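/- arXiv:math/0110096 — 2 statements merged into one kernel-verified Lean document; each statement's English description precedes it below -/
import Mathlib

section
/- (Eagon–Reiner) Let Δ be a simplicial complex on vertex set {1,…,d} and k a field. The Stanley–Reisner ring S/I_Δ is Cohen–Macaulay if and only if the Stanley–Reisner ideal I_{Δ*} of the Alexander dual complex Δ* has a linear free resolution over S. -/
attribute [local instance] Classical.propDecidable

set_option synthInstance.maxHeartbeats 1000000
set_option maxHeartbeats 4000000

noncomputable section

namespace EagonReiner

variable (k : Type) [Field k] (d : ℕ)

/-- The polynomial ring `S = k[z₁, …, z_d]` with its standard grading. -/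
abbrev S : Type := MvPolynomial (Fin d) k

/-- The Stanley--Reisner ideal of a simplicial complex `Δ` on `{1, …, d}`:
the ideal generated by the squarefree monomials `∏_{i ∈ σ} z_i` for `σ ∉ Δ`. -/
def srIdeal (Δ : Finset (Finset (Fin d))) : Ideal (S k d) :=
  Ideal.span {m | ∃ σ : Finset (Fin d), σ ∉ Δ ∧ m = ∏ i ∈ σ, MvPolynomial.X i}

/-- The Stanley--Reisner ideal of the Alexander dual complex
`Δ* = {[d] ∖ σ | σ ∉ Δ}`: since `τ ∉ Δ*` iff `τᶜ ∈ Δ`, it is generated by the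
squarefree monomials `∏_{i ∈ σ} z_i` with `σᶜ ∈ Δ`. -/
def dualSRIdeal (Δ : Finset (Finset (Fin d))) : Ideal (S k d) :=
  Ideal.span {m | ∃ σ : Finset (Fin d), σᶜ ∈ Δ ∧ m = ∏ i ∈ σ, MvPolynomial.X i}

/-- The irrelevant maximal ideal `(z₁, …, z_d)` of `S`. -/
def polyMaxIdeal : Ideal (S k d) :=
  Ideal.span (Set.range (MvPolynomial.X : Fin d → S k d))

/-- `S/I` is a Cohen--Macaulay ring: there is a regular sequence inside the
irrelevant maximal ideal with length equal to the Krull dimension.  (For finitely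
generated graded `k`-algebras this is equivalent to the usual definition of
Cohen--Macaulayness.) -/
def PolyRingIsCM (I : Ideal (S k d)) : Prop :=
  ∃ rs : List (S k d ⧸ I),
    (∀ r ∈ rs, r ∈ (polyMaxIdeal k d).map (Ideal.Quotient.mk I)) ∧
    RingTheory.Sequence.IsRegular (S k d ⧸ I) rs ∧
    (rs.length : WithBot (WithTop ℕ)) = ringKrullDim (S k d ⧸ I)

/-- The map `S^{b₀} → S` sending the `j`-th basis vector to `g j`. -/
def toModuleMap {b0 : ℕ} (g : Fin b0 → S k d) : (Fin b0 → S k d) →ₗ[S k d] S k d :=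
  ∑ j, (LinearMap.proj j).smulRight (g j)

/-- `N` has a linear free resolution: there is a free resolution
`⋯ → S^{b₁} → S^{b₀} → N → 0` in which the generators map to homogeneous elements
of a single degree `r` and all the matrices of the differentials are filled with
linear forms (equivalently, the minimal graded free resolution of `N` satisfies
`F_i` generated in degree `r + i`). -/
def HasLinearFreeResolution (N : Ideal (S k d)) : Prop :=
  ∃ (b : ℕ → ℕ) (r : ℕ) (g : Fin (b 0) → S k d)
    (f : (n : ℕ) → ((Fin (b (n+1)) → S k d) →ₗ[S k d] (Fin (b n) → S k d))),
    (∀ j, (g j).IsHomogeneous r) ∧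
    LinearMap.range (toModuleMap k d g) = N ∧
    (∀ (n : ℕ) (j : Fin (b (n+1))) (j' : Fin (b n)),
      MvPolynomial.IsHomogeneous (f n (Pi.single j 1) j') 1) ∧
    Function.Exact ⇑(f 0) ⇑(toModuleMap k d g) ∧
    (∀ n : ℕ, Function.Exact ⇑(f (n+1)) ⇑(f n))

section helpers

variable {k} {d}

/-- Koszul sign. -/
def sg (i : Fin d) (τ : Finset (Fin d)) : ℤ := ∏ j ∈ τ, if j < i then -1 else 1

theorem sg_insert {i j : Fin d} {τ : Finset (Fin d)} (h : j ∉ τ) :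
    sg i (insert j τ) = (if j < i then -1 else 1) * sg i τ := by
  unfold sg
  rw [Finset.prod_insert h]

theorem sg_insert_self {i : Fin d} {τ : Finset (Fin d)} (h : i ∉ τ) :
    sg i (insert i τ) = sg i τ := by
  simp [sg_insert h]

theorem sg_mul_self (i : Fin d) (τ : Finset (Fin d)) : sg i τ * sg i τ = 1 := by
  unfold sg
  rw [← Finset.prod_mul_distrib]
  apply Finset.prod_eq_one
  intro j _
  split_ifs <;> simp

theorem sg_erase {i : Fin d} {τ : Finset (Fin d)} (h : i ∈ τ) :
    sg i (τ.erase i) = sg i τ := by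
  conv_rhs => rw [← Finset.insert_erase h]
  rw [sg_insert_self (Finset.notMem_erase i τ)]

section ops
variable {R : Type*} [CommRing R] {M : Type*} [AddCommGroup M] [Module R M]

variable (R) in
/-- Contraction operator. -/
def dI (i : Fin d) : (Finset (Fin d) → M) →ₗ[R] (Finset (Fin d) → M) where
  toFun c τ := if i ∈ τ then 0 else sg i τ • c (insert i τ)
  map_add' c c' := by
    funext τ
    simp only [Pi.add_apply]
    split_ifs <;> simp
  map_smul' a c := by
    funext τ
    simp only [Pi.smul_apply, RingHom.id_apply]
    split_ifs
    · simp
    · rw [smul_comm]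

variable (R) in
/-- Wedge operator. -/
def eI (i : Fin d) : (Finset (Fin d) → M) →ₗ[R] (Finset (Fin d) → M) where
  toFun c τ := if i ∈ τ then sg i τ • c (τ.erase i) else 0
  map_add' c c' := by
    funext τ
    simp only [Pi.add_apply]
    split_ifs <;> simp
  map_smul' a c := by
    funext τ
    simp only [Pi.smul_apply, RingHom.id_apply]
    split_ifs
    · rw [smul_comm]
    · simp

theorem dI_apply (i : Fin d) (c : Finset (Fin d) → M) (τ : Finset (Fin d)) :
    dI R i c τ = if i ∈ τ then 0 else sg i τ • c (insert i τ) := rfl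

theorem eI_apply (i : Fin d) (c : Finset (Fin d) → M) (τ : Finset (Fin d)) :
    eI R i c τ = if i ∈ τ then sg i τ • c (τ.erase i) else 0 := rfl

theorem dI_dI_self (i : Fin d) (c : Finset (Fin d) → M) : dI R i (dI R i c) = 0 := by
  funext τ
  simp [dI_apply]

theorem dI_dI (i j : Fin d) (h : i ≠ j) (c : Finset (Fin d) → M) :
    dI R i (dI R j c) + dI R j (dI R i c) = 0 := by
  funext τ
  simp only [dI_apply, Pi.add_apply, Pi.zero_apply, Finset.mem_insert]
  by_cases hi : i ∈ τ
  · simp [hi]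
  by_cases hj : j ∈ τ
  · simp [hj]
  simp only [hi, hj, h, h.symm, or_self, if_false]
  rw [sg_insert hi, sg_insert hj, Finset.insert_comm, smul_smul, smul_smul, ← add_smul]
  rcases lt_or_gt_of_ne h with h1 | h1
  · rw [if_pos h1, if_neg (asymm h1)]
    convert zero_smul ℤ _
    ring
  · rw [if_pos h1, if_neg (asymm h1)]
    convert zero_smul ℤ _
    ring

theorem dI_eI_self (i : Fin d) (c : Finset (Fin d) → M) :
    dI R i (eI R i c) + eI R i (dI R i c) = c := by
  funext τ
  simp only [dI_apply, eI_apply, Pi.add_apply]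
  by_cases hi : i ∈ τ
  · simp only [hi, if_true, Finset.notMem_erase, if_false, zero_add, Finset.insert_erase hi]
    rw [sg_erase hi, smul_smul, sg_mul_self, one_smul]
  · simp only [hi, if_false, Finset.mem_insert_self, if_true, add_zero, Finset.erase_insert hi]
    rw [sg_insert_self hi, smul_smul, sg_mul_self, one_smul]

theorem dI_eI (i j : Fin d) (h : i ≠ j) (c : Finset (Fin d) → M) :
    dI R i (eI R j c) + eI R j (dI R i c) = 0 := by
  funext τ
  simp only [dI_apply, eI_apply, Pi.add_apply, Finset.mem_insert, Pi.zero_apply, Finset.mem_erase]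
  by_cases hi : i ∈ τ
  · simp [hi, h]
  by_cases hj : j ∈ τ
  swap
  · simp [hj, h.symm]
  simp only [hi, hj, if_false, if_true, or_true, and_false]
  obtain ⟨τ, hj', rfl⟩ : ∃ τ', j ∉ τ' ∧ τ = insert j τ' :=
    ⟨τ.erase j, Finset.notMem_erase j τ, (Finset.insert_erase hj).symm⟩
  have hi' : i ∉ τ := fun hh => hi (Finset.mem_insert_of_mem hh)
  rw [Finset.erase_insert hj', Finset.insert_comm,
    Finset.erase_insert (by simp [hj', h.symm]), sg_insert hj', sg_insert_self hj',
    sg_insert_self (by simp [hj', h.symm]), sg_insert hi',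
    smul_smul, smul_smul, ← add_smul]
  rcases lt_or_gt_of_ne h with h1 | h1
  · rw [if_pos h1, if_neg (asymm h1)]
    convert zero_smul ℤ _
    ring
  · rw [if_pos h1, if_neg (asymm h1)]
    convert zero_smul ℤ _
    ring

/-- Koszul differential. -/
def bd (x : Fin d → R) : (Finset (Fin d) → M) →ₗ[R] (Finset (Fin d) → M) :=
  ∑ i, x i • dI R i

theorem bd_eq (x : Fin d → R) (c : Finset (Fin d) → M) : bd x c = ∑ i, x i • dI R i c := by
  simp [bd]

theorem bd_apply (x : Fin d → R) (c : Finset (Fin d) → M) (τ : Finset (Fin d)) :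
    bd x c τ = ∑ i, x i • (if i ∈ τ then 0 else sg i τ • c (insert i τ)) := by
  simp [bd, dI_apply]

theorem bd_bd (x : Fin d → R) (c : Finset (Fin d) → M) : bd x (bd x c) = 0 := by
  rw [bd_eq x (bd x c)]
  simp only [bd_eq x c, map_sum, map_smul, Finset.smul_sum]
  rw [← Finset.sum_product']
  refine Finset.sum_involution (fun p _ => (p.2, p.1)) ?_ ?_ ?_ ?_
  · rintro ⟨i, j⟩ _
    by_cases h : i = j
    · subst h
      simp [dI_dI_self]
    · simp only
      rw [smul_comm (x j), ← smul_add, ← smul_add, dI_dI i j h, smul_zero, smul_zero]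
  · rintro ⟨i, j⟩ _ h1 h2
    simp only [Prod.mk.injEq] at h2
    obtain ⟨h2, -⟩ := h2
    subst h2
    simp [dI_dI_self] at h1
  · simp
  · simp

theorem bd_eI (x : Fin d → R) (j : Fin d) (c : Finset (Fin d) → M) :
    bd x (eI R j c) + eI R j (bd x c) = x j • c := by
  rw [bd_eq, bd_eq, map_sum, ← Finset.sum_add_distrib]
  rw [Finset.sum_eq_single j]
  · rw [map_smul, ← smul_add, dI_eI_self]
  · intro i _ hi
    rw [map_smul, ← smul_add, dI_eI i j hi, smul_zero]
  · simp

theorem bd_dI (x : Fin d → R) (j : Fin d) (c : Finset (Fin d) → M) :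
    bd x (dI R j c) = - dI R j (bd x c) := by
  rw [eq_neg_iff_add_eq_zero, bd_eq, bd_eq, map_sum, ← Finset.sum_add_distrib]
  apply Finset.sum_eq_zero
  intro i _
  rw [map_smul, ← smul_add]
  by_cases h : i = j
  · subst h
    simp [dI_dI_self]
  · rw [dI_dI i j h, smul_zero]

/-- Supported in cardinality `i`. -/
def SC {N : Type*} [Zero N] (i : ℕ) (c : Finset (Fin d) → N) : Prop :=
  ∀ τ : Finset (Fin d), τ.card ≠ i → c τ = 0

theorem SC.bd {i : ℕ} {c : Finset (Fin d) → M} (hc : SC (i + 1) c) (x : Fin d → R) :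
    SC i (bd x c) := by
  intro τ hτ
  rw [bd_apply]
  apply Finset.sum_eq_zero
  intro j _
  split_ifs with h
  · simp
  · rw [hc, smul_zero, smul_zero]
    rw [Finset.card_insert_of_notMem h]
    omega

theorem SC.eI {i : ℕ} {c : Finset (Fin d) → M} (hc : SC i c) (j : Fin d) :
    SC (i + 1) (eI R j c) := by
  intro τ hτ
  rw [eI_apply]
  split_ifs with h
  · rw [hc, smul_zero]
    rw [Finset.card_erase_of_mem h]
    have := Finset.card_pos.2 ⟨j, h⟩
    omega
  · rfl

theorem bd_zero_of_SC_zero {c : Finset (Fin d) → M} (hc : SC 0 c) (x : Fin d → R) :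
    EagonReiner.bd x c = 0 := by
  funext τ
  rw [bd_apply]
  apply Finset.sum_eq_zero
  intro j _
  split_ifs with h
  · simp
  · rw [hc, smul_zero, smul_zero]
    rw [Finset.card_insert_of_notMem h]
    omega

theorem SC.add {i : ℕ} {c c' : Finset (Fin d) → M} (hc : SC i c) (hc' : SC i c') :
    SC i (c + c') := fun τ h => by simp [hc τ h, hc' τ h]

theorem SC.sub {i : ℕ} {c c' : Finset (Fin d) → M} (hc : SC i c) (hc' : SC i c') :
    SC i (c - c') := fun τ h => by simp [hc τ h, hc' τ h]

theorem SC.smul {i : ℕ} {c : Finset (Fin d) → M} (hc : SC i c) (r : R) :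
    SC i (r • c) := fun τ h => by simp [hc τ h]

/-- Naturality. -/
theorem bd_map {R' : Type*} [CommRing R'] {M' : Type*} [AddCommGroup M'] [Module R' M']
    (f : M →+ M') (x : Fin d → R) (x' : Fin d → R')
    (hf : ∀ i m, f (x i • m) = x' i • f m) (c : Finset (Fin d) → M) (τ : Finset (Fin d)) :
    f (bd x c τ) = bd x' (fun τ => f (c τ)) τ := by
  rw [bd_apply, bd_apply, map_sum]
  apply Finset.sum_congr rfl
  intro i _
  rw [hf]
  split_ifs
  · simp
  · rw [map_zsmul]

theorem bd_congr (x : Fin d → R) {c c' : Finset (Fin d) → M}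
    {τ : Finset (Fin d)} (h : ∀ i ∉ τ, c (insert i τ) = c' (insert i τ)) :
    bd x c τ = bd x c' τ := by
  rw [bd_apply, bd_apply]
  apply Finset.sum_congr rfl
  intro i _
  split_ifs with hi
  · rfl
  · rw [h i hi]
end ops
end helpers

section helpers

variable {k} {d}

variable (k) in
/-- Unweighted simplicial differential. -/
abbrev del (u : Finset (Fin d) → k) : Finset (Fin d) → k := bd (R := k) (fun _ => 1) u

variable (k) in
/-- Exactness at cardinality `i` of the complex spanned by the family `P`. -/
def Ex (P : Finset (Fin d) → Prop) (i : ℕ) : Prop :=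
  ∀ u : Finset (Fin d) → k, (∀ τ, ¬ (P τ ∧ τ.card = i) → u τ = 0) →
    (∀ τ, P τ → del k u τ = 0) →
    ∃ w : Finset (Fin d) → k, (∀ τ, ¬ (P τ ∧ τ.card = i + 1) → w τ = 0) ∧
      ∀ τ, P τ → del k w τ = u τ

theorem Ex_of_empty {P : Finset (Fin d) → Prop} {i : ℕ} (h : ∀ τ, P τ → τ.card ≠ i) :
    Ex k P i := by
  intro u hu _
  have : u = 0 := by
    funext τ
    exact hu τ (fun hh => h τ hh.1 hh.2)
  subst this
  exact ⟨0, fun _ _ => rfl, fun τ _ => by simp [del]⟩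

theorem Ex_of_toggle {P : Finset (Fin d) → Prop} (i : ℕ) (j : Fin d)
    (h1 : ∀ τ, P τ → P (insert j τ)) (h2 : ∀ τ, P τ → P (τ.erase j)) :
    Ex k P i := by
  intro u hu hdu
  refine ⟨eI k j u, ?_, ?_⟩
  · intro τ hτ
    rw [eI_apply]
    split_ifs with hj
    · rw [hu, smul_zero]
      rintro ⟨h3, h4⟩
      apply hτ
      refine ⟨?_, ?_⟩
      · have := h1 _ h3
        rwa [Finset.insert_erase hj] at this
      · rw [← h4, Finset.card_erase_add_one hj]
    · rfl
  · intro τ hτ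
    have := congrFun (bd_eI (R := k) (fun _ => (1:k)) j u) τ
    simp only [one_smul, Pi.add_apply] at this
    have h0 : bd (R := k) (fun _ => (1:k)) u (τ.erase j) = 0 := hdu _ (h2 _ hτ)
    rw [← this]
    rw [eI_apply, h0]
    simp [del]

/-- two-parameter family -/
def PF (Δ : Finset (Finset (Fin d))) (ρ σ τ : Finset (Fin d)) : Prop :=
  τ ⊆ σ ∧ ρ ∪ (σ \ τ) ∈ Δ

section leray
variable {Δ : Finset (Finset (Fin d))}

theorem PF_insert_notMem {ρ σ τ : Finset (Fin d)} {v : Fin d} (_hv : v ∉ σ) :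
    v ∉ τ → (PF Δ ρ (insert v σ) τ ↔ PF Δ (insert v ρ) σ τ) := by
  intro h
  unfold PF
  rw [Finset.subset_insert_iff_of_notMem h, Finset.insert_sdiff_of_notMem _ h,
    Finset.union_insert, Finset.insert_union]

theorem PF_insert_mem {ρ σ τ : Finset (Fin d)} {v : Fin d} (hv : v ∉ σ) (h : v ∉ τ) :
    (PF Δ ρ (insert v σ) (insert v τ) ↔ PF Δ ρ σ τ) := by
  unfold PF
  rw [Finset.insert_subset_insert_iff h, Finset.insert_sdiff_insert,
    Finset.sdiff_insert_of_notMem hv]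

theorem PF_mono (hΔ : ∀ σ ∈ Δ, ∀ τ ⊆ σ, τ ∈ Δ)
    {ρ σ τ : Finset (Fin d)} {v : Fin d} (h : PF Δ (insert v ρ) σ τ) : PF Δ ρ σ τ :=
  ⟨h.1, hΔ _ h.2 _ (Finset.union_subset_union_left (Finset.subset_insert _ _))⟩

theorem PF_up (hΔ : ∀ σ ∈ Δ, ∀ τ ⊆ σ, τ ∈ Δ)
    {ρ σ τ τ' : Finset (Fin d)} (h : PF Δ ρ σ τ) (h1 : τ ⊆ τ') (h2 : τ' ⊆ σ) :
    PF Δ ρ σ τ' :=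
  ⟨h2, hΔ _ h.2 _ (Finset.union_subset_union_right (Finset.sdiff_subset_sdiff le_rfl h1))⟩

theorem PF.notMem {ρ σ τ : Finset (Fin d)} {v : Fin d} (h : PF Δ ρ σ τ) (hv : v ∉ σ) : v ∉ τ :=
  fun hh => hv (h.1 hh)

theorem leray1 (hΔ : ∀ σ ∈ Δ, ∀ τ ⊆ σ, τ ∈ Δ)
    {ρ σ : Finset (Fin d)} {v : Fin d} (hv : v ∉ σ) {i : ℕ}
    (h1 : Ex k (PF Δ ρ σ) i) (h2 : Ex k (PF Δ ρ (insert v σ)) i) :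
    Ex k (PF Δ (insert v ρ) σ) i := by
  intro u hu hdu
  have hu0 : ∀ τ, v ∈ τ → u τ = 0 := fun τ hτ => hu τ (fun hh => hh.1.notMem hv hτ)
  obtain ⟨W, hW, hdW⟩ := h2 u (by
      intro τ hτ
      by_cases hvτ : v ∈ τ
      · exact hu0 _ hvτ
      · rw [PF_insert_notMem hv hvτ] at hτ
        exact hu τ hτ) (by
      intro τ hτ
      by_cases hvτ : v ∈ τ
      · rw [del, bd_apply]
        apply Finset.sum_eq_zero
        intro j _
        rw [hu0 _ (Finset.mem_insert_of_mem hvτ)]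
        simp
      · rw [PF_insert_notMem hv hvτ] at hτ
        exact hdu τ hτ)
  obtain ⟨y, hy, hdy⟩ := h1 (dI k v W) (by
      intro τ hτ
      rw [dI_apply]
      split_ifs with hvτ
      · rfl
      · rw [hW, smul_zero]
        rw [PF_insert_mem hv hvτ, Finset.card_insert_of_notMem hvτ]
        simpa using hτ) (by
      intro τ hτ
      have hvτ := hτ.notMem hv
      rw [del, bd_dI, Pi.neg_apply, dI_apply, if_neg hvτ]
      have := hdW (insert v τ) ((PF_insert_mem hv hvτ).2 hτ)
      rw [del] at this
      rw [this, hu0 _ (Finset.mem_insert_self _ _)]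
      simp)
  refine ⟨fun τ => (if v ∈ τ then 0 else W τ) + (if PF Δ (insert v ρ) σ τ then y τ else 0), ?_, ?_⟩
  · intro τ hτ
    simp only
    split_ifs with a b b
    · exact absurd a (b.notMem hv)
    · simp
    · rw [hW, hy, add_zero]
      · intro hh
        exact hτ ⟨b, hh.2⟩
      · rw [PF_insert_notMem hv a]
        exact hτ
    · rw [hW, add_zero]
      · rw [PF_insert_notMem hv a]
        exact hτ
  · intro τ hτ
    have hvτ := hτ.notMem hv
    have e1 := hdW τ ((PF_insert_notMem hv hvτ).2 hτ)
    have e2 := hdy τ (PF_mono hΔ hτ)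
    rw [← e1]
    have e3 : del k (fun τ => if PF Δ (insert v ρ) σ τ then y τ else 0) τ = del k y τ := by
      apply bd_congr
      intro j hj
      split_ifs with hh
      · rfl
      · by_cases hjσ : insert j τ ⊆ σ
        · exact absurd (PF_up hΔ hτ (Finset.subset_insert j τ) hjσ) hh
        · rw [hy]
          intro h3
          exact hjσ h3.1.1
    have e4 : (fun τ => (if v ∈ τ then 0 else W τ) + (if PF Δ (insert v ρ) σ τ then y τ else 0)) =
      (fun τ => (if v ∈ τ then 0 else W τ)) + (fun τ => if PF Δ (insert v ρ) σ τ then y τ else 0) := rfl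
    rw [e4, del, map_add, Pi.add_apply]
    rw [del] at e3
    rw [e3, ← del, e2]
    have e5 : (fun τ => (if v ∈ τ then 0 else W τ)) = W - eI k v (dI k v W) := by
      rw [eq_sub_iff_add_eq]
      funext τ
      simp only [Pi.add_apply, eI_apply, dI_apply]
      by_cases hh : v ∈ τ
      · simp only [hh, if_true, Finset.notMem_erase, if_false, zero_add, Finset.insert_erase hh]
        rw [sg_erase hh, smul_smul, sg_mul_self, one_smul]
      · simp [hh]
    rw [del, e5, map_sub, Pi.sub_apply]
    have e6 := congrFun (bd_eI (R := k) (fun _ => (1:k)) v (dI k v W)) τ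
    simp only [one_smul, Pi.add_apply] at e6
    rw [← e6, eI_apply, if_neg hvτ]
    simp [del]

theorem leray2 (hΔ : ∀ σ ∈ Δ, ∀ τ ⊆ σ, τ ∈ Δ)
    {ρ σ : Finset (Fin d)} {v : Fin d} (hv : v ∉ σ) {i : ℕ}
    (h1 : Ex k (PF Δ (insert v ρ) σ) i) (h2 : Ex k (PF Δ ρ (insert v σ)) (i + 1)) :
    Ex k (PF Δ ρ σ) i := by
  intro u hu hdu
  have hu0 : ∀ τ, v ∈ τ → u τ = 0 := fun τ hτ => hu τ (fun hh => hh.1.notMem hv hτ)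
  obtain ⟨w, hw, hdw⟩ := h1 (fun τ => if PF Δ (insert v ρ) σ τ then u τ else 0) (by
      intro τ hτ
      split_ifs with a
      · exact hu τ (fun hh => hτ ⟨a, hh.2⟩)
      · rfl) (by
      intro τ hτ
      refine Eq.trans ?_ (hdu τ (PF_mono hΔ hτ))
      apply bd_congr
      intro j hj
      split_ifs with hh
      · rfl
      · by_cases hjσ : insert j τ ⊆ σ
        · exact absurd (PF_up hΔ hτ (Finset.subset_insert j τ) hjσ) hh
        · rw [hu]
          intro h3
          exact hjσ h3.1.1)
  have hw0 : ∀ τ, v ∈ τ → w τ = 0 := fun τ hτ => hw τ (fun hh => hh.1.notMem hv hτ)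
  obtain ⟨Y, hY, hdY⟩ := h2 (eI k v u - w) (by
      intro τ hτ
      rw [Pi.sub_apply, eI_apply]
      by_cases hvτ : v ∈ τ
      · rw [hw0 _ hvτ, if_pos hvτ, hu, smul_zero, sub_zero]
        intro hh
        apply hτ
        rw [← Finset.insert_erase hvτ, PF_insert_mem hv (Finset.notMem_erase v τ),
          Finset.card_insert_of_notMem (Finset.notMem_erase v τ), hh.2]
        exact ⟨hh.1, rfl⟩
      · rw [if_neg hvτ, hw, sub_zero]
        rwa [PF_insert_notMem hv hvτ] at hτ) (by
      intro τ hτ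
      rw [del, map_sub, Pi.sub_apply]
      have e6 := congrFun (bd_eI (R := k) (fun _ => (1:k)) v u) τ
      simp only [one_smul, Pi.add_apply] at e6
      rw [← eq_sub_iff_add_eq] at e6
      rw [e6, eI_apply]
      by_cases hvτ : v ∈ τ
      · rw [if_pos hvτ, hu0 _ hvτ, ← del, hdu]
        · rw [bd_apply, Finset.sum_eq_zero]
          · simp
          intro j _
          rw [hw0 _ (Finset.mem_insert_of_mem hvτ)]
          simp
        · rwa [← Finset.insert_erase hvτ, PF_insert_mem hv (Finset.notMem_erase v τ)] at hτ
      · rw [if_neg hvτ, ← del, hdw]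
        · rw [PF_insert_notMem hv hvτ] at hτ
          rw [if_pos hτ]
          simp
        · rwa [PF_insert_notMem hv hvτ] at hτ)
  refine ⟨- dI k v Y, ?_, ?_⟩
  · intro τ hτ
    rw [Pi.neg_apply, dI_apply]
    split_ifs with hvτ
    · simp
    · rw [hY, smul_zero, neg_zero]
      rw [PF_insert_mem hv hvτ, Finset.card_insert_of_notMem hvτ]
      simpa using hτ
  · intro τ hτ
    have hvτ := hτ.notMem hv
    rw [del, map_neg, bd_dI, neg_neg, dI_apply, if_neg hvτ, ← del,
      hdY _ ((PF_insert_mem hv hvτ).2 hτ), Pi.sub_apply, hw0 _ (Finset.mem_insert_self _ _),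
      eI_apply, if_pos (Finset.mem_insert_self _ _), Finset.erase_insert hvτ, sg_insert_self hvτ,
      sub_zero, smul_smul, sg_mul_self, one_smul]

theorem leray (hΔ : ∀ σ ∈ Δ, ∀ τ ⊆ σ, τ ∈ Δ)
    (r : ℕ) : (∀ σ, ∀ i, r < i → Ex k (PF Δ ∅ σ) i) ↔
    (∀ σ, ∀ i, r < i → Ex k (PF Δ σᶜ σ) i) := by
  constructor
  · intro h
    have key : ∀ ρ σ : Finset (Fin d), Disjoint ρ σ → ∀ i, r < i → Ex k (PF Δ ρ σ) i := by
      intro ρ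
      induction ρ using Finset.induction_on with
      | empty => intro σ _; exact h σ
      | insert v ρ hvρ ih =>
        intro σ hd i hi
        rw [Finset.disjoint_insert_left] at hd
        apply leray1 hΔ hd.1 (ih σ hd.2 i hi) (ih (insert v σ) _ i hi)
        rw [Finset.disjoint_insert_right]
        exact ⟨hvρ, hd.2⟩
    intro σ
    exact key _ _ disjoint_compl_left
  · intro h
    have key : ∀ α ρ σ : Finset (Fin d), Disjoint ρ σ → α = (ρ ∪ σ)ᶜ →
        ∀ i, r < i → Ex k (PF Δ ρ σ) i := by
      intro α
      induction α using Finset.induction_on with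
      | empty =>
        intro ρ σ hd he
        have : ρ = σᶜ := by
          apply IsCompl.eq_compl
          refine ⟨hd, ?_⟩
          rw [codisjoint_iff]
          simpa using (compl_eq_bot.1 he.symm)
        rw [this]
        exact h σ
      | insert v α hv ih =>
        intro ρ σ hd he i hi
        have hvm : v ∈ (ρ ∪ σ)ᶜ := by rw [← he]; exact Finset.mem_insert_self _ _
        simp only [Finset.mem_compl, Finset.mem_union, not_or] at hvm
        have hα : α = (insert v (ρ ∪ σ))ᶜ := by
          rw [Finset.compl_insert, ← he, Finset.erase_insert hv]
        apply leray2 hΔ hvm.2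
        · apply ih _ _ _ _ _ hi
          · rw [Finset.disjoint_insert_left]
            exact ⟨hvm.2, hd⟩
          · rw [Finset.insert_union, hα]
        · apply ih _ _ _ _ _ (by omega)
          · rw [Finset.disjoint_insert_right]
            exact ⟨hvm.1, hd⟩
          · rw [Finset.union_insert, hα]
    intro σ
    exact key _ ∅ σ (by simp) rfl
end leray
end helpers

section helpers

variable {k} {d}

/-- Unweighted simplicial codifferential. -/
def cob (y : Finset (Fin d) → k) : Finset (Fin d) → k := fun τ => ∑ i, eI k i y τ

theorem dI_adj (i : Fin d) (w y : Finset (Fin d) → k) :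
    ∑ τ, dI k i w τ * y τ = ∑ τ, w τ * eI k i y τ := by
  simp only [dI_apply, eI_apply, ite_mul, mul_ite, zero_mul, mul_zero]
  have e0 : (∑ τ : Finset (Fin d), if i ∈ τ then 0 else sg i τ • w (insert i τ) * y τ) =
      ∑ τ : Finset (Fin d), if ¬ i ∈ τ then sg i τ • w (insert i τ) * y τ else 0 := by
    apply Finset.sum_congr rfl
    intro τ _
    by_cases h : i ∈ τ <;> simp [h]
  rw [e0, ← Finset.sum_filter, ← Finset.sum_filter]
  refine Finset.sum_bij' (fun τ _ => insert i τ) (fun τ _ => τ.erase i) ?_ ?_ ?_ ?_ ?_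
  · intro τ h; simp
  · intro τ h; simp
  · intro τ h
    exact Finset.erase_insert (by simpa using h)
  · intro τ h
    exact Finset.insert_erase (by simpa using h)
  · intro τ h
    have h : i ∉ τ := by simpa using h
    rw [Finset.erase_insert h, sg_insert_self h, smul_mul_assoc, mul_smul_comm]

theorem del_adj (w y : Finset (Fin d) → k) :
    ∑ τ, del k w τ * y τ = ∑ τ, w τ * cob y τ := by
  simp only [del, bd_eq, cob, one_smul, Finset.sum_apply, Finset.sum_mul, Finset.mul_sum]
  rw [Finset.sum_comm, Finset.sum_comm (s := (Finset.univ : Finset (Finset (Fin d))))]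
  exact Finset.sum_congr rfl (fun i _ => dI_adj i w y)

theorem Ex_dual {P : Finset (Fin d) → Prop} {i : ℕ} (h : Ex k P i) (y : Finset (Fin d) → k)
    (hy : ∀ τ, ¬ (P τ ∧ τ.card = i) → y τ = 0) (hdy : ∀ τ, P τ → cob y τ = 0) :
    ∃ z : Finset (Fin d) → k, (∀ τ, ¬ (P τ ∧ τ.card + 1 = i) → z τ = 0) ∧
      ∀ τ, P τ → cob z τ = y τ := by
  let pr (Q : Finset (Fin d) → Prop) : (Finset (Fin d) → k) →ₗ[k] (Finset (Fin d) → k) :=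
    { toFun := fun u τ => if Q τ then u τ else 0
      map_add' := by
        intro a b; funext τ; simp only [Pi.add_apply]; split_ifs <;> simp
      map_smul' := by
        intro a b; funext τ; simp only [Pi.smul_apply, RingHom.id_apply]; split_ifs <;> simp }
  have pr_apply : ∀ Q u τ, pr Q u τ = if Q τ then u τ else 0 := fun _ _ _ => rfl
  let g : (Finset (Fin d) → k) →ₗ[k] (Finset (Fin d) → k) :=
    pr P ∘ₗ bd (R := k) (fun _ => 1) ∘ₗ pr (fun τ => P τ ∧ τ.card = i)
  let ℓ : Module.Dual k (Finset (Fin d) → k) := ∑ τ, y τ • LinearMap.proj τ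
  have hℓ : ∀ u, ℓ u = ∑ τ, u τ * y τ := by
    intro u
    simp only [ℓ, LinearMap.sum_apply, LinearMap.smul_apply, LinearMap.proj_apply, smul_eq_mul]
    exact Finset.sum_congr rfl (fun _ _ => mul_comm _ _)
  have hmem : ℓ ∈ LinearMap.range g.dualMap := by
    rw [LinearMap.range_dualMap_eq_dualAnnihilator_ker, Submodule.mem_dualAnnihilator]
    intro u hu
    rw [LinearMap.mem_ker] at hu
    obtain ⟨w, hw, hdw⟩ := h (pr (fun τ => P τ ∧ τ.card = i) u) (by
      intro τ hτ
      rw [pr_apply, if_neg hτ]) (by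
      intro τ hτ
      have := congrFun hu τ
      simp only [g, LinearMap.comp_apply] at this
      rw [pr_apply, if_pos hτ] at this
      exact this)
    have e1 : ℓ u = ∑ τ, del k w τ * y τ := by
      rw [hℓ]
      apply Finset.sum_congr rfl
      intro τ _
      by_cases hτ : P τ ∧ τ.card = i
      · rw [hdw τ hτ.1, pr_apply, if_pos hτ]
      · rw [hy τ hτ, mul_zero, mul_zero]
    rw [e1, del_adj]
    apply Finset.sum_eq_zero
    intro τ _
    by_cases hτ : P τ
    · rw [hdy τ hτ, mul_zero]
    · rw [hw τ (fun hh => hτ hh.1), zero_mul]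
  obtain ⟨Z, hZ⟩ := hmem
  have hZ' : ∀ u, Z u = ∑ τ, u τ * Z (Pi.single τ 1) := by
    intro u
    have e0 : u = ∑ τ, Pi.single τ (u τ) := (Finset.univ_sum_single u).symm
    conv_lhs => rw [e0]
    rw [map_sum]
    apply Finset.sum_congr rfl
    intro τ _
    rw [← smul_eq_mul, ← map_smul]
    congr 1
    rw [← Pi.single_smul, smul_eq_mul, mul_one]
  let z : Finset (Fin d) → k := fun τ => if P τ ∧ τ.card + 1 = i then Z (Pi.single τ 1) else 0
  refine ⟨z, ?_, ?_⟩
  · intro τ hτ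
    simp only [z]
    rw [if_neg hτ]
  · intro η hη
    by_cases hc : η.card = i
    · have e1 : cob z η = ∑ τ, (Pi.single η 1 : Finset (Fin d) → k) τ * cob z τ := by
        rw [Finset.sum_eq_single η]
        · simp
        · intro b _ hb
          simp [Pi.single_eq_of_ne hb]
        · simp
      have e2 : y η = ℓ (Pi.single η 1) := by
        rw [hℓ, Finset.sum_eq_single η]
        · simp
        · intro b _ hb
          simp [Pi.single_eq_of_ne hb]
        · simp
      rw [e1, ← del_adj, e2, ← hZ, LinearMap.dualMap_apply, hZ']
      apply Finset.sum_congr rfl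
      intro τ _
      have e3 : pr (fun τ => P τ ∧ τ.card = i) (Pi.single η 1) = Pi.single η 1 := by
        funext τ
        rw [pr_apply]
        split_ifs with hh
        · rfl
        · rw [Pi.single_eq_of_ne]
          rintro rfl
          exact hh ⟨hη, hc⟩
      simp only [g, LinearMap.comp_apply]
      rw [e3, pr_apply]
      by_cases hP : P τ
      · rw [if_pos hP]
        by_cases hcτ : τ.card + 1 = i
        · simp only [z]
          rw [if_pos ⟨hP, hcτ⟩]
        · rw [del, bd_apply, Finset.sum_eq_zero]
          · simp
          · intro j _
            split_ifs with hj
            · simp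
            · rw [Pi.single_eq_of_ne]
              · simp
              · rintro rfl
                rw [Finset.card_insert_of_notMem hj] at hc
                exact hcτ hc
      · rw [if_neg hP]
        simp only [z]
        rw [if_neg (fun hh => hP hh.1)]
        simp
    · rw [hy η (fun hh => hc hh.2), cob]
      apply Finset.sum_eq_zero
      intro j _
      rw [eI_apply]
      split_ifs with hj
      · simp only [z]
        rw [if_neg, smul_zero]
        rintro ⟨-, h3⟩
        rw [Finset.card_erase_add_one hj] at h3
        exact hc h3
      · rfl

/-- The complement sign. -/
def eps (σ τ : Finset (Fin d)) : ℤ := ∏ j ∈ τ, sg j σ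

theorem eps_mul_self (σ τ : Finset (Fin d)) : eps σ τ * eps σ τ = 1 := by
  unfold eps
  rw [← Finset.prod_mul_distrib]
  exact Finset.prod_eq_one (fun j _ => sg_mul_self j σ)

theorem sg_sdiff {σ τ : Finset (Fin d)} (h : τ ⊆ σ) (i : Fin d) :
    sg i (σ \ τ) * sg i τ = sg i σ := by
  unfold sg
  exact Finset.prod_sdiff h

theorem eps_erase {σ τ : Finset (Fin d)} {i : Fin d} (h : i ∈ τ) :
    eps σ (τ.erase i) = eps σ τ * sg i σ := by
  unfold eps
  rw [← Finset.mul_prod_erase τ _ h, mul_comm (sg i σ), mul_assoc, sg_mul_self, mul_one]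

/-- Complementation with sign. -/
def til (σ : Finset (Fin d)) (y : Finset (Fin d) → k) : Finset (Fin d) → k :=
  fun τ => if τ ⊆ σ then eps σ τ • y (σ \ τ) else 0

theorem cob_til {σ : Finset (Fin d)} {y : Finset (Fin d) → k} (hy : ∀ τ, ¬ τ ⊆ σ → y τ = 0)
    {τ : Finset (Fin d)} (hτ : τ ⊆ σ) : cob (til σ y) τ = eps σ τ • del k y (σ \ τ) := by
  rw [cob, del, bd_apply, Finset.smul_sum]
  apply Finset.sum_congr rfl
  intro i _
  rw [eI_apply, one_smul]
  by_cases hi : i ∈ τ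
  · have hi2 : i ∉ σ \ τ := by simp [hi]
    rw [if_pos hi, if_neg hi2, til, if_pos ((Finset.erase_subset _ _).trans hτ), eps_erase hi,
      smul_smul, smul_smul]
    have : σ \ τ.erase i = insert i (σ \ τ) := by
      rw [Finset.sdiff_erase (hτ hi)]
    rw [this]
    congr 1
    rw [← sg_sdiff hτ i]
    linear_combination (eps σ τ * sg i (σ \ τ)) * sg_mul_self i τ
  · rw [if_neg hi]
    by_cases hi2 : i ∈ σ
    · rw [if_pos (by simp [hi, hi2])]
      simp
    · rw [if_neg (by simp [hi2]), hy]
      · simp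
      · intro hh
        exact hi2 (hh (Finset.mem_insert_self _ _))

theorem Ex_compl {P Q : Finset (Fin d) → Prop} {σ : Finset (Fin d)} (hP : ∀ τ, P τ → τ ⊆ σ)
    (hQ : ∀ τ, Q τ ↔ τ ⊆ σ ∧ P (σ \ τ)) {i : ℕ} (hi : i ≤ σ.card) (h : Ex k P i) :
    Ex k Q (σ.card - i) := by
  intro y hy hdy
  have hcard : ∀ τ, τ ⊆ σ → (σ \ τ).card + τ.card = σ.card := fun τ hτ =>
    Finset.card_sdiff_add_card_eq_card hτ
  have hy' : ∀ τ, ¬ τ ⊆ σ → y τ = 0 := fun τ hτ => hy τ (fun hh => hτ ((hQ τ).1 hh.1).1)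
  have hPQ : ∀ τ, P τ → Q (σ \ τ) := fun τ hτ => (hQ _).2
    ⟨Finset.sdiff_subset, by rwa [Finset.sdiff_sdiff_eq_self (hP τ hτ)]⟩
  obtain ⟨z, hz, hdz⟩ := Ex_dual h (til σ y) (by
      intro τ hτ
      rw [til]
      split_ifs with hs
      · rw [hy, smul_zero]
        rw [hQ, Finset.sdiff_sdiff_eq_self hs]
        rintro ⟨⟨-, h1⟩, h2⟩
        have := hcard τ hs
        exact hτ ⟨h1, by omega⟩
      · rfl) (by
      intro τ hτ
      rw [cob_til hy' (hP τ hτ), hdy _ (hPQ τ hτ), smul_zero])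
  have hz' : ∀ τ, ¬ τ ⊆ σ → z τ = 0 := fun τ hτ => hz τ (fun hh => hτ (hP _ hh.1))
  let w : Finset (Fin d) → k := fun η => if η ⊆ σ then eps σ (σ \ η) • z (σ \ η) else 0
  have hw' : ∀ τ, ¬ τ ⊆ σ → w τ = 0 := fun τ hτ => by simp only [w]; rw [if_neg hτ]
  have hzw : z = til σ w := by
    funext τ
    rw [til]
    split_ifs with hs
    · simp only [w]
      rw [if_pos Finset.sdiff_subset, Finset.sdiff_sdiff_eq_self hs, smul_smul, eps_mul_self,
        one_smul]
    · exact hz' τ hs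
  refine ⟨w, ?_, ?_⟩
  · intro τ hτ
    simp only [w]
    split_ifs with hs
    · rw [hz, smul_zero]
      rintro ⟨h1, h2⟩
      apply hτ
      have := hcard τ hs
      exact ⟨(hQ τ).2 ⟨hs, h1⟩, by omega⟩
    · rfl
  · intro η hη
    obtain ⟨hs, h1⟩ := (hQ η).1 hη
    have e1 := hdz _ h1
    rw [hzw, cob_til hw' Finset.sdiff_subset, til, if_pos Finset.sdiff_subset,
      Finset.sdiff_sdiff_eq_self hs] at e1
    have e2 := congrArg (fun t => eps σ (σ \ η) • t) e1
    simpa only [smul_smul, eps_mul_self, one_smul] using e2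
end helpers

section helpers

variable {k} {d}

open MvPolynomial in
/-- Indicator exponent. -/
def ind (τ : Finset (Fin d)) : Fin d →₀ ℕ :=
  Finsupp.equivFunOnFinite.symm (fun j => if j ∈ τ then 1 else 0)

theorem ind_apply (τ : Finset (Fin d)) (j : Fin d) : ind τ j = if j ∈ τ then 1 else 0 := rfl

theorem degree_ind (τ : Finset (Fin d)) : (ind τ).degree = τ.card := by
  rw [Finsupp.degree_eq_sum]
  simp [ind_apply]

theorem ind_insert_le {A : Fin d →₀ ℕ} {τ : Finset (Fin d)} {i : Fin d} (hi : i ∉ τ)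
    (h : ind τ ≤ A) : ind (insert i τ) ≤ A ↔ i ∈ (A - ind τ).support := by
  rw [Finsupp.mem_support_iff, Finsupp.tsub_apply, ind_apply, if_neg hi]
  constructor
  · intro hh
    have := hh i
    rw [ind_apply, if_pos (Finset.mem_insert_self _ _)] at this
    omega
  · intro hh j
    rw [ind_apply]
    by_cases hj : j = i
    · subst hj
      rw [if_pos (Finset.mem_insert_self _ _)]
      omega
    · have := h j
      rw [ind_apply] at this
      simpa [hj] using this

theorem ind_le_of_insert {A : Fin d →₀ ℕ} {τ : Finset (Fin d)} {i : Fin d}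
    (h : ind (insert i τ) ≤ A) : ind τ ≤ A := by
  intro j
  have := h j
  rw [ind_apply] at this ⊢
  refine le_trans ?_ this
  simp only [Finset.mem_insert]
  split_ifs <;> simp_all

theorem ind_insert {τ : Finset (Fin d)} {i : Fin d} (hi : i ∉ τ) :
    ind (insert i τ) = ind τ + Finsupp.single i 1 := by
  ext j
  rw [Finsupp.add_apply, ind_apply, ind_apply, Finsupp.single_apply]
  by_cases hj : i = j
  · subst hj
    simp [hi]
  · have : j ≠ i := fun h => hj h.symm
    simp [hj, this]

section
open MvPolynomial

/-- multigraded component -/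
def comp (A : Fin d →₀ ℕ) (c : Finset (Fin d) → S k d) : Finset (Fin d) → k :=
  fun τ => if ind τ ≤ A then coeff (A - ind τ) (c τ) else 0

theorem comp_add_ind (e : Fin d →₀ ℕ) (c : Finset (Fin d) → S k d) (τ : Finset (Fin d)) :
    comp (e + ind τ) c τ = coeff e (c τ) := by
  rw [comp, if_pos (by exact le_add_self), add_tsub_cancel_right]

theorem comp_sub (A : Fin d →₀ ℕ) (c c' : Finset (Fin d) → S k d) (τ : Finset (Fin d)) :
    comp A (c - c') τ = comp A c τ - comp A c' τ := by
  unfold comp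
  split_ifs
  · simp
  · simp

/-- The Koszul differential on polynomials. -/
abbrev kz (c : Finset (Fin d) → S k d) : Finset (Fin d) → S k d := bd (R := S k d) X c

theorem comp_kz {A : Fin d →₀ ℕ} {τ : Finset (Fin d)} (h : ind τ ≤ A)
    (c : Finset (Fin d) → S k d) : comp A (kz c) τ = del k (comp A c) τ := by
  rw [comp, if_pos h, del, kz, bd_apply, bd_apply, coeff_sum]
  apply Finset.sum_congr rfl
  intro i _
  rw [smul_eq_mul, one_smul, coeff_X_mul']
  by_cases hi : i ∈ τ
  · simp [hi]
  · rw [if_neg hi, if_neg hi, comp]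
    by_cases h2 : ind (insert i τ) ≤ A
    · rw [if_pos h2, if_pos ((ind_insert_le hi h).1 h2), ind_insert hi, ← tsub_tsub]
      rw [← lcoeff_apply, map_zsmul, lcoeff_apply]
    · rw [if_neg h2, if_neg (fun hh => h2 ((ind_insert_le hi h).2 hh)), smul_zero]

/-- `N` is the monomial ideal with exponent set `B`. -/
def IsMon (N : Ideal (S k d)) (B : (Fin d →₀ ℕ) → Prop) : Prop :=
  (∀ p, p ∈ N ↔ ∀ e, coeff e p ≠ 0 → B e) ∧ ∀ e i, B e → B (e + Finsupp.single i 1)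

/-- The family in multidegree `A`. -/
def PA (B1 B2 : (Fin d →₀ ℕ) → Prop) (A : Fin d →₀ ℕ) (τ : Finset (Fin d)) : Prop :=
  ind τ ≤ A ∧ B1 (A - ind τ) ∧ ¬ B2 (A - ind τ)

variable {N1 N2 : Ideal (S k d)} {B1 B2 : (Fin d →₀ ℕ) → Prop}

theorem kz_mem {N : Ideal (S k d)} {c : Finset (Fin d) → S k d} (h : ∀ τ, c τ ∈ N)
    (τ : Finset (Fin d)) : kz c τ ∈ N := by
  rw [kz, bd_apply]
  apply Ideal.sum_mem
  intro i _
  apply Ideal.mul_mem_left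
  split_ifs
  · simp
  · exact zsmul_mem (h _) _

theorem del_restrict (h1 : IsMon N1 B1) (h2 : IsMon N2 B2) {A : Fin d →₀ ℕ}
    {b : Finset (Fin d) → S k d} (hb : ∀ τ, b τ ∈ N1) {τ : Finset (Fin d)} (hτ : PA B1 B2 A τ) :
    del k (fun τ => if PA B1 B2 A τ then comp A b τ else 0) τ = coeff (A - ind τ) (kz b τ) := by
  have e0 : coeff (A - ind τ) (kz b τ) = comp A (kz b) τ := by
    rw [comp, if_pos hτ.1]
  rw [e0, comp_kz hτ.1]
  apply bd_congr
  intro i hi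
  split_ifs with hh
  · rfl
  · by_contra hne
    apply hh
    rw [comp] at hne
    split_ifs at hne with hle
    · refine ⟨hle, ?_, ?_⟩
      · exact (h1.1 _).1 (hb (insert i τ)) _ (Ne.symm hne)
      · intro hB
        apply hτ.2.2
        have := h2.2 _ i hB
        convert this using 1
        rw [ind_insert hi]
        rw [ind_insert hi] at hle
        rw [← tsub_tsub, tsub_add_cancel_of_le]
        exact le_tsub_of_add_le_left hle
    · exact absurd rfl hne

theorem mg1 (h1 : IsMon N1 B1) (h2 : IsMon N2 B2) (A : Fin d →₀ ℕ) (i : ℕ)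
    (H : ∀ c : Finset (Fin d) → S k d, SC i c → (∀ τ, c τ ∈ N1) →
      (∀ τ, (c τ).IsHomogeneous (A.degree - i)) → (∀ τ, kz c τ ∈ N2) →
      ∃ b : Finset (Fin d) → S k d, (∀ τ, b τ ∈ N1) ∧ SC (i + 1) b ∧ ∀ τ, c τ - kz b τ ∈ N2) :
    Ex k (PA B1 B2 A) i := by
  intro u hu hdu
  let c : Finset (Fin d) → S k d := fun τ => monomial (A - ind τ) (u τ)
  have hcompA : ∀ A' τ, comp A' c τ = if A' = A then u τ else 0 := by
    intro A' τ
    by_cases hz : u τ = 0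
    · have : c τ = 0 := by simp [c, hz]
      simp [comp, this, hz]
    have hP : PA B1 B2 A τ := by
      by_contra hh
      exact hz (hu τ (fun h => hh h.1))
    rw [comp]
    by_cases hA : A' = A
    · subst hA
      rw [if_pos hP.1, if_pos rfl]
      simp [c]
    · rw [if_neg hA]
      split_ifs with hle
      · simp only [c, coeff_monomial]
        rw [if_neg]
        intro hh
        apply hA
        rw [← tsub_add_cancel_of_le hle, ← hh, tsub_add_cancel_of_le hP.1]
      · rfl
  have hcN : ∀ τ, c τ ∈ N1 := by
    intro τ
    rw [h1.1]
    intro e he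
    simp only [c, coeff_monomial] at he
    split_ifs at he with hh
    · rw [← hh]
      by_contra hB
      exact he (hu τ (fun h => hB h.1.2.1))
    · exact absurd rfl he
  obtain ⟨b, hbN, hbS, hb⟩ := H c (by
      intro τ hτ
      simp only [c]
      rw [hu τ (fun h => hτ h.2), monomial_zero]) hcN (by
      intro τ
      by_cases hz : u τ = 0
      · simp only [c, hz, monomial_zero]
        exact isHomogeneous_zero _ _ _
      have hP : PA B1 B2 A τ ∧ τ.card = i := by
        by_contra hh
        exact hz (hu τ hh)
      apply isHomogeneous_monomial
      have := congrArg Finsupp.degree (tsub_add_cancel_of_le hP.1.1)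
      rw [map_add, degree_ind, hP.2] at this
      omega) (by
      intro τ
      rw [h2.1]
      intro e he
      rw [← comp_add_ind, comp_kz le_add_self] at he
      have hA : e + ind τ = A := by
        by_contra hne
        apply he
        have : comp (e + ind τ) c = 0 := by
          funext τ'
          rw [hcompA, if_neg hne]
          rfl
        rw [this]
        simp [del]
      have hu' : comp (e + ind τ) c = u := by
        funext τ'
        rw [hcompA, if_pos hA]
      have he' : coeff e (kz c τ) ≠ 0 := by
        rw [← comp_add_ind, comp_kz le_add_self]
        exact he
      rw [hu'] at he
      have hee : A - ind τ = e := by rw [← hA, add_tsub_cancel_right]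
      by_contra hB
      apply he
      apply hdu
      refine ⟨?_, ?_, ?_⟩
      · rw [← hA]
        exact le_add_self
      · rw [hee]
        exact (h1.1 _).1 (kz_mem hcN τ) _ he'
      · rwa [hee])
  refine ⟨fun τ => if PA B1 B2 A τ then comp A b τ else 0, ?_, ?_⟩
  · intro τ hτ
    simp only
    split_ifs with hP
    · rw [comp, hbS]
      · simp
      · exact fun hh => hτ ⟨hP, hh⟩
    · rfl
  · intro τ hτ
    rw [del_restrict h1 h2 hbN hτ]
    have e1 : coeff (A - ind τ) (c τ - kz b τ) = 0 := by
      by_contra hne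
      exact hτ.2.2 ((h2.1 _).1 (hb τ) _ hne)
    rw [coeff_sub, sub_eq_zero] at e1
    rw [← e1]
    simp [c]

theorem mg2 (h1 : IsMon N1 B1) (h2 : IsMon N2 B2) (i : ℕ)
    (c : Finset (Fin d) → S k d) (hcS : SC i c) (hcN : ∀ τ, c τ ∈ N1) (hdc : ∀ τ, kz c τ ∈ N2)
    (H : ∀ A τ, τ.card = i → ind τ ≤ A → coeff (A - ind τ) (c τ) ≠ 0 → Ex k (PA B1 B2 A) i) :
    ∃ b : Finset (Fin d) → S k d, (∀ τ, b τ ∈ N1) ∧ SC (i + 1) b ∧ ∀ τ, c τ - kz b τ ∈ N2 := by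
  have key : ∀ A : Fin d →₀ ℕ, ∃ w : Finset (Fin d) → k,
      (∀ τ, ¬ (PA B1 B2 A τ ∧ τ.card = i + 1) → w τ = 0) ∧
      (∀ τ, PA B1 B2 A τ → del k w τ = comp A c τ) ∧ (comp A c = 0 → w = 0) := by
    intro A
    by_cases hz : comp A c = 0
    · refine ⟨0, fun _ _ => rfl, ?_, fun _ => rfl⟩
      intro τ _
      rw [hz]
      simp [del]
    obtain ⟨τ0, hτ0⟩ : ∃ τ, comp A c τ ≠ 0 := by
      by_contra hh
      push Not at hh
      exact hz (funext hh)
    have hE : Ex k (PA B1 B2 A) i := by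
      rw [comp] at hτ0
      split_ifs at hτ0 with hle
      · refine H A τ0 ?_ hle hτ0
        by_contra hne
        rw [hcS τ0 hne] at hτ0
        simp at hτ0
      · exact absurd rfl hτ0
    obtain ⟨w, hw, hdw⟩ := hE (fun τ => if PA B1 B2 A τ then comp A c τ else 0) (by
      intro τ hτ
      split_ifs with hP
      · rw [comp, hcS]
        · simp
        · exact fun hh => hτ ⟨hP, hh⟩
      · rfl) (by
      intro τ hτ
      rw [del_restrict h1 h2 hcN hτ]
      by_contra hne
      exact hτ.2.2 ((h2.1 _).1 (hdc τ) _ hne))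
    refine ⟨w, hw, ?_, fun h => absurd h hz⟩
    intro τ hτ
    rw [hdw τ hτ, if_pos hτ]
  choose w hw hdw hw0 using key
  let T : Finset (Fin d →₀ ℕ) :=
    Finset.univ.biUnion (fun τ : Finset (Fin d) => (c τ).support.image (fun e => e + ind τ))
  have hT : ∀ A, A ∉ T → w A = 0 := by
    intro A hA
    apply hw0
    funext τ
    rw [comp]
    split_ifs with hle
    · by_contra hne
      apply hA
      simp only [T, Finset.mem_biUnion, Finset.mem_univ, true_and, Finset.mem_image]
      exact ⟨τ, A - ind τ, by rw [mem_support_iff]; exact hne, tsub_add_cancel_of_le hle⟩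
    · rfl
  let b : Finset (Fin d) → S k d := fun τ => ∑ A ∈ T, monomial (A - ind τ) (w A τ)
  have hcomp : ∀ A, comp A b = w A := by
    intro A
    funext τ
    have hwle : ∀ A, w A τ ≠ 0 → ind τ ≤ A := by
      intro A h
      by_contra hh
      exact h (hw A τ (fun h3 => hh h3.1.1))
    rw [comp]
    split_ifs with hle
    · simp only [b, coeff_sum, coeff_monomial]
      rw [Finset.sum_eq_single A]
      · simp
      · intro A' _ hne
        split_ifs with hh
        · by_contra h0
          apply hne
          rw [← tsub_add_cancel_of_le (hwle A' h0), hh, tsub_add_cancel_of_le hle]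
        · rfl
      · intro hA
        simp [hT A hA]
    · by_contra hh
      exact hle (hwle A (Ne.symm hh))
  have hbN : ∀ τ, b τ ∈ N1 := by
    intro τ
    rw [h1.1]
    intro e he
    rw [← comp_add_ind, hcomp] at he
    have hP : PA B1 B2 (e + ind τ) τ := by
      by_contra hh
      exact he (hw _ τ (fun h3 => hh h3.1))
    have := hP.2.1
    rwa [add_tsub_cancel_right] at this
  refine ⟨b, hbN, ?_, ?_⟩
  · intro τ hτ
    simp only [b]
    apply Finset.sum_eq_zero
    intro A _
    rw [hw A τ (fun h => hτ h.2), monomial_zero]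
  · intro τ
    rw [h2.1]
    intro e he
    by_contra hB
    have hP : PA B1 B2 (e + ind τ) τ := by
      refine ⟨le_add_self, ?_, ?_⟩
      · rw [add_tsub_cancel_right]
        exact (h1.1 _).1 (N1.sub_mem (hcN τ) (kz_mem hbN τ)) _ he
      · rwa [add_tsub_cancel_right]
    apply he
    rw [coeff_sub, ← comp_add_ind, ← comp_add_ind, comp_kz le_add_self, hcomp, hdw _ τ hP, sub_self]
end
end helpers

section helpers

variable {k} {d}

section
open MvPolynomial

theorem ind_le_iff {A : Fin d →₀ ℕ} {τ : Finset (Fin d)} : ind τ ≤ A ↔ τ ⊆ A.support := by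
  constructor
  · intro h j hj
    have := h j
    rw [ind_apply, if_pos hj] at this
    rw [Finsupp.mem_support_iff]
    omega
  · intro h j
    rw [ind_apply]
    split_ifs with hj
    · have := h hj
      rw [Finsupp.mem_support_iff] at this
      omega
    · exact Nat.zero_le _

theorem support_ind (σ : Finset (Fin d)) : (ind σ).support = σ := by
  ext j
  simp [ind_apply]

theorem support_ind_sub (σ τ : Finset (Fin d)) : (ind σ - ind τ).support = σ \ τ := by
  ext j
  rw [Finsupp.mem_support_iff, Finsupp.tsub_apply, ind_apply, ind_apply, Finset.mem_sdiff]
  by_cases h1 : j ∈ σ <;> by_cases h2 : j ∈ τ <;> simp [h1, h2]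

theorem eq_ind_of_le_one {A : Fin d →₀ ℕ} (h : ∀ j, A j ≤ 1) : A = ind A.support := by
  ext j
  rw [ind_apply]
  have := h j
  split_ifs with hj
  · rw [Finsupp.mem_support_iff] at hj
    omega
  · rw [Finsupp.mem_support_iff] at hj
    omega

theorem support_sub_congr {A : Fin d →₀ ℕ} {τ τ' : Finset (Fin d)} {j : Fin d} (hA : 2 ≤ A j)
    (h : ∀ i, i ≠ j → (i ∈ τ ↔ i ∈ τ')) : (A - ind τ).support = (A - ind τ').support := by
  ext i
  simp only [Finsupp.mem_support_iff, Finsupp.tsub_apply, ind_apply]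
  by_cases hi : i = j
  · subst hi
    split_ifs <;> omega
  · simp only [h i hi]

theorem Ex_big (b1 b2 : Finset (Fin d) → Prop) {A : Fin d →₀ ℕ} {j : Fin d} (hA : 2 ≤ A j) (i : ℕ) :
    Ex k (PA (fun e => b1 e.support) (fun e => b2 e.support) A) i := by
  apply Ex_of_toggle i j
  · rintro τ ⟨h1, h2, h3⟩
    have e := support_sub_congr (τ := τ) (τ' := insert j τ) hA (fun i hi => by simp [hi])
    refine ⟨?_, ?_, ?_⟩
    · rw [ind_le_iff] at h1 ⊢
      rw [Finset.insert_subset_iff]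
      refine ⟨?_, h1⟩
      rw [Finsupp.mem_support_iff]
      omega
    · simpa only [← e] using h2
    · simpa only [← e] using h3
  · rintro τ ⟨h1, h2, h3⟩
    have e := support_sub_congr (τ := τ) (τ' := τ.erase j) hA (fun i hi => by simp [hi])
    refine ⟨?_, ?_, ?_⟩
    · rw [ind_le_iff] at h1 ⊢
      exact (Finset.erase_subset _ _).trans h1
    · simpa only [← e] using h2
    · simpa only [← e] using h3

theorem Ex_PA (b1 b2 : Finset (Fin d) → Prop) (i : ℕ) (A : Fin d →₀ ℕ)
    (H : ∀ σ : Finset (Fin d), A = ind σ →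
      Ex k (fun τ => τ ⊆ σ ∧ b1 (σ \ τ) ∧ ¬ b2 (σ \ τ)) i) :
    Ex k (PA (fun e => b1 e.support) (fun e => b2 e.support) A) i := by
  by_cases h : ∀ j, A j ≤ 1
  · have hA := eq_ind_of_le_one h
    have := H _ hA
    convert this using 1
    funext τ
    rw [PA, ind_le_iff]
    conv_lhs => rw [show A - ind τ = ind A.support - ind τ by rw [← hA], support_ind_sub]
  · push Not at h
    obtain ⟨j, hj⟩ := h
    exact Ex_big b1 b2 (j := j) (by omega) i

theorem PA_ind (b1 b2 : Finset (Fin d) → Prop) (σ : Finset (Fin d)) :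
    PA (fun e => b1 e.support) (fun e => b2 e.support) (ind σ) =
      (fun τ => τ ⊆ σ ∧ b1 (σ \ τ) ∧ ¬ b2 (σ \ τ)) := by
  funext τ
  rw [PA, ind_le_iff, support_ind_sub, support_ind]

theorem monomial_ind (σ : Finset (Fin d)) :
    (∏ i ∈ σ, X i : S k d) = monomial (ind σ) 1 := by
  rw [monomial_eq, map_one, one_mul, Finsupp.prod, support_ind]
  apply Finset.prod_congr rfl
  intro i hi
  rw [ind_apply, if_pos hi, pow_one]

theorem isMon_span (T : Finset (Fin d) → Prop)
    (hT : ∀ σ τ, T σ → σ ⊆ τ → T τ) :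
    IsMon (Ideal.span {m : S k d | ∃ σ : Finset (Fin d), T σ ∧ m = ∏ i ∈ σ, X i})
      (fun e => T e.support) := by
  constructor
  · intro p
    have : {m : S k d | ∃ σ : Finset (Fin d), T σ ∧ m = ∏ i ∈ σ, X i} =
        (fun s => monomial s (1 : k)) '' {s | ∃ σ, T σ ∧ s = ind σ} := by
      ext m
      constructor
      · rintro ⟨σ, h, rfl⟩
        exact ⟨ind σ, ⟨σ, h, rfl⟩, (monomial_ind σ).symm⟩
      · rintro ⟨s, ⟨σ, h, rfl⟩, rfl⟩
        exact ⟨σ, h, (monomial_ind σ).symm⟩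
    rw [this, mem_ideal_span_monomial_image]
    constructor
    · intro h e he
      obtain ⟨s, ⟨σ, hσ, rfl⟩, hs⟩ := h e (by rwa [mem_support_iff])
      exact hT _ _ hσ (ind_le_iff.1 hs)
    · intro h e he
      rw [mem_support_iff] at he
      exact ⟨_, ⟨_, h e he, rfl⟩, ind_le_iff.2 (le_refl _)⟩
  · intro e i h
    refine hT _ _ h ?_
    intro j hj
    rw [Finsupp.mem_support_iff] at hj ⊢
    rw [Finsupp.add_apply]
    omega

variable {Δ : Finset (Finset (Fin d))}

theorem isMon_sr (hΔ : ∀ σ ∈ Δ, ∀ τ ⊆ σ, τ ∈ Δ) :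
    IsMon (srIdeal k d Δ) (fun e => e.support ∉ Δ) :=
  isMon_span (fun σ => σ ∉ Δ) (fun σ τ h1 h2 h3 => h1 (hΔ τ h3 σ h2))

theorem isMon_dual (hΔ : ∀ σ ∈ Δ, ∀ τ ⊆ σ, τ ∈ Δ) :
    IsMon (dualSRIdeal k d Δ) (fun e => e.supportᶜ ∈ Δ) :=
  isMon_span (fun σ => σᶜ ∈ Δ) (fun _ _ h1 h2 => hΔ _ h1 _ (Finset.compl_subset_compl.2 h2))

theorem isMon_top : IsMon (⊤ : Ideal (S k d)) (fun e => (fun _ => True) e.support) :=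
  ⟨fun p => by simp, fun _ _ _ => trivial⟩

theorem isMon_bot : IsMon (⊥ : Ideal (S k d)) (fun e => (fun _ => False) e.support) := by
  refine ⟨fun p => ?_, fun _ _ h => h⟩
  rw [Ideal.mem_bot, MvPolynomial.ext_iff]
  simp

/-- The Koszul homology of `S/I` vanishes at `i` in terms of the face complexes. -/
theorem sr_ex (hΔ : ∀ σ ∈ Δ, ∀ τ ⊆ σ, τ ∈ Δ) (i : ℕ) :
    (∀ σ, Ex k (PF Δ ∅ σ) i) ↔
    ∀ c : Finset (Fin d) → S k d, SC i c → (∀ τ, kz c τ ∈ srIdeal k d Δ) →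
      ∃ b : Finset (Fin d) → S k d, SC (i + 1) b ∧ ∀ τ, c τ - kz b τ ∈ srIdeal k d Δ := by
  have hPF : ∀ σ, PF Δ ∅ σ = fun τ => τ ⊆ σ ∧ (fun _ => True) (σ \ τ) ∧
      ¬ (fun σ => σ ∉ Δ) (σ \ τ) := by
    intro σ
    funext τ
    simp [PF]
  constructor
  · intro h c hc hk
    obtain ⟨b, _, h2, h3⟩ := mg2 isMon_top (isMon_sr hΔ) i c hc (fun _ => trivial) hk (by
      intro A τ _ _ _
      apply Ex_PA (fun _ => True) (fun σ => σ ∉ Δ)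
      intro σ _
      rw [← hPF]
      exact h σ)
    exact ⟨b, h2, h3⟩
  · intro h σ
    rw [hPF, ← PA_ind (fun _ => True) (fun σ => σ ∉ Δ)]
    apply mg1 isMon_top (isMon_sr hΔ)
    intro c hc _ _ hk
    obtain ⟨b, h1, h2⟩ := h c hc hk
    exact ⟨b, fun _ => trivial, h1, h2⟩

/-- The dual family. -/
def QF (Δ : Finset (Finset (Fin d))) (σ τ : Finset (Fin d)) : Prop :=
  τ ⊆ σ ∧ (σ \ τ)ᶜ ∈ Δ

theorem degree_of_coeff {q : ℕ} {p : S k d} (hp : p.IsHomogeneous q) {e : Fin d →₀ ℕ}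
    (he : coeff e p ≠ 0) : e.degree = q := by
  have := hp he
  rw [Finsupp.degree_eq_weight_one]
  exact this

theorem dual_ex (hΔ : ∀ σ ∈ Δ, ∀ τ ⊆ σ, τ ∈ Δ) (i q : ℕ) :
    (∀ σ, σ.card = i + q → Ex k (QF Δ σ) i) ↔
    ∀ c : Finset (Fin d) → S k d, SC i c → (∀ τ, c τ ∈ dualSRIdeal k d Δ) →
      (∀ τ, (c τ).IsHomogeneous q) → kz c = 0 →
      ∃ b : Finset (Fin d) → S k d, (∀ τ, b τ ∈ dualSRIdeal k d Δ) ∧ SC (i + 1) b ∧ kz b = c := by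
  have hPF : ∀ σ, QF Δ σ = fun τ => τ ⊆ σ ∧ (fun σ => σᶜ ∈ Δ) (σ \ τ) ∧
      ¬ (fun _ => False) (σ \ τ) := by
    intro σ
    funext τ
    simp [QF]
  constructor
  · intro h c hc hN hq hk
    obtain ⟨b, h1, h2, h3⟩ := mg2 (isMon_dual hΔ) isMon_bot i c hc hN (by simp [hk]) (by
      intro A τ h1 h2 h3
      apply Ex_PA (fun σ => σᶜ ∈ Δ) (fun _ => False)
      intro σ hσ
      rw [← hPF]
      apply h σ
      have h4 := degree_of_coeff (hq τ) h3
      have := congrArg Finsupp.degree (tsub_add_cancel_of_le h2)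
      rw [map_add, degree_ind, h4, h1] at this
      rw [← degree_ind, ← hσ]
      omega)
    refine ⟨b, h1, h2, ?_⟩
    funext τ
    exact (sub_eq_zero.1 ((Ideal.mem_bot).1 (h3 τ))).symm
  · intro h σ hσ
    rw [hPF, ← PA_ind (fun σ => σᶜ ∈ Δ) (fun _ => False)]
    apply mg1 (isMon_dual hΔ) isMon_bot
    intro c hc hN hq hk
    rw [degree_ind, hσ, Nat.add_sub_cancel_left] at hq
    obtain ⟨b, h1, h2, h3⟩ := h c hc hN hq (by funext τ; exact (Ideal.mem_bot).1 (hk τ))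
    exact ⟨b, h1, h2, fun τ => by simp [h3]⟩

theorem koszul_S (i : ℕ) (c : Finset (Fin d) → S k d) (hc : SC i c)
    (hq : 0 < i ∨ ∃ q, 0 < q ∧ ∀ τ, (c τ).IsHomogeneous q) (hk : kz c = 0) :
    ∃ b : Finset (Fin d) → S k d, SC (i + 1) b ∧ kz b = c := by
  obtain ⟨b, _, h2, h3⟩ := mg2 isMon_top isMon_bot i c hc (fun _ => trivial) (by simp [hk]) (by
      intro A τ h1 h2 h3
      have := congrArg Finsupp.degree (tsub_add_cancel_of_le h2)
      rw [map_add, degree_ind, h1] at this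
      have hA : A ≠ 0 := by
        rintro rfl
        rcases hq with hq | ⟨q, hq0, hq⟩
        · simp at this
          omega
        · rw [degree_of_coeff (hq τ) h3] at this
          simp at this
          omega
      obtain ⟨j, hj⟩ := Finsupp.ne_iff.1 hA
      have hj' : j ∈ A.support := by rwa [Finsupp.mem_support_iff]
      apply Ex_of_toggle i j
      · rintro τ ⟨h1, _, _⟩
        rw [ind_le_iff] at h1
        exact ⟨ind_le_iff.2 (Finset.insert_subset hj' h1), trivial, id⟩
      · rintro τ ⟨h1, _, _⟩
        rw [ind_le_iff] at h1
        exact ⟨ind_le_iff.2 ((Finset.erase_subset _ _).trans h1), trivial, id⟩)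
  refine ⟨b, h2, ?_⟩
  funext τ
  exact (sub_eq_zero.1 ((Ideal.mem_bot).1 (h3 τ))).symm

end
end helpers

section helpers

variable {k} {d}

section depth
universe u
variable {R : Type u} [CommRing R] {M : Type u} [AddCommGroup M] [Module R M]

/-- Vanishing of Koszul homology. -/
def KE (x : Fin d → R) (M : Type u) [AddCommGroup M] [Module R M] (i : ℕ) : Prop :=
  ∀ c : Finset (Fin d) → M, SC i c → bd x c = 0 → ∃ b : Finset (Fin d) → M, SC (i + 1) b ∧ bd x b = c

/-- Vanishing of Koszul homology in high degrees. -/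
def DD (x : Fin d → R) (M : Type u) [AddCommGroup M] [Module R M] (n : ℕ) : Prop :=
  ∀ i, d < i + n → KE x M i

theorem SC_big {i : ℕ} (hi : d < i) {c : Finset (Fin d) → M} (hc : SC i c) : c = 0 := by
  funext τ
  apply hc
  have := Finset.card_le_univ τ
  rw [Fintype.card_fin] at this
  omega

theorem DD_zero (x : Fin d → R) : DD x M 0 := by
  intro i hi c hc _
  rw [SC_big (by omega) hc]
  exact ⟨0, fun _ _ => rfl, by simp⟩

theorem exists_homotopy (x : Fin d → R) {r : R} (hr : r ∈ Ideal.span (Set.range x)) :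
    ∃ H : (Finset (Fin d) → M) →ₗ[R] (Finset (Fin d) → M),
      (∀ c, bd x (H c) + H (bd x c) = r • c) ∧ ∀ i c, SC i c → SC (i + 1) (H c) := by
  rw [Ideal.mem_span_range_iff_exists_fun] at hr
  obtain ⟨a, rfl⟩ := hr
  refine ⟨∑ j, a j • eI R j, ?_, ?_⟩
  · intro c
    simp only [LinearMap.sum_apply, LinearMap.smul_apply, map_sum, map_smul]
    rw [← Finset.sum_add_distrib, Finset.sum_smul]
    apply Finset.sum_congr rfl
    intro j _
    rw [← smul_add, bd_eI, smul_smul]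
  · intro i c hc τ hτ
    simp only [LinearMap.sum_apply, LinearMap.smul_apply, Finset.sum_apply, Pi.smul_apply]
    apply Finset.sum_eq_zero
    intro j _
    rw [SC.eI (R := R) hc j τ hτ, smul_zero]

theorem quot_zero {r : R} {m : M} :
    (Submodule.Quotient.mk m : QuotSMulTop r M) = 0 ↔ ∃ e, r • e = m := by
  rw [Submodule.Quotient.mk_eq_zero, Submodule.mem_smul_pointwise_iff_exists]
  simp

theorem bd_quot (x : Fin d → R) (N : Submodule R M) (c : Finset (Fin d) → M) (τ) :
    bd x (fun τ => (Submodule.Quotient.mk (c τ) : M ⧸ N)) τ = Submodule.Quotient.mk (bd x c τ) :=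
  (bd_map N.mkQ.toAddMonoidHom x x (fun i m => N.mkQ.map_smul (x i) m) c τ).symm

theorem lift_SC (N : Submodule R M) {i : ℕ} {c : Finset (Fin d) → M ⧸ N} (hc : SC i c) :
    ∃ c' : Finset (Fin d) → M, SC i c' ∧ ∀ τ, (Submodule.Quotient.mk (c' τ) : M ⧸ N) = c τ := by
  choose f hf using Submodule.Quotient.mk_surjective N
  refine ⟨fun τ => if τ.card = i then f (c τ) else 0, ?_, ?_⟩
  · intro τ hτ
    simp [hτ]
  · intro τ
    by_cases h : τ.card = i
    · simp [h, hf]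
    · simp [h, hc τ h]

theorem DD_quot (x : Fin d → R) {r : R} (hr : r ∈ Ideal.span (Set.range x))
    (hreg : IsSMulRegular M r) (n : ℕ) : DD x (QuotSMulTop r M) n ↔ DD x M (n + 1) := by
  have hz : ∀ c : Finset (Fin d) → M, r • c = 0 → c = 0 := by
    intro c hc
    funext τ
    apply hreg
    have := congrFun hc τ
    simpa using this
  constructor
  · intro h i hi c hc hbc
    obtain ⟨H, hH, hS⟩ := exists_homotopy (M := M) x hr
    have h1 := hH c
    rw [hbc, map_zero, add_zero] at h1
    obtain ⟨b, hb, hbb⟩ := h (i + 1) (by omega)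
      (fun τ => (Submodule.Quotient.mk (H c τ) : QuotSMulTop r M))
      (fun τ hτ => by
        change Submodule.Quotient.mk (H c τ) = _
        rw [hS i c hc τ hτ]
        rfl) (by
        funext τ
        rw [bd_quot, h1, Pi.zero_apply, quot_zero]
        exact ⟨c τ, rfl⟩)
    obtain ⟨b', hb', hbb'⟩ := lift_SC _ hb
    have h2 : ∀ τ, ∃ e, r • e = H c τ - bd x b' τ := by
      intro τ
      rw [← quot_zero, Submodule.Quotient.mk_sub, sub_eq_zero]
      have := congrFun hbb τ
      change _ = Submodule.Quotient.mk (H c τ) at this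
      rw [← this, ← bd_quot]
      simp only [hbb']
    choose e he using h2
    have he' : r • e = H c - bd x b' := funext he
    refine ⟨e, ?_, ?_⟩
    · intro τ hτ
      apply hreg
      change r • e τ = r • 0
      rw [he, hS i c hc τ hτ, hb'.bd x τ hτ]
      simp
    · have : r • (bd x e - c) = 0 := by
        rw [smul_sub, ← map_smul, he', map_sub, bd_bd, h1]
        simp
      exact sub_eq_zero.1 (hz _ this)
  · intro h i hi c hc hbc
    obtain ⟨c', hc', hcc'⟩ := lift_SC _ hc
    have hfin : ∀ e : Finset (Fin d) → M, SC i e → bd x (c' - r • e) = 0 →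
        ∃ b : Finset (Fin d) → QuotSMulTop r M, SC (i + 1) b ∧ bd x b = c := by
      intro e hSe he
      obtain ⟨b, hb, hbb⟩ := h i (by omega) _ (hc'.sub (hSe.smul r)) he
      refine ⟨fun τ => Submodule.Quotient.mk (b τ), ?_, ?_⟩
      · intro τ hτ
        change Submodule.Quotient.mk (b τ) = _
        rw [hb τ hτ]
        rfl
      · funext τ
        rw [bd_quot, hbb, Pi.sub_apply, Submodule.Quotient.mk_sub, hcc', sub_eq_self, quot_zero]
        exact ⟨e τ, rfl⟩
    cases i with
    | zero =>
      apply hfin 0 (fun _ _ => rfl)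
      rw [smul_zero, sub_zero]
      exact bd_zero_of_SC_zero hc' x
    | succ i =>
      have h2 : ∀ τ, ∃ e, r • e = bd x c' τ := by
        intro τ
        rw [← quot_zero, ← bd_quot]
        have := congrFun hbc τ
        simp only [hcc']
        exact this
      choose e he using h2
      have he' : r • e = bd x c' := funext he
      have hSe : SC i e := by
        intro τ hτ
        apply hreg
        change r • e τ = r • 0
        rw [he, hc'.bd x τ hτ, smul_zero]
      have hbe : bd x e = 0 := by
        apply hz
        rw [← map_smul, he', bd_bd]
      obtain ⟨b', hb', hbb'⟩ := h i (by omega) e hSe hbe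
      apply hfin b' hb'
      rw [map_sub, map_smul, hbb', he', sub_self]

open RingTheory.Sequence

theorem DD_of_regular (x : Fin d → R) (rs : List R) :
    ∀ (M : Type u) [AddCommGroup M] [Module R M],
    (∀ r ∈ rs, r ∈ Ideal.span (Set.range x)) → IsWeaklyRegular M rs → DD x M rs.length := by
  induction rs with
  | nil => intro M _ _ _ _; exact DD_zero x
  | cons r rs ih =>
    intro M _ _ h1 h2
    rw [isWeaklyRegular_cons_iff] at h2
    rw [List.length_cons, ← DD_quot x (h1 r (by simp)) h2.1]
    exact ih _ (fun s hs => h1 s (by simp [hs])) h2.2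

theorem exists_regular [IsNoetherianRing R] [Module.Finite R M] (x : Fin d → R)
    (h : KE x M d) : ∃ r ∈ Ideal.span (Set.range x), IsSMulRegular M r := by
  have key : Subsingleton ((R ⧸ Ideal.span (Set.range x)) →ₗ[R] M) := by
    apply subsingleton_of_forall_eq 0
    intro f
    have hm : ∀ i, x i • f 1 = 0 := by
      intro i
      rw [← map_smul]
      have : x i • (1 : R ⧸ Ideal.span (Set.range x)) = 0 := by
        rw [Algebra.smul_def, mul_one, Ideal.Quotient.algebraMap_eq, Ideal.Quotient.eq_zero_iff_mem]
        exact Ideal.subset_span ⟨i, rfl⟩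
      rw [this, map_zero]
    obtain ⟨b, hb, hbb⟩ := h (fun τ => if τ = Finset.univ then f 1 else 0) (by
      intro τ hτ
      apply if_neg
      rintro rfl
      simp at hτ) (by
      funext τ
      rw [bd_apply]
      apply Finset.sum_eq_zero
      intro i _
      split_ifs
      · simp
      · rw [smul_comm, hm, smul_zero]
      · simp)
    have hf1 : f 1 = 0 := by
      have := congrFun hbb Finset.univ
      rw [SC_big (by omega) hb] at this
      simpa using this.symm
    ext
    simpa using hf1
  rw [IsSMulRegular.subsingleton_linearMap_iff] at key
  simpa only [Ideal.annihilator_quotient] using key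

theorem regular_of_DD [IsNoetherianRing R] (x : Fin d → R) (n : ℕ) :
    ∀ (M : Type u) [AddCommGroup M] [Module R M] [Module.Finite R M], DD x M n →
    ∃ rs : List R, rs.length = n ∧
    (∀ r ∈ rs, r ∈ Ideal.span (Set.range x)) ∧ IsWeaklyRegular M rs := by
  induction n with
  | zero => intro M _ _ _ _; exact ⟨[], rfl, by simp, IsWeaklyRegular.nil R M⟩
  | succ n ih =>
    intro M _ _ _ h
    obtain ⟨r, hr, hreg⟩ := exists_regular x (h d (by omega))
    rw [← DD_quot x hr hreg] at h
    obtain ⟨rs, h1, h2, h3⟩ := ih _ h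
    refine ⟨r :: rs, by simp [h1], ?_, ?_⟩
    · intro s hs
      rcases List.mem_cons.1 hs with rfl | hs
      · exact hr
      · exact h2 s hs
    · rw [isWeaklyRegular_cons_iff]
      exact ⟨hreg, h3⟩

end depth
end helpers

section helpers

variable {k} {d}

section dim
open MvPolynomial

variable {Δ : Finset (Finset (Fin d))}

theorem dim_lower {F : Finset (Fin d)} (hΔ : ∀ σ ∈ Δ, ∀ τ ⊆ σ, τ ∈ Δ) (hF : F ∈ Δ) :
    (F.card : WithBot ℕ∞) ≤ ringKrullDim (S k d ⧸ srIdeal k d Δ) := by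
  let f : S k d →ₐ[k] MvPolynomial F k := aeval (fun i => if h : i ∈ F then X ⟨i, h⟩ else 0)
  have hf : ∀ a ∈ srIdeal k d Δ, (f : S k d →+* MvPolynomial F k) a = 0 := by
    intro a ha
    have hle : srIdeal k d Δ ≤ RingHom.ker (f : S k d →+* MvPolynomial F k) := by
      rw [srIdeal, Ideal.span_le]
      rintro m ⟨σ, hσ, rfl⟩
      have : ¬ σ ⊆ F := fun h => hσ (hΔ F hF σ h)
      obtain ⟨i, hi, hiF⟩ := Finset.not_subset.1 this
      change (f : S k d →+* MvPolynomial F k) _ = 0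
      rw [map_prod]
      apply Finset.prod_eq_zero hi
      simp [f, hiF]
    exact hle ha
  have hs : Function.Surjective (Ideal.Quotient.lift _ (f : S k d →+* MvPolynomial F k) hf) := by
    apply Ideal.Quotient.lift_surjective_of_surjective
    intro p
    refine ⟨rename Subtype.val p, ?_⟩
    have : (f.comp (rename Subtype.val)) = AlgHom.id k (MvPolynomial F k) := by
      apply MvPolynomial.algHom_ext
      intro i
      simp [f]
    exact DFunLike.congr_fun this p
  have := ringKrullDim_le_of_surjective _ hs
  rwa [MvPolynomial.ringKrullDim_of_isNoetherianRing, ringKrullDim_eq_zero_of_field, zero_add,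
    Nat.card_eq_fintype_card, Fintype.card_coe] at this

theorem dim_upper_aux {R : Type} [CommRing R] {n : ℕ} (hn : ∀ F ∈ Δ, F.card ≤ n)
    (q0 : S k d →+* R) (hq0 : Function.Surjective q0)
    (hq1 : ∀ a ∈ srIdeal k d Δ, q0 a = 0) :
    ringKrullDim R ≤ n := by
  rw [ringKrullDim, Order.krullDim]
  apply iSup_le
  intro p
  let P := p.head.asIdeal
  have hP : P.IsPrime := p.head.isPrime
  let q : S k d →+* (R ⧸ P) :=
    (Ideal.Quotient.mk P).comp q0
  have hq : Function.Surjective q :=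
    Ideal.Quotient.mk_surjective.comp hq0
  let F : Finset (Fin d) := Finset.univ.filter (fun i => q (X i) ≠ 0)
  have hF : F ∈ Δ := by
    by_contra h
    have h1 : (∏ i ∈ F, X i : S k d) ∈ srIdeal k d Δ := Ideal.subset_span ⟨F, h, rfl⟩
    have h2 : q (∏ i ∈ F, X i) = 0 := by
      change (Ideal.Quotient.mk P) (q0 _) = 0
      rw [hq1 _ h1, map_zero]
    rw [map_prod, Finset.prod_eq_zero_iff] at h2
    obtain ⟨i, hi, h3⟩ := h2
    exact (Finset.mem_filter.1 hi).2 h3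
  let g : MvPolynomial F k →+* (R ⧸ P) :=
    q.comp (rename Subtype.val : MvPolynomial F k →ₐ[k] S k d).toRingHom
  have hg : Function.Surjective g := by
    intro y
    obtain ⟨s, rfl⟩ := hq y
    let f : S k d →ₐ[k] MvPolynomial F k := aeval (fun i => if h : i ∈ F then X ⟨i, h⟩ else 0)
    refine ⟨f s, ?_⟩
    have : g.comp f.toRingHom = q := by
      apply MvPolynomial.ringHom_ext
      · intro a
        simp [g, f]
      · intro i
        by_cases h : i ∈ F
        · simp [g, f, h]
        · have h0 : q (X i) = 0 := by
            by_contra hh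
            exact h (Finset.mem_filter.2 ⟨Finset.mem_univ _, hh⟩)
          simp [f, h, h0]
    exact DFunLike.congr_fun this s
  have h1 := ringKrullDim_le_of_surjective _ hg
  rw [MvPolynomial.ringKrullDim_of_isNoetherianRing, ringKrullDim_eq_zero_of_field, zero_add,
    Nat.card_eq_fintype_card, Fintype.card_coe, ringKrullDim_quotient] at h1
  let p' : LTSeries (PrimeSpectrum.zeroLocus (P : Set R)) :=
    { length := p.length
      toFun := fun i => ⟨p i, by
        rw [PrimeSpectrum.mem_zeroLocus]
        exact p.head_le i⟩
      step := fun i => p.step i }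
  have h2 : (p'.length : WithBot ℕ∞) ≤ _ := Order.LTSeries.length_le_krullDim p'
  refine le_trans h2 (h1.trans ?_)
  exact_mod_cast hn F hF

theorem dim_upper {n : ℕ} (hn : ∀ F ∈ Δ, F.card ≤ n) :
    ringKrullDim (S k d ⧸ srIdeal k d Δ) ≤ n :=
  dim_upper_aux hn (Ideal.Quotient.mk _) Ideal.Quotient.mk_surjective
    (fun _ ha => Ideal.Quotient.eq_zero_iff_mem.2 ha)

theorem span_mk_X (I : Ideal (S k d)) :
    Ideal.span (Set.range (fun i => Ideal.Quotient.mk I (X i))) =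
      (polyMaxIdeal k d).map (Ideal.Quotient.mk I) := by
  rw [polyMaxIdeal, Ideal.map_span, ← Set.range_comp]
  rfl

theorem max_ne_top (hne : Δ.Nonempty) (hΔ : ∀ σ ∈ Δ, ∀ τ ⊆ σ, τ ∈ Δ) :
    (polyMaxIdeal k d).map (Ideal.Quotient.mk (srIdeal k d Δ)) ≠ ⊤ := by
  obtain ⟨F, hF⟩ := hne
  have h0 : ∅ ∈ Δ := hΔ F hF ∅ (Finset.empty_subset _)
  have hle : srIdeal k d Δ ≤ RingHom.ker (constantCoeff : S k d →+* k) := by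
    rw [srIdeal, Ideal.span_le]
    rintro m ⟨σ, hσ, rfl⟩
    have : σ.Nonempty := by
      rw [Finset.nonempty_iff_ne_empty]
      rintro rfl
      exact hσ h0
    obtain ⟨i, hi⟩ := this
    change constantCoeff _ = 0
    rw [map_prod]
    exact Finset.prod_eq_zero hi (by simp)
  let g := Ideal.Quotient.lift (srIdeal k d Δ) (constantCoeff : S k d →+* k) hle
  intro h
  have h1 : (polyMaxIdeal k d).map (Ideal.Quotient.mk (srIdeal k d Δ)) ≤ RingHom.ker g := by
    rw [← span_mk_X, Ideal.span_le]
    rintro _ ⟨i, rfl⟩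
    change constantCoeff (X i : S k d) = 0
    simp
  rw [h, top_le_iff] at h1
  exact RingHom.ker_ne_top g h1

theorem CM_iff_DD {n : ℕ} (hne : Δ.Nonempty) (hΔ : ∀ σ ∈ Δ, ∀ τ ⊆ σ, τ ∈ Δ)
    (hn : ∀ F ∈ Δ, F.card ≤ n) (hn' : ∃ F ∈ Δ, F.card = n) :
    PolyRingIsCM k d (srIdeal k d Δ) ↔
      DD (fun i => Ideal.Quotient.mk (srIdeal k d Δ) (X i)) (S k d ⧸ srIdeal k d Δ) n := by
  have hdim : ringKrullDim (S k d ⧸ srIdeal k d Δ) = n := by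
    apply le_antisymm (dim_upper hn)
    obtain ⟨F, hF, rfl⟩ := hn'
    exact dim_lower hΔ hF
  constructor
  · rintro ⟨rs, h1, h2, h3⟩
    rw [hdim] at h3
    have h4 : rs.length = n := by
      have h3' : ((rs.length : ℕ∞) : WithBot ℕ∞) = ((n : ℕ∞) : WithBot ℕ∞) := h3
      exact_mod_cast h3'
    rw [← h4]
    apply DD_of_regular _ _ _ _ h2.toIsWeaklyRegular
    intro r hr
    rw [span_mk_X]
    exact h1 r hr
  · intro h
    obtain ⟨rs, h1, h2, h3⟩ := regular_of_DD _ n _ h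
    simp only [span_mk_X] at h2
    refine ⟨rs, h2, ⟨h3, ?_⟩, ?_⟩
    · intro h4
      apply max_ne_top (k := k) hne hΔ
      rw [eq_top_iff]
      intro y _
      have hy : y ∈ (⊤ : Submodule (S k d ⧸ srIdeal k d Δ) (S k d ⧸ srIdeal k d Δ)) := trivial
      rw [h4] at hy
      have h5 : Ideal.ofList rs ≤ (polyMaxIdeal k d).map (Ideal.Quotient.mk (srIdeal k d Δ)) :=
        Ideal.span_le.2 h2
      apply h5
      rw [smul_eq_mul, Ideal.mul_top] at hy
      exact hy
    · rw [hdim, h1]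
      rfl

theorem KE_iff (I : Ideal (S k d)) (i : ℕ) :
    KE (fun i => Ideal.Quotient.mk I (X i)) (S k d ⧸ I) i ↔
    ∀ c : Finset (Fin d) → S k d, SC i c → (∀ τ, kz c τ ∈ I) →
      ∃ b : Finset (Fin d) → S k d, SC (i + 1) b ∧ ∀ τ, c τ - kz b τ ∈ I := by
  have hbd : ∀ (c : Finset (Fin d) → S k d) τ,
      Ideal.Quotient.mk I (kz c τ) = bd (fun i => Ideal.Quotient.mk I (X i))
        (fun τ => Ideal.Quotient.mk I (c τ)) τ := fun c τ =>
    bd_map (Ideal.Quotient.mk I).toAddMonoidHom _ _ (fun i m => map_mul (Ideal.Quotient.mk I) _ _) c τ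
  constructor
  · intro h c hc hk
    obtain ⟨b, hb, hbb⟩ := h (fun τ => Ideal.Quotient.mk I (c τ))
      (fun τ hτ => by
        change Ideal.Quotient.mk I (c τ) = 0
        rw [hc τ hτ, map_zero]) (by
        funext τ
        rw [← hbd, Pi.zero_apply, Ideal.Quotient.eq_zero_iff_mem]
        exact hk τ)
    obtain ⟨b', hb', h2⟩ := lift_SC (R := S k d) I hb
    have h2' : b = fun τ => Ideal.Quotient.mk I (b' τ) := funext fun τ => (h2 τ).symm
    refine ⟨b', hb', fun τ => ?_⟩
    have := congrFun hbb τ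
    rw [h2', ← hbd] at this
    rw [← Ideal.Quotient.eq_zero_iff_mem, map_sub, this, sub_self]
  · intro h c hc hk
    obtain ⟨c', hc', h2⟩ := lift_SC (R := S k d) I hc
    have h2' : c = fun τ => Ideal.Quotient.mk I (c' τ) := funext fun τ => (h2 τ).symm
    obtain ⟨b, hb, hbb⟩ := h c' hc' (by
      intro τ
      rw [← Ideal.Quotient.eq_zero_iff_mem, hbd, ← h2', hk]
      rfl)
    refine ⟨fun τ => Ideal.Quotient.mk I (b τ), fun τ hτ => by
        change Ideal.Quotient.mk I (b τ) = 0
        rw [hb τ hτ, map_zero], ?_⟩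
    funext τ
    rw [← hbd, h2']
    have := hbb τ
    rw [← Ideal.Quotient.eq_zero_iff_mem, map_sub, sub_eq_zero] at this
    exact this.symm

theorem CM_iff {n : ℕ} (hne : Δ.Nonempty) (hΔ : ∀ σ ∈ Δ, ∀ τ ⊆ σ, τ ∈ Δ)
    (hn : ∀ F ∈ Δ, F.card ≤ n) (hn' : ∃ F ∈ Δ, F.card = n) :
    PolyRingIsCM k d (srIdeal k d Δ) ↔ ∀ σ i, d - n < i → Ex k (PF Δ σᶜ σ) i := by
  rw [CM_iff_DD hne hΔ hn hn', ← leray hΔ]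
  have hnd : n ≤ d := by
    obtain ⟨F, _, rfl⟩ := hn'
    simpa using Finset.card_le_univ F
  constructor
  · intro h σ i hi
    have := h i (by omega)
    rw [KE_iff, ← sr_ex hΔ] at this
    exact this σ
  · intro h i hi
    rw [KE_iff, ← sr_ex hΔ]
    exact fun σ => h σ i (by omega)

end dim
end helpers

section helpers

variable {k} {d}

section linres
open MvPolynomial

variable {ι β : Type} [Fintype β]

/-- Homogeneous component of a vector. -/
def hcv (q : ℕ) (v : ι → S k d) : ι → S k d := fun j => homogeneousComponent q (v j)

/-- Homogeneous vector. -/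
def HV (v : ι → S k d) (q : ℕ) : Prop := ∀ j, (v j).IsHomogeneous q

/-- Homogeneous matrix. -/
def HomMap (φ : (β → S k d) →ₗ[S k d] (ι → S k d)) (r : ℕ) : Prop :=
  ∀ j i, (φ (Pi.single j 1) i).IsHomogeneous r

section
attribute [local instance] MvPolynomial.gradedAlgebra

theorem decomp_eq (p : S k d) (i : ℕ) :
    ((DirectSum.decompose (homogeneousSubmodule (Fin d) k) p i : homogeneousSubmodule (Fin d) k i) :
      S k d) = homogeneousComponent i p :=
  decomposition.decompose'_apply p i

theorem hc_mul (q r : ℕ) (p g : S k d) (hg : g.IsHomogeneous r) :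
    homogeneousComponent (q + r) (p * g) = homogeneousComponent q p * g := by
  rw [← decomp_eq, ← decomp_eq]
  exact DirectSum.coe_decompose_mul_add_of_right_mem
    (homogeneousSubmodule (Fin d) k) (i := q) (j := r) (a := p) (b := g) hg

theorem hc_mul_lt (q r : ℕ) (hqr : q < r) (p g : S k d) (hg : g.IsHomogeneous r) :
    homogeneousComponent q (p * g) = 0 := by
  rw [← decomp_eq]
  exact DirectSum.coe_decompose_mul_of_right_mem_of_not_le
    (homogeneousSubmodule (Fin d) k) (i := r) (n := q) (a := p) (b := g) hg (by omega)

end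

theorem HV_iff {v : ι → S k d} {q : ℕ} : HV v q ↔ hcv q v = v := by
  constructor
  · intro h
    funext j
    exact homogeneousComponent_eq_self (h j)
  · intro h j
    rw [← h]
    exact homogeneousComponent_isHomogeneous _ _

theorem HV_hcv (v : ι → S k d) (q : ℕ) : HV (hcv q v) q :=
  fun _ => homogeneousComponent_isHomogeneous _ _

theorem hcv_zero (q : ℕ) : hcv q (0 : ι → S k d) = 0 := by
  funext j
  simp [hcv]

theorem hcv_bd (q : ℕ) (c : Finset (Fin d) → ι → S k d) (τ : Finset (Fin d)) :
    hcv (q + 1) (bd (R := S k d) X c τ) = bd (R := S k d) X (fun τ => hcv q (c τ)) τ := by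
  funext j
  rw [bd_apply, bd_apply, hcv, Finset.sum_apply, Finset.sum_apply, map_sum]
  apply Finset.sum_congr rfl
  intro i _
  rw [Pi.smul_apply, Pi.smul_apply, smul_eq_mul, smul_eq_mul, mul_comm,
    hc_mul _ _ _ _ (isHomogeneous_X k i), mul_comm]
  split_ifs
  · simp
  · rw [Pi.smul_apply, Pi.smul_apply, map_zsmul]
    rfl

theorem hcv_zero_bd (c : Finset (Fin d) → ι → S k d) (τ : Finset (Fin d)) :
    hcv 0 (bd (R := S k d) X c τ) = 0 := by
  funext j
  rw [bd_apply, hcv, Finset.sum_apply, map_sum]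
  apply Finset.sum_eq_zero
  intro i _
  rw [Pi.smul_apply, smul_eq_mul, mul_comm, hc_mul_lt 0 1 (by omega) _ _ (isHomogeneous_X k i)]

theorem hcv_map {φ : (β → S k d) →ₗ[S k d] (ι → S k d)} {r : ℕ} (h : HomMap φ r) (q : ℕ)
    (u : β → S k d) : hcv (q + r) (φ u) = φ (hcv q u) := by
  funext i
  rw [LinearMap.pi_apply_eq_sum_univ φ u, LinearMap.pi_apply_eq_sum_univ φ (hcv q u), hcv,
    Finset.sum_apply, Finset.sum_apply, map_sum]
  apply Finset.sum_congr rfl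
  intro j _
  have := h j i
  rw [Pi.smul_apply, Pi.smul_apply, smul_eq_mul, smul_eq_mul, hc_mul]
  · rfl
  · convert this using 3 with j'
    rw [Pi.single_apply]
    by_cases hj : j = j'
    · simp [hj]
    · simp [hj, Ne.symm hj]

theorem hcv_map_lt {φ : (β → S k d) →ₗ[S k d] (ι → S k d)} {r : ℕ} (h : HomMap φ r) {q : ℕ}
    (hq : q < r) (u : β → S k d) : hcv q (φ u) = 0 := by
  funext i
  rw [LinearMap.pi_apply_eq_sum_univ φ u, hcv, Finset.sum_apply, map_sum]
  apply Finset.sum_eq_zero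
  intro j _
  have := h j i
  rw [Pi.smul_apply, smul_eq_mul, hc_mul_lt _ _ hq]
  convert this using 3 with j'
  rw [Pi.single_apply]
  by_cases hj : j = j'
  · simp [hj]
  · simp [hj, Ne.symm hj]

theorem HV.map {φ : (β → S k d) →ₗ[S k d] (ι → S k d)} {r : ℕ} (h : HomMap φ r) {q : ℕ}
    {u : β → S k d} (hu : HV u q) : HV (φ u) (q + r) := by
  rw [HV_iff, hcv_map h, HV_iff.1 hu]

theorem bd_coord (c : Finset (Fin d) → ι → S k d) (τ : Finset (Fin d)) (j : ι) :
    bd (R := S k d) X c τ j = kz (fun τ => c τ j) τ :=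
  bd_map (Pi.evalAddMonoidHom (fun _ : ι => S k d) j) X X (fun _ _ => rfl) c τ

theorem bd_lin (φ : (β → S k d) →ₗ[S k d] (ι → S k d)) (c : Finset (Fin d) → β → S k d)
    (τ : Finset (Fin d)) : φ (bd (R := S k d) X c τ) = bd (R := S k d) X (fun τ => φ (c τ)) τ :=
  bd_map φ.toAddMonoidHom X X (fun i m => φ.map_smul _ _) c τ

theorem koszul_vec (i : ℕ) (c : Finset (Fin d) → ι → S k d) (hc : SC i c)
    (hq : 0 < i ∨ ∃ q, 0 < q ∧ ∀ τ, HV (c τ) q) (hk : bd (R := S k d) X c = 0) :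
    ∃ b : Finset (Fin d) → ι → S k d, SC (i + 1) b ∧ bd (R := S k d) X b = c := by
  have : ∀ j, ∃ b : Finset (Fin d) → S k d, SC (i + 1) b ∧ kz b = fun τ => c τ j := by
    intro j
    apply koszul_S
    · intro τ hτ
      change c τ j = 0
      rw [hc τ hτ]
      rfl
    · rcases hq with hq | ⟨q, h0, hq⟩
      · exact Or.inl hq
      · exact Or.inr ⟨q, h0, fun τ => hq τ j⟩
    · funext τ
      rw [← bd_coord, hk]
      rfl
  choose b hb hbb using this
  refine ⟨fun τ j => b j τ, ?_, ?_⟩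
  · intro τ hτ
    funext j
    exact hb j τ hτ
  · funext τ j
    rw [bd_coord]
    exact congrFun (hbb j) τ

/-- Graded Koszul vanishing outside internal degree `r`. -/
def KVan (N : Submodule (S k d) (ι → S k d)) (r i : ℕ) : Prop :=
  ∀ q, q ≠ r → ∀ c : Finset (Fin d) → ι → S k d, (∀ τ, c τ ∈ N) → SC i c → (∀ τ, HV (c τ) q) →
    bd (R := S k d) X c = 0 → ∃ w : Finset (Fin d) → ι → S k d, (∀ τ, w τ ∈ N) ∧ SC (i + 1) w ∧
      bd (R := S k d) X w = c

theorem lift_range {φ : (β → S k d) →ₗ[S k d] (ι → S k d)} {i : ℕ}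
    {c : Finset (Fin d) → ι → S k d} (hcN : ∀ τ, c τ ∈ LinearMap.range φ) (hc : SC i c) :
    ∃ u : Finset (Fin d) → β → S k d, SC i u ∧ ∀ τ, φ (u τ) = c τ := by
  choose u hu using hcN
  refine ⟨fun τ => if τ.card = i then u τ else 0, ?_, ?_⟩
  · intro τ hτ
    simp [hτ]
  · intro τ
    by_cases h : τ.card = i
    · simp [h, hu]
    · simp [h, hc τ h]

theorem lift_hom {φ : (β → S k d) →ₗ[S k d] (ι → S k d)} {r : ℕ} (h : HomMap φ r) {i q : ℕ}
    {c : Finset (Fin d) → ι → S k d} (hcN : ∀ τ, c τ ∈ LinearMap.range φ) (hc : SC i c)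
    (hq : ∀ τ, HV (c τ) q) :
    c = 0 ∨ r ≤ q ∧ ∃ u : Finset (Fin d) → β → S k d, SC i u ∧ (∀ τ, φ (u τ) = c τ) ∧
      ∀ τ, HV (u τ) (q - r) := by
  obtain ⟨u, hu, huc⟩ := lift_range hcN hc
  by_cases hqr : q < r
  · left
    funext τ
    rw [← HV_iff.1 (hq τ), ← huc, hcv_map_lt h hqr]
    rfl
  · right
    refine ⟨by omega, fun τ => hcv (q - r) (u τ), ?_, ?_, ?_⟩
    · intro τ hτ
      change hcv (q - r) (u τ) = 0
      rw [hu τ hτ, hcv_zero]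
    · intro τ
      rw [← hcv_map h, huc, Nat.sub_add_cancel (by omega), HV_iff.1 (hq τ)]
    · intro τ
      exact HV_hcv _ _

theorem KVan_zero {φ : (β → S k d) →ₗ[S k d] (ι → S k d)} {r : ℕ} (h : HomMap φ r) :
    KVan (LinearMap.range φ) r 0 := by
  intro q hq c hcN hc hH hk
  rcases lift_hom h hcN hc hH with rfl | ⟨hr, u, hu, huc, huH⟩
  · exact ⟨0, fun _ => zero_mem _, fun _ _ => rfl, by simp⟩
  · obtain ⟨b, hb, hbb⟩ := koszul_vec 0 u hu (Or.inr ⟨q - r, by omega, huH⟩)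
      (bd_zero_of_SC_zero hu X)
    refine ⟨fun τ => φ (b τ), fun τ => ⟨_, rfl⟩, ?_, ?_⟩
    · intro τ hτ
      change φ (b τ) = 0
      rw [hb τ hτ, map_zero]
    · funext τ
      rw [← bd_lin, hbb, huc]

theorem KVan_succ {φ : (β → S k d) →ₗ[S k d] (ι → S k d)} {r : ℕ} (h : HomMap φ r) {i : ℕ}
    (hK : KVan (LinearMap.ker φ) 1 i) : KVan (LinearMap.range φ) r (i + 1) := by
  intro q hq c hcN hc hH hk
  rcases lift_hom h hcN hc hH with rfl | ⟨hr, u, hu, huc, huH⟩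
  · exact ⟨0, fun _ => zero_mem _, fun _ _ => rfl, by simp⟩
  · obtain ⟨w, hwN, hw, hww⟩ := hK (q - r + 1) (by omega) (bd (R := S k d) X u) (by
        intro τ
        rw [LinearMap.mem_ker, bd_lin]
        simp only [huc]
        exact congrFun hk τ) (hu.bd X) (by
        intro τ
        rw [HV_iff, hcv_bd]
        simp only [HV_iff.1 (huH _)]) (bd_bd _ _)
    obtain ⟨b, hb, hbb⟩ := koszul_vec (i + 1) (u - w) (hu.sub hw) (Or.inl (by omega)) (by
      rw [map_sub, hww, sub_self])
    refine ⟨fun τ => φ (b τ), fun τ => ⟨_, rfl⟩, ?_, ?_⟩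
    · intro τ hτ
      change φ (b τ) = 0
      rw [hb τ hτ, map_zero]
    · funext τ
      rw [← bd_lin, hbb, Pi.sub_apply, map_sub, huc, LinearMap.mem_ker.1 (hwN τ), sub_zero]

theorem KVan_ker {φ : (β → S k d) →ₗ[S k d] (ι → S k d)} {r : ℕ} (h : HomMap φ r) {i : ℕ}
    (hconst : ∀ u, HV u 0 → φ u = 0 → u = 0)
    (hK : KVan (LinearMap.range φ) r (i + 1)) : KVan (LinearMap.ker φ) 1 i := by
  intro q hq c hcN hc hH hk
  by_cases h0 : q = 0
  · subst h0
    have : c = 0 := by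
      funext τ
      exact hconst _ (hH τ) (hcN τ)
    subst this
    exact ⟨0, fun _ => zero_mem _, fun _ _ => rfl, by simp⟩
  · obtain ⟨b0, hb0, hbb0⟩ := koszul_vec i c hc (Or.inr ⟨q, by omega, hH⟩) hk
    obtain ⟨b, hb, hbb, hbH⟩ : ∃ b : Finset (Fin d) → β → S k d, SC (i + 1) b ∧
        bd (R := S k d) X b = c ∧ ∀ τ, HV (b τ) (q - 1) := by
      refine ⟨fun τ => hcv (q - 1) (b0 τ), ?_, ?_, fun τ => HV_hcv _ _⟩
      · intro τ hτ
        change hcv (q - 1) (b0 τ) = 0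
        rw [hb0 τ hτ, hcv_zero]
      · funext τ
        rw [← hcv_bd, hbb0, Nat.sub_add_cancel (by omega), HV_iff.1 (hH τ)]
    obtain ⟨w, hwN, hw, hww⟩ := hK (q - 1 + r) (by omega) (fun τ => φ (b τ))
      (fun τ => ⟨_, rfl⟩) (by
        intro τ hτ
        change φ (b τ) = 0
        rw [hb τ hτ, map_zero]) (fun τ => (hbH τ).map h) (by
        funext τ
        rw [← bd_lin, hbb]
        exact hcN τ)
    obtain ⟨v, hv, hvw⟩ := lift_range hwN hw
    refine ⟨b - bd (R := S k d) X v, ?_, hb.sub (hv.bd X), ?_⟩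
    · intro τ
      rw [LinearMap.mem_ker, Pi.sub_apply, map_sub, bd_lin]
      simp only [hvw]
      rw [hww, sub_self]
    · rw [map_sub, hbb, bd_bd, sub_zero]

end linres
end helpers

section helpers

variable {k} {d}

section linres2
open MvPolynomial

variable {ι : Type}

theorem homMap_iff {b : ℕ} {φ : (Fin b → S k d) →ₗ[S k d] (ι → S k d)} {r : ℕ} :
    HomMap φ r ↔ ∀ (j : Fin b) i, (φ (Pi.single j 1) i).IsHomogeneous r := by
  unfold HomMap
  have : (fun a b => Classical.propDecidable (a = b) : DecidableEq (Fin b)) =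
    instDecidableEqFin b := Subsingleton.elim _ _
  rw [this]

/-- Homogeneous submodule. -/
def HomSub (N : Submodule (S k d) (ι → S k d)) : Prop := ∀ v ∈ N, ∀ q, hcv q v ∈ N

theorem gen_aux {N : Submodule (S k d) (ι → S k d)} {r : ℕ} (hN : HomSub N) (hK : KVan N r 0)
    (q : ℕ) : ∀ v ∈ N, HV v q → v ∈ Submodule.span (S k d) {v | v ∈ N ∧ HV v r} := by
  induction q with
  | zero =>
    intro v hv hq
    by_cases hr : 0 = r
    · subst hr
      exact Submodule.subset_span ⟨hv, hq⟩
    obtain ⟨w, hwN, hw, hww⟩ := hK 0 hr (fun τ => if τ = ∅ then v else 0) (by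
      intro τ
      split_ifs
      · exact hv
      · exact zero_mem _) (by
      intro τ hτ
      apply if_neg
      rintro rfl
      simp at hτ) (by
      intro τ
      split_ifs
      · exact hq
      · exact fun j => isHomogeneous_zero _ _ _) (by
      apply bd_zero_of_SC_zero
      intro τ hτ
      apply if_neg
      rintro rfl
      simp at hτ)
    have h1 := congrFun hww ∅
    rw [if_pos rfl] at h1
    have h2 : v = 0 := by
      rw [← HV_iff.1 hq, ← h1, hcv_zero_bd]
    rw [h2]
    exact zero_mem _
  | succ q ih =>
    intro v hv hq
    by_cases hr : q + 1 = r
    · subst hr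
      exact Submodule.subset_span ⟨hv, hq⟩
    obtain ⟨w, hwN, hw, hww⟩ := hK (q + 1) hr (fun τ => if τ = ∅ then v else 0) (by
      intro τ
      split_ifs
      · exact hv
      · exact zero_mem _) (by
      intro τ hτ
      apply if_neg
      rintro rfl
      simp at hτ) (by
      intro τ
      split_ifs
      · exact hq
      · exact fun j => isHomogeneous_zero _ _ _) (by
      apply bd_zero_of_SC_zero
      intro τ hτ
      apply if_neg
      rintro rfl
      simp at hτ)
    have h1 := congrFun hww ∅
    rw [if_pos rfl] at h1
    rw [← HV_iff.1 hq, ← h1, hcv_bd, bd_apply]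
    apply Submodule.sum_mem
    intro i _
    apply Submodule.smul_mem
    split_ifs
    · exact zero_mem _
    · apply zsmul_mem
      exact ih _ (hN _ (hwN _) q) (HV_hcv _ _)

theorem sum_hcv [Fintype ι] (v : ι → S k d) :
    ∑ q ∈ Finset.range ((Finset.univ.sup fun j => (v j).totalDegree) + 1), hcv q v = v := by
  funext j
  rw [Finset.sum_apply]
  conv_rhs => rw [← sum_homogeneousComponent (v j)]
  symm
  apply Finset.sum_subset
  · intro q hq
    rw [Finset.mem_range] at hq ⊢
    have : (v j).totalDegree ≤ Finset.univ.sup fun j => (v j).totalDegree :=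
      Finset.le_sup (f := fun j => (v j).totalDegree) (Finset.mem_univ j)
    omega
  · intro q _ hq
    rw [Finset.mem_range] at hq
    exact homogeneousComponent_eq_zero _ _ (by omega)

theorem gen [Fintype ι] {N : Submodule (S k d) (ι → S k d)} {r : ℕ} (hN : HomSub N)
    (hK : KVan N r 0) : Submodule.span (S k d) {v | v ∈ N ∧ HV v r} = N := by
  apply le_antisymm
  · rw [Submodule.span_le]
    exact fun v hv => hv.1
  · intro v hv
    rw [← sum_hcv v]
    apply Submodule.sum_mem
    intro q _
    exact gen_aux hN hK q _ (hN v hv q) (HV_hcv _ _)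

theorem exists_cover [Fintype ι] {N : Submodule (S k d) (ι → S k d)} {r : ℕ} (hN : HomSub N)
    (hK : KVan N r 0) : ∃ (b : ℕ) (φ : (Fin b → S k d) →ₗ[S k d] (ι → S k d)),
      LinearMap.range φ = N ∧ HomMap φ r ∧ ∀ u, HV u 0 → φ u = 0 → u = 0 := by
  have hfg : (Submodule.span (S k d) {v | v ∈ N ∧ HV v r}).FG := IsNoetherian.noetherian _
  rw [Submodule.fg_span_iff_fg_span_finset_subset] at hfg
  obtain ⟨T, hT, hTN⟩ := hfg
  rw [gen hN hK] at hTN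
  obtain ⟨B, hBT, hBs, hBl⟩ := exists_linearIndependent k (T : Set (ι → S k d))
  have hBf : B.Finite := T.finite_toSet.subset hBT
  have hBN : Submodule.span (S k d) B = N := by
    apply le_antisymm
    · rw [Submodule.span_le]
      exact fun v hv => (hT (hBT hv)).1
    · rw [hTN, Submodule.span_le]
      intro v hv
      have h1 : v ∈ Submodule.span k (T : Set (ι → S k d)) := Submodule.subset_span hv
      rw [← hBs] at h1
      exact Submodule.span_le_restrictScalars k (S k d) B h1
  let := hBf.fintype
  let e := Fintype.equivFin B
  let f : Fin (Fintype.card B) → (ι → S k d) := fun j => (e.symm j : ι → S k d)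
  have hfl : LinearIndependent k f := hBl.comp e.symm e.symm.injective
  have hfr : Set.range f = B := by
    ext v
    constructor
    · rintro ⟨j, rfl⟩
      exact (e.symm j).2
    · intro hv
      exact ⟨e ⟨v, hv⟩, by simp [f]⟩
  refine ⟨Fintype.card B, Fintype.linearCombination (S k d) f, ?_, ?_, ?_⟩
  · rw [Fintype.range_linearCombination, hfr, hBN]
  · intro j i
    rw [Fintype.linearCombination_apply_single, one_smul]
    exact (hT (hBT (e.symm j).2)).2 i
  · intro u hu hz
    have hC : ∀ j, u j = C (coeff 0 (u j)) := by
      intro j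
      rw [← homogeneousComponent_zero]
      exact (homogeneousComponent_eq_self (hu j)).symm
    rw [Fintype.linearCombination_apply] at hz
    have h2 : ∑ j, coeff 0 (u j) • f j = 0 := by
      rw [← hz]
      apply Finset.sum_congr rfl
      intro j _
      conv_rhs => rw [hC j]
      funext i
      simp [MvPolynomial.smul_eq_C_mul]
    rw [Fintype.linearIndependent_iff] at hfl
    funext j
    rw [hC j, hfl _ h2 j]
    simp

theorem homSub_ker {β : Type} [Fintype β] {φ : (β → S k d) →ₗ[S k d] (ι → S k d)} {r : ℕ}
    (h : HomMap φ r) : HomSub (LinearMap.ker φ) := by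
  intro v hv q
  rw [LinearMap.mem_ker] at hv ⊢
  rw [← hcv_map h, hv, hcv_zero]

/-- An ideal as a submodule of vectors of length one. -/
def emb (J : Ideal (S k d)) : Submodule (S k d) (Unit → S k d) :=
  Submodule.comap (LinearMap.proj ()) J

theorem mem_emb {J : Ideal (S k d)} {v : Unit → S k d} : v ∈ emb J ↔ v () ∈ J := Iff.rfl

theorem toModuleMap_apply {b : ℕ} (g : Fin b → S k d) (u : Fin b → S k d) :
    toModuleMap k d g u = ∑ j, u j * g j := by
  simp [toModuleMap]

theorem KVan_of_resolution {J : Ideal (S k d)} (h : HasLinearFreeResolution k d J) :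
    ∃ r, ∀ i, KVan (emb J) r i := by
  obtain ⟨b, r, g, f, hg, hr, hf, h0, hn⟩ := h
  have key : ∀ i n, KVan (LinearMap.range (f n)) 1 i := by
    intro i
    induction i with
    | zero => exact fun n => KVan_zero (homMap_iff.2 (hf n))
    | succ i ih =>
      intro n
      apply KVan_succ (homMap_iff.2 (hf n))
      rw [LinearMap.exact_iff.1 (hn n)]
      exact ih (n + 1)
  let φ : (Fin (b 0) → S k d) →ₗ[S k d] (Unit → S k d) :=
    LinearMap.pi (fun _ => toModuleMap k d g)
  have hφ : HomMap φ r := by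
    rw [homMap_iff]
    intro j i
    change IsHomogeneous (toModuleMap k d g (Pi.single j 1)) r
    rw [toModuleMap_apply, Finset.sum_eq_single j]
    · simpa using hg j
    · intro j' _ hj
      rw [Pi.single_eq_of_ne hj, zero_mul]
    · simp
  have hrange : LinearMap.range φ = emb J := by
    ext v
    rw [mem_emb, ← hr]
    constructor
    · rintro ⟨u, rfl⟩
      exact ⟨u, rfl⟩
    · rintro ⟨u, hu⟩
      exact ⟨u, funext fun _ => hu⟩
  have hker : LinearMap.ker φ = LinearMap.range (f 0) := by
    rw [← LinearMap.exact_iff.1 h0]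
    ext u
    rw [LinearMap.mem_ker, LinearMap.mem_ker]
    constructor
    · intro h
      exact congrFun h ()
    · intro h
      exact funext fun _ => h
  refine ⟨r, fun i => ?_⟩
  rw [← hrange]
  cases i with
  | zero => exact KVan_zero hφ
  | succ i =>
    apply KVan_succ hφ
    rw [hker]
    exact key i 0

variable (k d) in
/-- A stage in the construction of the resolution. -/
structure Stage where
  /-- rank -/
  b : ℕ
  /-- syzygies -/
  N : Submodule (S k d) (Fin b → S k d)
  hN : HomSub N
  hK : ∀ i, KVan N 1 i

theorem exists_stage {N : Submodule (S k d) (ι → S k d)} [Fintype ι] {r : ℕ} (hN : HomSub N)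
    (hK : ∀ i, KVan N r i) : ∃ (st : Stage k d) (φ : (Fin st.b → S k d) →ₗ[S k d] (ι → S k d)),
      LinearMap.range φ = N ∧ LinearMap.ker φ = st.N ∧ HomMap φ r := by
  obtain ⟨b, φ, h1, h2, h3⟩ := exists_cover hN (hK 0)
  refine ⟨⟨b, LinearMap.ker φ, homSub_ker h2, fun i => ?_⟩, φ, h1, rfl, h2⟩
  apply KVan_ker h2 h3
  rw [h1]
  exact hK (i + 1)

theorem resolution_of_KVan {J : Ideal (S k d)} {r : ℕ} (hJ : HomSub (emb J))
    (h : ∀ i, KVan (emb J) r i) : HasLinearFreeResolution k d J := by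
  obtain ⟨st0, φ, h1, h2, h3⟩ := exists_stage hJ h
  have step : ∀ st : Stage k d, ∃ (st' : Stage k d)
      (f : (Fin st'.b → S k d) →ₗ[S k d] (Fin st.b → S k d)),
      LinearMap.range f = st.N ∧ LinearMap.ker f = st'.N ∧ HomMap f 1 :=
    fun st => exists_stage st.hN st.hK
  choose nx f hf1 hf2 hf3 using step
  let st : ℕ → Stage k d := fun n => Nat.rec st0 (fun _ s => nx s) n
  let g : Fin st0.b → S k d := fun j => φ (Pi.single j 1) ()
  have hφ : ∀ u, φ u () = toModuleMap k d g u := by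
    intro u
    rw [toModuleMap_apply, LinearMap.pi_apply_eq_sum_univ φ u, Finset.sum_apply]
    apply Finset.sum_congr rfl
    intro j _
    rw [Pi.smul_apply, smul_eq_mul]
    have e : (fun j' => if j = j' then (1 : S k d) else 0) = Pi.single j 1 := by
      funext j'
      rw [Pi.single_apply]
      by_cases hj : j = j'
      · simp [hj]
      · simp [hj, Ne.symm hj]
    rw [e]
  refine ⟨fun n => (st n).b, r, g, fun n => f (st n), ?_, ?_, ?_, ?_, ?_⟩
  · intro j
    exact homMap_iff.1 h3 j ()
  · ext p
    constructor
    · rintro ⟨u, rfl⟩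
      have : φ u ∈ emb J := by
        rw [← h1]
        exact ⟨u, rfl⟩
      rw [mem_emb, hφ] at this
      exact this
    · intro hp
      have : (fun _ => p : Unit → S k d) ∈ emb J := hp
      rw [← h1] at this
      obtain ⟨u, hu⟩ := this
      refine ⟨u, ?_⟩
      exact (hφ u).symm.trans (congrFun hu ())
  · intro n j j'
    exact homMap_iff.1 (hf3 (st n)) j j'
  · rw [LinearMap.exact_iff, hf1]
    change _ = st0.N
    rw [← h2]
    ext u
    rw [LinearMap.mem_ker, LinearMap.mem_ker]
    constructor
    · intro h
      exact funext fun _ => (hφ u).trans h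
    · intro h
      exact (hφ u).symm.trans (congrFun h ())
  · intro n
    rw [LinearMap.exact_iff, hf1, hf2]

end linres2
end helpers

section helpers

variable {k} {d}

section final
open MvPolynomial

variable {Δ : Finset (Finset (Fin d))}

theorem KVan_emb_iff (hΔ : ∀ σ ∈ Δ, ∀ τ ⊆ σ, τ ∈ Δ) (r i : ℕ) :
    KVan (emb (dualSRIdeal k d Δ)) r i ↔
      ∀ q, q ≠ r → ∀ σ : Finset (Fin d), σ.card = i + q → Ex k (QF Δ σ) i := by
  apply forall_congr'
  intro q
  apply imp_congr_right
  intro _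
  rw [dual_ex hΔ i q]
  constructor
  · intro h c hc hcN hcH hk
    obtain ⟨w, hwN, hw, hww⟩ := h (fun τ _ => c τ) hcN (fun τ hτ => funext fun _ => hc τ hτ)
      (fun τ _ => hcH τ) (by
        funext τ j
        rw [bd_coord]
        exact congrFun hk τ)
    refine ⟨fun τ => w τ (), hwN, fun τ hτ => congrFun (hw τ hτ) (), ?_⟩
    funext τ
    rw [← bd_coord, hww]
  · intro h c hcN hc hcH hk
    obtain ⟨b, hbN, hb, hbb⟩ := h (fun τ => c τ ()) (fun τ hτ => congrFun (hc τ hτ) ()) hcN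
      (fun τ => hcH τ ()) (by
        funext τ
        rw [← bd_coord, hk]
        rfl)
    refine ⟨fun τ _ => b τ, hbN, fun τ hτ => funext fun _ => hb τ hτ, ?_⟩
    funext τ j
    rw [bd_coord]
    exact congrFun hbb τ

theorem homSub_dual (hΔ : ∀ σ ∈ Δ, ∀ τ ⊆ σ, τ ∈ Δ) : HomSub (emb (dualSRIdeal k d Δ)) := by
  intro v hv q
  rw [mem_emb, (isMon_dual hΔ).1] at hv ⊢
  intro e he
  apply hv
  intro h0
  apply he
  rw [hcv, coeff_homogeneousComponent, h0, ite_self]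

theorem QF_iff (σ τ : Finset (Fin d)) : QF Δ σ τ ↔ τ ⊆ σ ∧ PF Δ σᶜ σ (σ \ τ) := by
  unfold QF PF
  apply and_congr_right
  intro h
  have : σᶜ ∪ (σ \ (σ \ τ)) = (σ \ τ)ᶜ := by
    ext x
    simp
    tauto
  rw [this]
  simp

theorem PF_iff (σ τ : Finset (Fin d)) : PF Δ σᶜ σ τ ↔ τ ⊆ σ ∧ QF Δ σ (σ \ τ) := by
  constructor
  · intro h
    refine ⟨h.1, ?_⟩
    rw [QF_iff, Finset.sdiff_sdiff_eq_self h.1]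
    exact ⟨Finset.sdiff_subset, h⟩
  · rintro ⟨h, h'⟩
    rw [QF_iff, Finset.sdiff_sdiff_eq_self h] at h'
    exact h'.2

theorem not_Ex_facet {n : ℕ} (hn : ∀ F ∈ Δ, F.card ≤ n) {F : Finset (Fin d)} (hF : F ∈ Δ)
    (hFn : F.card = n) : ¬ Ex k (QF Δ Fᶜ) 0 := by
  intro h
  obtain ⟨w, hw, hww⟩ := h (fun τ => if τ = ∅ then 1 else 0) (by
    intro τ hτ
    apply if_neg
    rintro rfl
    exact hτ ⟨⟨by simp, by simpa using hF⟩, rfl⟩) (by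
    intro τ _
    have : SC 0 (fun τ : Finset (Fin d) => if τ = ∅ then (1 : k) else 0) := by
      intro τ hτ
      apply if_neg
      rintro rfl
      simp at hτ
    exact congrFun (bd_zero_of_SC_zero this _) τ)
  have hw0 : w = 0 := by
    funext τ
    apply hw
    rintro ⟨⟨h1, h2⟩, h3⟩
    have := hn _ h2
    have h4 := Finset.card_compl (Fᶜ \ τ)
    have h5 := Finset.card_sdiff_add_card_eq_card h1
    have h6 := Finset.card_compl F
    have h7 := Finset.card_le_univ F
    simp only [Fintype.card_fin] at h4 h6 h7
    omega
  have := hww ∅ ⟨by simp, by simpa using hF⟩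
  rw [hw0] at this
  simp [del] at this

theorem main (hne : Δ.Nonempty) (hΔ : ∀ σ ∈ Δ, ∀ τ ⊆ σ, τ ∈ Δ) :
    PolyRingIsCM k d (srIdeal k d Δ) ↔
      HasLinearFreeResolution k d (dualSRIdeal k d Δ) := by
  obtain ⟨F, hF, hFm⟩ := Finset.exists_max_image Δ Finset.card hne
  have hd : F.card ≤ d := by simpa using Finset.card_le_univ F
  rw [CM_iff hne hΔ hFm ⟨F, hF, rfl⟩]
  constructor
  · intro h
    apply resolution_of_KVan (r := d - F.card) (homSub_dual hΔ)
    intro i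
    rw [KVan_emb_iff hΔ]
    intro q hq σ hσ
    rcases lt_or_gt_of_ne hq with hlt | hgt
    · apply Ex_of_empty
      rintro τ ⟨h1, h2⟩ h3
      have := hFm _ h2
      have h4 := Finset.card_compl (σ \ τ)
      have h5 := Finset.card_sdiff_add_card_eq_card h1
      have h7 := Finset.card_le_univ (σ \ τ)
      simp only [Fintype.card_fin] at h4 h7
      omega
    · have := Ex_compl (fun τ (hτ : PF Δ σᶜ σ τ) => hτ.1) (QF_iff σ) (by omega) (h σ q hgt)
      rwa [hσ, Nat.add_sub_cancel] at this
  · intro h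
    obtain ⟨r, hr⟩ := KVan_of_resolution h
    simp only [KVan_emb_iff hΔ] at hr
    have hrr : d - F.card = r := by
      by_contra hne
      exact not_Ex_facet hFm hF rfl (hr 0 _ hne Fᶜ (by rw [Finset.card_compl]; simp))
    intro σ i hi
    by_cases his : i ≤ σ.card
    · have := Ex_compl (fun τ (hτ : QF Δ σ τ) => hτ.1) (PF_iff σ) (Nat.sub_le _ _)
        (hr (σ.card - i) i (by omega) σ (by omega))
      rwa [Nat.sub_sub_self his] at this
    · apply Ex_of_empty
      intro τ hτ h3
      have := Finset.card_le_card hτ.1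
      omega

end final
end helpers

/-- **Statement 17 (Eagon--Reiner).**  For a simplicial complex `Δ` on the vertex
set `{1, …, d}`, the Stanley--Reisner ring `S/I_Δ` is Cohen--Macaulay if and only if
the Stanley--Reisner ideal `I_{Δ*}` of the Alexander dual complex has a linear free
resolution. -/
theorem eagon_reiner (Δ : Finset (Finset (Fin d))) (hne : Δ.Nonempty)
    (hΔ : ∀ σ ∈ Δ, ∀ τ ⊆ σ, τ ∈ Δ) :
    PolyRingIsCM k d (srIdeal k d Δ) ↔
      HasLinearFreeResolution k d (dualSRIdeal k d Δ) := by
  exact main hne hΔ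

end EagonReiner
end
end

section
/- For each face F of Q, the complex of ℤ^d-graded k[Q]-modules 0 → k[F] → ⊕_{G, G a facet of F} k[G] → ⋯ → ⊕_{G ⊆ F, dim G = 1} k[G] → k → 0, whose term in cohomological degree i is ⊕_{G ⊆ F, dim G = dim F − i} k[G] and whose differentials have component from k[G] to k[G'] equal to ε(G',G) times the quotient map when G' is a facet of G (and 0 otherwise), is exact except at the leftmost term, and the kernel of the first map k[F] → ⊕_{facets G of F} k[G] is the canonical module ω_{k[F]}; in other words, this complex is an irreducible resolution of ω_{k[F]}. -/
attribute [local instance] Classical.propDecidable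

set_option synthInstance.maxHeartbeats 1000000
set_option maxHeartbeats 4000000

noncomputable section

open DirectSum

namespace ZMS

/-- The ambient lattice `ℤ^d`. -/
abbrev L (d : ℕ) : Type := Fin d → ℤ

variable (k : Type) [Field k] {d : ℕ} (Q : AddSubmonoid (L d))

/-- `Q ⊆ ℤ^d` is a normal affine semigroup. -/
structure IsNormalAffineSemigroup (Q : AddSubmonoid (L d)) : Prop where
  fg : Q.FG
  generates : AddSubgroup.closure (Q : Set (L d)) = ⊤
  pointed : ∀ x ∈ Q, -x ∈ Q → x = 0
  saturated : ∀ (x : L d) (n : ℕ), 0 < n → n • x ∈ Q → x ∈ Q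

/-- The affine semigroup ring `k[Q]`. -/
abbrev kQ : Type := AddMonoidAlgebra k Q

/-- The monomial `x^q` in `k[Q]`. -/
def mono (q : Q) : kQ k Q := AddMonoidAlgebra.single q 1

/-- A monomial (i.e. `ℤ^d`-graded) ideal of `k[Q]`. -/
def IsMonomialIdeal (W : Ideal (kQ k Q)) : Prop :=
  ∃ S : Set Q, W = Ideal.span (mono k Q '' S)

/-- An ideal is irreducible if it is not the intersection of two ideals
properly containing it. -/
def IsIrreducibleIdeal (W : Ideal (kQ k Q)) : Prop :=
  ∀ W₁ W₂ : Ideal (kQ k Q), W = W₁ ⊓ W₂ → W = W₁ ∨ W = W₂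

/-- A face of `Q`: the zero set in `Q` of a linear functional nonnegative on `Q`. -/
def IsFace (F : AddSubmonoid (L d)) : Prop :=
  ∃ lam : L d →ₗ[ℤ] ℤ, (∀ x ∈ Q, 0 ≤ lam x) ∧
    (F : Set (L d)) = {x | x ∈ Q ∧ lam x = 0}

/-- The dimension of (the real cone spanned by) a face. -/
def faceDim (F : AddSubmonoid (L d)) : ℕ :=
  Module.finrank ℤ (AddSubgroup.closure (F : Set (L d)))

/-- `G'` is a facet of `G`. -/
def IsFacetOf (G' G : AddSubmonoid (L d)) : Prop :=
  IsFace Q G' ∧ IsFace Q G ∧ G' ≤ G ∧ faceDim G' + 1 = faceDim G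

/-- The monomial prime ideal of the face `F`, i.e. the kernel of `k[Q] → k[F]`. -/
def facePrime (F : AddSubmonoid (L d)) : Ideal (kQ k Q) :=
  Ideal.span {m | ∃ q : Q, (q : L d) ∉ F ∧ m = mono k Q q}

lemma facePrime_mono {F G : AddSubmonoid (L d)} (h : G ≤ F) :
    facePrime k Q F ≤ facePrime k Q G := by
  apply Ideal.span_mono
  rintro m ⟨q, hq, rfl⟩
  exact ⟨q, fun hm => hq (h hm), rfl⟩

/-- The semigroup ring `k[F]` of a face `F`, as a quotient of `k[Q]`. -/
abbrev faceRing (F : AddSubmonoid (L d)) : Type := kQ k Q ⧸ facePrime k Q F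

/-- The `k[Q]`-linear quotient map between quotients of `k[Q]`. -/
def fMap {I J : Ideal (kQ k Q)} (h : I ≤ J) :
    (kQ k Q ⧸ I) →ₗ[kQ k Q] (kQ k Q ⧸ J) :=
  Submodule.mapQ _ _ LinearMap.id (by simpa using h)

/-- Lattice points in the relative interior of a face `F`. -/
def relint (F : AddSubmonoid (L d)) : Set (L d) :=
  {a | a ∈ F ∧ ∀ G, IsFace Q G → G ≤ F → G ≠ F → a ∉ G}

/-- The canonical module `ω_{k[F]}`, the span in `k[F]` of the monomials whose
exponents lie in the relative interior of `F`. -/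
def canonicalModule (F : AddSubmonoid (L d)) : Submodule (kQ k Q) (faceRing k Q F) :=
  Submodule.span (kQ k Q)
    {x | ∃ q : Q, (q : L d) ∈ relint Q F ∧ x = Ideal.Quotient.mk (facePrime k Q F) (mono k Q q)}

/-- The `ℤ^d`-degree-`a` component of a quotient of `k[Q]` by a monomial ideal. -/
def quotDeg (W : Ideal (kQ k Q)) (a : L d) : Submodule k (kQ k Q ⧸ W) :=
  Submodule.span k {x | ∃ q : Q, (q : L d) = a ∧ x = Ideal.Quotient.mk W (mono k Q q)}

/-- Isomorphism of `ℤ^d`-graded `k[Q]`-modules between the quotients of `k[Q]` by two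
monomial ideals. -/
def GradedQuotIso (W W' : Ideal (kQ k Q)) : Prop :=
  ∃ e : (kQ k Q ⧸ W) ≃ₗ[kQ k Q] (kQ k Q ⧸ W'),
    (∀ (a : L d) (x), x ∈ quotDeg k Q W a → e x ∈ quotDeg k Q W' a) ∧
    (∀ (a : L d) (x), x ∈ quotDeg k Q W' a → e.symm x ∈ quotDeg k Q W a)

/-- The `ℤ^d`-degree-`a` component of a direct sum of quotients of `k[Q]` by
monomial ideals. -/
def sumDeg {ι : Type} (W : ι → Ideal (kQ k Q)) (a : L d) :
    Submodule k (⨁ j, kQ k Q ⧸ W j) :=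
  Submodule.span k {x | ∃ (q : Q) (j : ι), (q : L d) = a ∧
    x = DirectSum.lof (kQ k Q) ι (fun j => kQ k Q ⧸ W j) j
          (Ideal.Quotient.mk (W j) (mono k Q q))}


section Zeeman

variable (Δ : Finset (AddSubmonoid (L d)))
variable (ε : AddSubmonoid (L d) → AddSubmonoid (L d) → ℤ)
/-- `Δ` is a polyhedral subcomplex of `ℝ_{≥0} Q`: a collection of faces of `Q`
closed under taking faces. -/
def IsPolyhedralComplex : Prop :=
  (∀ F ∈ Δ, IsFace Q F) ∧ (∀ F ∈ Δ, ∀ G, IsFace Q G → G ≤ F → G ∈ Δ)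

/-- `ε` is an incidence function on the faces of `ℝ_{≥0} Q`. -/
def IsIncidence : Prop :=
  (∀ G' G, IsFacetOf Q G' G → ε G' G = 1 ∨ ε G' G = -1) ∧
  (∀ G₁ G₂ G₃ G₄, G₂ ≠ G₃ → IsFacetOf Q G₁ G₂ → IsFacetOf Q G₂ G₄ →
    IsFacetOf Q G₁ G₃ → IsFacetOf Q G₃ G₄ →
    ε G₁ G₂ * ε G₂ G₄ + ε G₁ G₃ * ε G₃ G₄ = 0)

/-- The dimension of the polyhedral complex `Δ`. -/
abbrev cxDim : ℕ := Δ.sup faceDim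

/-- The radical monomial ideal `I_Δ`, spanned by all monomials lying on no face of `Δ`. -/
def complexIdeal : Ideal (kQ k Q) :=
  Ideal.span {m | ∃ q : Q, (∀ F ∈ Δ, (q : L d) ∉ F) ∧ m = mono k Q q}


end Zeeman


section FaceComplex

variable (F : AddSubmonoid (L d)) (Φ : Finset (AddSubmonoid (L d)))

/-- Faces `G ⊆ F` with `dim G = dim F - i` (drawn from a finite enumeration `Φ` of
the faces of `Q`). -/
abbrev WIdx (i : ℕ) : Type :=
  {G : {G // G ∈ Φ} // (G : AddSubmonoid (L d)) ≤ F ∧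
    faceDim (G : AddSubmonoid (L d)) + i = faceDim F}

/-- The term `⊕_{G ⊆ F, dim G = dim F - i} k[G]` of the complex (in cohomological
degree `i ≥ 1`). -/
abbrev WMod (i : ℕ) : Type := ⨁ G : WIdx F Φ i, faceRing k Q (G : AddSubmonoid (L d))

variable (ε : AddSubmonoid (L d) → AddSubmonoid (L d) → ℤ)

/-- The first map `k[F] → ⊕_{facets G of F} k[G]`, with components `ε(G,F)` times
the quotient maps. -/
def wd0 : faceRing k Q F →ₗ[kQ k Q] WMod k Q F Φ 1 :=
  ∑ G : WIdx F Φ 1,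
    if h : IsFacetOf Q (G : AddSubmonoid (L d)) F
    then (ε (G : AddSubmonoid (L d)) F) •
      ((DirectSum.lof (kQ k Q) _ _ G) ∘ₗ fMap k Q (facePrime_mono k Q h.2.2.1))
    else 0

/-- The differentials of the complex, with components `ε(G',G)` times the quotient
maps `k[G] → k[G']` for facets `G'` of `G` (and `0` otherwise). -/
def wd (i : ℕ) : WMod k Q F Φ (i+1) →ₗ[kQ k Q] WMod k Q F Φ (i+2) :=
  DirectSum.toModule _ _ _ fun G =>
    ∑ G' : WIdx F Φ (i+2),
      if h : IsFacetOf Q (G' : AddSubmonoid (L d)) (G : AddSubmonoid (L d))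
      then (ε (G' : AddSubmonoid (L d)) (G : AddSubmonoid (L d))) •
        ((DirectSum.lof (kQ k Q) _ _ G') ∘ₗ fMap k Q (facePrime_mono k Q h.2.2.1))
      else 0

end FaceComplex

section Combi

/-- Exactness of the complex spanned by `S`, with differential given by the matrix `e`. -/
def Acyc {X : Type} [Fintype X] (e : X → X → k) (S : Set X) : Prop :=
  ∀ x : X → k, (∀ a, x a ≠ 0 → a ∈ S) → (∀ a ∈ S, ∑ b, e a b * x b = 0) →
    ∃ y : X → k, (∀ a, y a ≠ 0 → a ∈ S) ∧ ∀ a ∈ S, x a = ∑ b, e a b * y b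

variable {k} {X : Type} [Fintype X] [PartialOrder X] {e : X → X → k}

lemma Acyc.glue (he : ∀ a b, e a b ≠ 0 → a ≤ b)
    (hee : ∀ a c, ∑ b, e a b * e b c = 0) {S S₁ S₂ : Set X}
    (hconv : ∀ a b c, a ∈ S → c ∈ S → a ≤ b → b ≤ c → b ∈ S)
    (hS : ∀ a, a ∈ S ↔ a ∈ S₁ ∨ a ∈ S₂)
    (hlow : ∀ a b, a ∈ S₂ → b ∈ S₁ → ¬ a ≤ b)
    (h1 : Acyc k e S₁) (h2 : Acyc k e S₂) : Acyc k e S := by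
  intro x hx hdx
  have hdisj : ∀ a, a ∈ S₁ → a ∈ S₂ → False := fun a h1 h2 => hlow a a h2 h1 le_rfl
  have key : ∀ (y : X → k), (∀ a, y a ≠ 0 → a ∈ S₁) → ∀ a ∈ S₂, ∑ b, e a b * y b = 0 := by
    intro y hy a ha
    apply Finset.sum_eq_zero
    intro b _
    by_contra h
    exact hlow a b ha (hy b (right_ne_zero_of_mul h)) (he a b (left_ne_zero_of_mul h))
  obtain ⟨y₂, hy₂, hxy₂⟩ := h2 (fun a => if a ∈ S₂ then x a else 0)
    (by intro a ha; by_contra h; simp [h] at ha)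
    (by
      intro a ha
      have h0 := hdx a ((hS a).2 (Or.inr ha))
      have h1 := key (fun b => if b ∈ S₂ then 0 else x b) (by
        intro b hb
        by_cases hb2 : b ∈ S₂
        · simp [hb2] at hb
        · simp only [hb2, if_false] at hb
          exact ((hS b).1 (hx b hb)).resolve_right hb2) a ha
      have : ∑ b, e a b * x b = ∑ b, e a b * (if b ∈ S₂ then x b else 0)
          + ∑ b, e a b * (if b ∈ S₂ then 0 else x b) := by
        rw [← Finset.sum_add_distrib]
        apply Finset.sum_congr rfl
        intro b _
        split_ifs <;> simp
      rw [this, h1, add_zero] at h0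
      exact h0)
  obtain ⟨y₁, hy₁, hxy₁⟩ := h1
    (fun a => if a ∈ S then x a - ∑ b, e a b * y₂ b else 0)
    (by
      intro a ha
      by_cases haS : a ∈ S
      · rcases (hS a).1 haS with h | h
        · exact h
        · exfalso; apply ha
          have := hxy₂ a h
          simp only [h, if_true] at this
          simp [this]
      · simp [haS] at ha)
    (by
      intro a ha
      have haS := (hS a).2 (Or.inl ha)
      have e1 : ∀ b, e a b * (if b ∈ S then x b - ∑ c, e b c * y₂ c else 0)
          = e a b * x b - ∑ c, (e a b * e b c) * y₂ c := by
        intro b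
        by_cases hb : b ∈ S
        · simp only [hb, if_true, mul_sub, Finset.mul_sum, mul_assoc]
        · have hxb : x b = 0 := by by_contra h; exact hb (hx b h)
          simp only [hb, if_false, hxb, mul_zero, zero_sub]
          rw [eq_comm, neg_eq_zero]
          apply Finset.sum_eq_zero
          intro c _
          by_contra h
          have hc := (hS c).2 (Or.inr (hy₂ c (right_ne_zero_of_mul h)))
          have hh := left_ne_zero_of_mul h
          exact hb (hconv a b c haS hc (he _ _ (left_ne_zero_of_mul hh))
            (he _ _ (right_ne_zero_of_mul hh)))
      rw [Finset.sum_congr rfl (fun b _ => e1 b), Finset.sum_sub_distrib, hdx a haS,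
        Finset.sum_comm]
      simp only [← Finset.sum_mul, hee, zero_mul, Finset.sum_const_zero, sub_zero])
  refine ⟨fun a => y₁ a + y₂ a, ?_, ?_⟩
  · intro a ha
    by_cases h : y₁ a = 0
    · simp only [h, zero_add] at ha
      exact (hS a).2 (Or.inr (hy₂ a ha))
    · exact (hS a).2 (Or.inl (hy₁ a h))
  · intro a ha
    simp only [mul_add, Finset.sum_add_distrib]
    rcases (hS a).1 ha with h | h
    · rw [← hxy₁ a h, if_pos ha]; ring
    · rw [key y₁ hy₁ a h, ← hxy₂ a h, if_pos h, zero_add]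

lemma Acyc.empty : Acyc k e (∅ : Set X) :=
  fun x _ _ => ⟨0, by simp, by simp⟩

lemma Acyc.fibers (he : ∀ a b, e a b ≠ 0 → a ≤ b)
    (hee : ∀ a c, ∑ b, e a b * e b c = 0) {T : Type} [PartialOrder T] (f : X → T) :
    ∀ (n : ℕ) (S : Set X), S.ncard ≤ n →
    (∀ a b c, a ∈ S → c ∈ S → a ≤ b → b ≤ c → b ∈ S) →
    (∀ a b, a ∈ S → b ∈ S → a ≤ b → f a ≤ f b) →
    (∀ a ∈ S, Acyc k e {b | b ∈ S ∧ f b = f a}) → Acyc k e S := by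
  intro n
  induction n with
  | zero =>
    intro S hn _ _ _
    have : S = ∅ := by
      rw [← Set.ncard_eq_zero (Set.toFinite S)]; omega
    rw [this]; exact Acyc.empty
  | succ n ih =>
    intro S hn hconv hmono hfib
    rcases S.eq_empty_or_nonempty with h | hne
    · rw [h]; exact Acyc.empty
    obtain ⟨m, hmS, hm⟩ := (Set.toFinite S).exists_maximalFor f S hne
    have hm' : ∀ b ∈ S, f m ≤ f b → f b = f m := fun b hb h => le_antisymm (hm hb h) h
    refine Acyc.glue he hee hconv (S₁ := {b | b ∈ S ∧ f b ≠ f m})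
      (S₂ := {b | b ∈ S ∧ f b = f m}) ?_ ?_ ?_ (hfib m hmS)
    · intro a
      simp only [Set.mem_setOf_eq]
      tauto
    · rintro a b ⟨ha, hfa⟩ ⟨hb, hfb⟩ hab
      exact hfb (hm' b hb (hfa ▸ hmono a b ha hb hab))
    · apply ih
      · have : {b | b ∈ S ∧ f b ≠ f m}.ncard < S.ncard := by
          apply Set.ncard_lt_ncard _ (Set.toFinite S)
          exact ⟨fun b hb => hb.1, fun h => (h hmS).2 rfl⟩
        omega
      · rintro a b c ⟨ha, hfa⟩ ⟨hc, hfc⟩ hab hbc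
        have hb := hconv a b c ha hc hab hbc
        exact ⟨hb, fun h => hfc (hm' c hc (h ▸ hmono b c hb hc hbc))⟩
      · intro a b ha hb hab
        exact hmono a b ha.1 hb.1 hab
      · rintro a ⟨ha, hfa⟩
        convert hfib a ha using 1
        ext b
        simp only [Set.mem_setOf_eq]
        constructor
        · rintro ⟨⟨h1, h2⟩, h3⟩; exact ⟨h1, h3⟩
        · rintro ⟨h1, h3⟩; exact ⟨⟨h1, by rw [h3]; exact hfa⟩, h3⟩

end Combi

section Geom


lemma vanish_span {A : AddSubmonoid (L d)} {l : L d →ₗ[ℤ] ℤ} (h : ∀ a ∈ A, l a = 0) :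
    ∀ a ∈ AddSubgroup.closure (A : Set (L d)), l a = 0 := by
  intro a ha
  induction ha using AddSubgroup.closure_induction with
  | mem x hx => exact h x hx
  | zero => simp
  | add x y _ _ hx hy => simp [hx, hy]
  | neg x _ hx => simp [hx]

lemma finrank_rn {M N : Type} [AddCommGroup M] [AddCommGroup N] [Module.Finite ℤ M]
    (f : M →ₗ[ℤ] N) :
    Module.finrank ℤ (LinearMap.range f) + Module.finrank ℤ (LinearMap.ker f) =
      Module.finrank ℤ M := by
  rw [← (LinearMap.quotKerEquivRange f).finrank_eq]
  exact Submodule.finrank_quotient_add_finrank _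

lemma faceDim_lt {A F : AddSubmonoid (L d)} (hAF : A ≤ F) (l : L d →ₗ[ℤ] ℤ)
    (hA : ∀ a ∈ A, l a = 0) (v : L d) (hv : v ∈ F) (hlv : l v ≠ 0) :
    faceDim A < faceDim F := by
  let HA := AddSubgroup.toIntSubmodule (AddSubgroup.closure (A : Set (L d)))
  let HF := AddSubgroup.toIntSubmodule (AddSubgroup.closure (F : Set (L d)))
  have hle : HA ≤ HF := AddSubgroup.closure_mono hAF
  have e1 : faceDim A = Module.finrank ℤ HA := rfl
  have e2 : faceDim F = Module.finrank ℤ HF := rfl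
  rw [e1, e2]
  let f := l.domRestrict HF
  have h1 := finrank_rn f
  let g : HA →ₗ[ℤ] LinearMap.ker f :=
    LinearMap.codRestrict _ (Submodule.inclusion hle) (by
      rintro ⟨x, hx⟩
      exact vanish_span hA x hx)
  have hg : Function.Injective g := by
    intro x y hxy
    have := congrArg (fun z : LinearMap.ker f => ((z : HF) : L d)) hxy
    exact Subtype.ext this
  have h2 := LinearMap.finrank_le_finrank_of_injective hg
  have h3 : Module.finrank ℤ (LinearMap.range f) ≠ 0 := by
    rw [Ne, Module.finrank_eq_zero_iff_isTorsion]
    intro ht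
    have hv' : v ∈ HF := AddSubgroup.subset_closure hv
    obtain ⟨a, ha⟩ := @ht ⟨f ⟨v, hv'⟩, ⟨_, rfl⟩⟩
    have := congrArg Subtype.val ha
    have h4 : (a : ℤ) * l v = 0 := this
    rcases mul_eq_zero.1 h4 with h | h
    · exact nonZeroDivisors.coe_ne_zero a h
    · exact hlv h
  omega

lemma faceDim_le {A F : AddSubmonoid (L d)} (l : L d →ₗ[ℤ] ℤ)
    (v : L d) (hlv : l v ≠ 0)
    (hprop : ∀ m : L d →ₗ[ℤ] ℤ, (∀ a ∈ A, m a = 0) → ∀ x ∈ F, l v * m x = m v * l x) :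
    faceDim F ≤ faceDim A + 1 := by
  let HA := AddSubgroup.toIntSubmodule (AddSubgroup.closure (A : Set (L d)))
  let HF := AddSubgroup.toIntSubmodule (AddSubgroup.closure (F : Set (L d)))
  have e1 : faceDim A = Module.finrank ℤ HA := rfl
  have e2 : faceDim F = Module.finrank ℤ HF := rfl
  rw [e1, e2]
  let f := l.domRestrict HF
  have h1 := finrank_rn f
  have h2 : Module.finrank ℤ (LinearMap.range f) ≤ 1 := by
    have := Submodule.finrank_le (LinearMap.range f)
    simpa using this
  let g : LinearMap.ker f →ₗ[ℤ] (L d ⧸ HA) :=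
    HA.mkQ ∘ₗ HF.subtype ∘ₗ (LinearMap.ker f).subtype
  have h3 := finrank_rn g
  have h4 : Module.finrank ℤ (LinearMap.range g) = 0 := by
    rw [Module.finrank_eq_zero_iff_isTorsion]
    rintro ⟨_, ⟨⟨⟨x, hxF⟩, hxk⟩, rfl⟩⟩
    have hlx : l x = 0 := hxk
    have hx0 : HA.mkQ x ∈ Submodule.torsion ℤ (L d ⧸ HA) := by
      rw [← Submodule.Quotient.mk_eq_zero, ← Module.forall_dual_apply_eq_zero_iff ℤ]
      intro φ
      let m : L d →ₗ[ℤ] ℤ := φ ∘ₗ (Submodule.mkQ _) ∘ₗ HA.mkQ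
      have hm : ∀ a ∈ A, m a = 0 := by
        intro a ha
        have : HA.mkQ a = 0 := by
          rw [Submodule.mkQ_apply, Submodule.Quotient.mk_eq_zero]
          exact AddSubgroup.subset_closure ha
        simp [m, this]
      have hz := vanish_span (A := F) (l := (l v) • m - (m v) • l) (by
        intro x hx
        have := hprop m hm x hx
        simp [this]) x hxF
      simp [hlx] at hz
      rcases hz with h | h
      · exact absurd h hlv
      · exact h
    obtain ⟨a, ha⟩ := hx0
    exact ⟨a, Subtype.ext ha⟩
  let g' : LinearMap.ker g →ₗ[ℤ] HA :=
    LinearMap.codRestrict _ (HF.subtype ∘ₗ (LinearMap.ker f).subtype ∘ₗ (LinearMap.ker g).subtype)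
     (by
      rintro ⟨x, hx⟩
      have : HA.mkQ (x : HF) = 0 := hx
      rw [Submodule.mkQ_apply, Submodule.Quotient.mk_eq_zero] at this
      exact this)
  have hg : Function.Injective g' := by
    intro x y hxy
    have := congrArg (fun z : HA => (z : L d)) hxy
    exact Subtype.ext (Subtype.ext (Subtype.ext this))
  have h5 := LinearMap.finrank_le_finrank_of_injective hg
  omega

lemma face_le {F : AddSubmonoid (L d)} (hF : IsFace Q F) : F ≤ Q := by
  obtain ⟨m, hm, hmF⟩ := hF
  intro x hx
  have : x ∈ (F : Set (L d)) := hx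
  rw [hmF] at this
  exact this.1

lemma face_split {F : AddSubmonoid (L d)} (hF : IsFace Q F) {x y : L d} (hx : x ∈ Q) (hy : y ∈ Q)
    (h : x + y ∈ F) : x ∈ F ∧ y ∈ F := by
  obtain ⟨m, hm, hmF⟩ := hF
  have hF' : ∀ z, z ∈ F ↔ z ∈ Q ∧ m z = 0 := fun z => by
    rw [← SetLike.mem_coe, hmF]; rfl
  rw [hF'] at h
  have h1 := hm x hx
  have h2 := hm y hy
  have h3 := h.2
  rw [map_add] at h3
  exact ⟨(hF' x).2 ⟨hx, by omega⟩, (hF' y).2 ⟨hy, by omega⟩⟩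

/-- a functional exposing a face -/
lemma face_fun {F : AddSubmonoid (L d)} (hF : IsFace Q F) :
    ∃ m : L d →ₗ[ℤ] ℤ, (∀ x ∈ Q, 0 ≤ m x) ∧ (∀ x ∈ F, m x = 0) ∧
      (∀ x ∈ Q, x ∉ F → 0 < m x) := by
  obtain ⟨m, hm, hmF⟩ := hF
  have hF' : ∀ z, z ∈ F ↔ z ∈ Q ∧ m z = 0 := fun z => by
    rw [← SetLike.mem_coe, hmF]; rfl
  refine ⟨m, hm, fun x hx => ((hF' x).1 hx).2, fun x hx hxF => ?_⟩
  rcases (hm x hx).lt_or_eq with h | h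
  · exact h
  · exact absurd ((hF' x).2 ⟨hx, h.symm⟩) hxF

lemma face_of_face (hQ : Q.FG) {F : AddSubmonoid (L d)} (hF : IsFace Q F) (l : L d →ₗ[ℤ] ℤ)
    (hl : ∀ x ∈ F, 0 ≤ l x) :
    ∃ B, IsFace Q B ∧ ∀ x, x ∈ B ↔ x ∈ F ∧ l x = 0 := by
  obtain ⟨m, hm, hmF, hmF'⟩ := face_fun Q hF
  obtain ⟨S, hS⟩ := hQ
  let N : ℤ := 1 + ∑ s ∈ S, |l s|
  have hN : 0 ≤ ∑ s ∈ S, |l s| := Finset.sum_nonneg fun _ _ => abs_nonneg _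
  have key : ∀ x ∈ Q, 0 ≤ m x ∧ 0 ≤ (l + N • m) x ∧ ((l + N • m) x = 0 → m x = 0) := by
    intro x hx
    rw [← hS] at hx
    induction hx using AddSubmonoid.closure_induction with
    | zero => simp
    | add x y _ _ hx hy =>
      obtain ⟨h1, h2, h3⟩ := hx
      obtain ⟨h4, h5, h6⟩ := hy
      simp only [map_add]
      refine ⟨by omega, by omega, fun h => ?_⟩
      rw [h3 (by omega), h6 (by omega)]; rfl
    | mem s hs =>
      have hsQ : s ∈ Q := hS ▸ AddSubmonoid.subset_closure hs
      by_cases hsF : s ∈ F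
      · have := hl s hsF
        simp [hmF s hsF, this]
      · have h1 := hmF' s hsQ hsF
        have h2 : |l s| ≤ ∑ s ∈ S, |l s| :=
          Finset.single_le_sum (f := fun s => |l s|) (fun _ _ => abs_nonneg _) hs
        have h3 := neg_abs_le (l s)
        have h4 : N ≤ N * m s := le_mul_of_one_le_right (by omega) (by omega)
        have h5 : 0 < (l + N • m) s := by
          simp only [LinearMap.add_apply, LinearMap.smul_apply, smul_eq_mul]
          omega
        exact ⟨h1.le, h5.le, fun h => by omega⟩
  refine ⟨{ carrier := {x | x ∈ Q ∧ (l + N • m) x = 0}, zero_mem' := ⟨Q.zero_mem, by simp⟩, add_mem' := ?_ },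
    ⟨l + N • m, fun x hx => (key x hx).2.1, rfl⟩, ?_⟩
  · rintro x y ⟨h1, h2⟩ ⟨h3, h4⟩
    exact ⟨Q.add_mem h1 h3, by rw [map_add, h2, h4]; rfl⟩
  · intro x
    change x ∈ Q ∧ (l + N • m) x = 0 ↔ _
    constructor
    · rintro ⟨h1, h2⟩
      have h3 := (key x h1).2.2 h2
      refine ⟨?_, ?_⟩
      · by_contra h
        have := hmF' x h1 h
        omega
      · simpa [h3] using h2
    · rintro ⟨h1, h2⟩
      exact ⟨face_le Q hF h1, by simp [h2, hmF x h1]⟩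

/-- minimal ratio -/
lemma min_ratio (hQ : Q.FG) {G : AddSubmonoid (L d)} (hG : IsFace Q G) (lam l : L d →ₗ[ℤ] ℤ)
    (hlam : ∀ x ∈ G, 0 ≤ lam x) (hl : ∀ x ∈ G, lam x = 0 → l x = 0)
    (hne : ∃ x ∈ G, lam x ≠ 0) :
    ∃ v ∈ G, 0 < lam v ∧ ∀ x ∈ G, l v * lam x ≤ lam v * l x := by
  obtain ⟨S, hS⟩ := hQ
  have gen : ∀ p : L d → Prop, p 0 → (∀ x y, p x → p y → p (x + y)) →
      (∀ s ∈ S, s ∈ G → p s) → ∀ x ∈ G, p x := by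
    intro p h0 hadd hgen x hxG
    have hxQ := face_le Q hG hxG
    rw [← hS] at hxQ
    induction hxQ using AddSubmonoid.closure_induction with
    | zero => exact h0
    | mem s hs => exact hgen s hs hxG
    | add x y hx hy ihx ihy =>
      rw [hS] at hx hy
      obtain ⟨h1, h2⟩ := face_split Q hG hx hy hxG
      exact hadd x y (ihx h1) (ihy h2)
  let S' := S.filter fun s => s ∈ G ∧ lam s ≠ 0
  have hS' : S'.Nonempty := by
    by_contra h
    rw [Finset.not_nonempty_iff_eq_empty] at h
    obtain ⟨x, hx, hx0⟩ := hne
    apply hx0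
    refine gen (fun x => lam x = 0) (by simp) (fun x y hx hy => by simp [hx, hy]) ?_ x hx
    intro s hs hsG
    by_contra h0
    have : s ∈ S' := Finset.mem_filter.2 ⟨hs, hsG, h0⟩
    simp [h] at this
  obtain ⟨v, hv, hmin⟩ := Finset.exists_min_image S' (fun s => (l s : ℚ) / lam s) hS'
  obtain ⟨hvS, hvG, hv0⟩ := Finset.mem_filter.1 hv
  have hvpos : 0 < lam v := lt_of_le_of_ne (hlam v hvG) (Ne.symm hv0)
  refine ⟨v, hvG, hvpos, ?_⟩
  refine gen _ (by simp) (fun x y hx hy => by simp only [map_add, mul_add]; omega) ?_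
  intro s hs hsG
  by_cases h0 : lam s = 0
  · simp [h0, hl s hsG h0]
  · have hspos : 0 < lam s := lt_of_le_of_ne (hlam s hsG) (Ne.symm h0)
    have := hmin s (Finset.mem_filter.2 ⟨hs, hsG, h0⟩)
    rw [div_le_div_iff₀ (by exact_mod_cast hvpos) (by exact_mod_cast hspos)] at this
    have h2 : l v * lam s ≤ l s * lam v := by exact_mod_cast this
    linarith

lemma face_dim_lt {A F : AddSubmonoid (L d)} (hA : IsFace Q A) (hF : IsFace Q F) (h : A < F) :
    faceDim A < faceDim F := by
  obtain ⟨m, hm, hm0, hm1⟩ := face_fun Q hA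
  obtain ⟨v, hvF, hvA⟩ := SetLike.exists_of_lt h
  exact faceDim_lt h.le m hm0 v hvF (hm1 v (face_le Q hF hvF) hvA).ne'

lemma diamond (hQ : Q.FG) {A B F : AddSubmonoid (L d)} (h1 : IsFacetOf Q A B)
    (h2 : IsFacetOf Q B F) : ∃ B', B' ≠ B ∧ IsFacetOf Q A B' ∧ IsFacetOf Q B' F := by
  obtain ⟨hA, hB, hAB, d1⟩ := h1
  obtain ⟨-, hF, hBF, d2⟩ := h2
  obtain ⟨a, ha, ha0, ha1⟩ := face_fun Q hA
  obtain ⟨b, hb, hb0, hb1⟩ := face_fun Q hB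
  have hltB : A < B := lt_of_le_of_ne hAB (by rintro rfl; omega)
  have hltF : B < F := lt_of_le_of_ne hBF (by rintro rfl; omega)
  obtain ⟨w, hwB, hwA⟩ := SetLike.exists_of_lt hltB
  obtain ⟨u, huF, huB⟩ := SetLike.exists_of_lt hltF
  have haw := ha1 w (face_le Q hB hwB) hwA
  have hbu := hb1 u (face_le Q hF huF) huB
  obtain ⟨v, hvF, hv, hmin⟩ := min_ratio Q hQ hF a (-b) (fun x hx => ha x (face_le Q hF hx))
    (fun x hx h => by
      have : x ∈ A := by
        by_contra hxA
        have := ha1 x (face_le Q hF hx) hxA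
        omega
      simp [hb0 x (hAB this)]) ⟨w, hBF hwB, haw.ne'⟩
  simp only [LinearMap.neg_apply] at hmin
  obtain ⟨B', hB', hB'm⟩ := face_of_face Q hQ hF (b v • a - a v • b) (fun x hx => by
    have := hmin x hx
    simp only [LinearMap.sub_apply, LinearMap.smul_apply, smul_eq_mul]
    linarith)
  simp only [LinearMap.sub_apply, LinearMap.smul_apply, smul_eq_mul] at hB'm
  have hvB : 0 < b v := by
    have h3 := hmin u huF
    have h4 : 0 < a v * b u := mul_pos hv hbu
    have h5 := ha u (face_le Q hF huF)
    have h6 := hb v (face_le Q hF hvF)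
    rcases h6.lt_or_eq with h | h
    · exact h
    · rw [← h] at h3; linarith
  have hwB' : w ∉ B' := by
    rw [hB'm]
    rintro ⟨-, h⟩
    rw [hb0 w hwB] at h
    have := mul_pos hvB haw
    linarith
  have hvB' : v ∈ B' := (hB'm v).2 ⟨hvF, by ring⟩
  have hAB' : A ≤ B' := fun x hx => (hB'm x).2
    ⟨hBF (hAB hx), by rw [ha0 x hx, hb0 x (hAB hx)]; ring⟩
  have hB'F : B' ≤ F := fun x hx => ((hB'm x).1 hx).1
  have l1 := face_dim_lt Q hA hB' (lt_of_le_of_ne hAB' (by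
    rintro rfl
    rw [ha0 v hvB'] at hv; omega))
  have l2 := face_dim_lt Q hB' hF (lt_of_le_of_ne hB'F (by
    rintro rfl
    exact hwB' (hBF hwB)))
  refine ⟨B', by rintro rfl; exact hwB' hwB, ⟨hA, hB', hAB', by omega⟩, ⟨hB', hF, hB'F, by omega⟩⟩

/-- smallest face containing a point -/
lemma exists_min_face (Φ : Finset (AddSubmonoid (L d))) (hΦ : ∀ G, G ∈ Φ ↔ IsFace Q G)
    (a : L d) (ha : a ∈ Q) : ∃ A, IsFace Q A ∧ a ∈ A ∧ ∀ G, IsFace Q G → a ∈ G → A ≤ G := by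
  have hex : ∀ G : {G // G ∈ Φ}, ∃ m : L d →ₗ[ℤ] ℤ, (∀ x ∈ Q, 0 ≤ m x) ∧
      (∀ x ∈ (G : AddSubmonoid (L d)), m x = 0) ∧
      (∀ x ∈ Q, x ∉ (G : AddSubmonoid (L d)) → 0 < m x) :=
    fun G => face_fun Q ((hΦ _).1 G.2)
  choose m hm hm0 hm1 using hex
  let M : L d →ₗ[ℤ] ℤ := ∑ G : {G // G ∈ Φ},
    if a ∈ (G : AddSubmonoid (L d)) then m G else 0
  have hMx : ∀ x, M x = ∑ G : {G // G ∈ Φ},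
      if a ∈ (G : AddSubmonoid (L d)) then m G x else 0 := by
    intro x
    simp only [M, LinearMap.sum_apply]
    apply Finset.sum_congr rfl
    intro G _
    split_ifs <;> simp
  have hnn : ∀ x ∈ Q, ∀ G : {G // G ∈ Φ}, 0 ≤ if a ∈ (G : AddSubmonoid (L d)) then m G x else 0 := by
    intro x hx G
    split_ifs
    · exact hm G x hx
    · exact le_rfl
  refine ⟨{ carrier := {x | x ∈ Q ∧ M x = 0}, zero_mem' := ⟨Q.zero_mem, by simp⟩, add_mem' := ?_ },
    ⟨M, fun x hx => ?_, rfl⟩, ⟨ha, ?_⟩, ?_⟩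
  · rintro x y ⟨h1, h2⟩ ⟨h3, h4⟩
    exact ⟨Q.add_mem h1 h3, by rw [map_add, h2, h4]; rfl⟩
  · rw [hMx]
    exact Finset.sum_nonneg fun G _ => hnn x hx G
  · rw [hMx]
    apply Finset.sum_eq_zero
    intro G _
    split_ifs with h
    · exact hm0 G a h
    · rfl
  · rintro G hG haG x ⟨hxQ, hx⟩
    rw [hMx, Finset.sum_eq_zero_iff_of_nonneg (fun G _ => hnn x hxQ G)] at hx
    have := hx ⟨G, (hΦ G).2 hG⟩ (Finset.mem_univ _)
    simp only [haG, if_true] at this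
    by_contra hxG
    have h2 := hm1 ⟨G, (hΦ G).2 hG⟩ x hxQ hxG
    omega

end Geom

section Sweep

variable (Φ : Finset (AddSubmonoid (L d)))
variable (ε : AddSubmonoid (L d) → AddSubmonoid (L d) → ℤ)

/-- The matrix of the differential. -/
def eM (a b : {G // G ∈ Φ}) : k :=
  if IsFacetOf Q (a : AddSubmonoid (L d)) b then ((ε a b : ℤ) : k) else 0

variable {Φ ε}

lemma eM_facet {a b : {G // G ∈ Φ}} (h : eM k Q Φ ε a b ≠ 0) :
    IsFacetOf Q (a : AddSubmonoid (L d)) b := by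
  by_contra h'
  exact h (by simp [eM, h'])

lemma eM_ne {a b : {G // G ∈ Φ}} (hε : IsIncidence Q ε)
    (h : IsFacetOf Q (a : AddSubmonoid (L d)) b) : eM k Q Φ ε a b ≠ 0 := by
  rw [eM, if_pos h]
  rcases hε.1 _ _ h with h | h <;> simp [h]

lemma eM_le {a b : {G // G ∈ Φ}} (h : eM k Q Φ ε a b ≠ 0) : a ≤ b :=
  (eM_facet k Q h).2.2.1

lemma eM_sq (hQ : Q.FG) (hΦ : ∀ G, G ∈ Φ ↔ IsFace Q G) (hε : IsIncidence Q ε)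
    (a c : {G // G ∈ Φ}) : ∑ b, eM k Q Φ ε a b * eM k Q Φ ε b c = 0 := by
  by_cases hex : ∃ b : {G // G ∈ Φ}, IsFacetOf Q (a : AddSubmonoid (L d)) b ∧
      IsFacetOf Q (b : AddSubmonoid (L d)) c
  · obtain ⟨b, hb1, hb2⟩ := hex
    obtain ⟨b', hne, hb'1, hb'2⟩ := diamond Q hQ hb1 hb2
    let B' : {G // G ∈ Φ} := ⟨b', (hΦ b').2 hb'1.2.1⟩
    have hr := hε.2 a b b' c hne.symm hb1 hb2 hb'1 hb'2
    rw [Fintype.sum_eq_add b B' (fun h => hne (congrArg Subtype.val h).symm)]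
    · have e1 : eM k Q Φ ε a B' = ((ε a b' : ℤ) : k) := if_pos hb'1
      have e2 : eM k Q Φ ε B' c = ((ε b' c : ℤ) : k) := if_pos hb'2
      rw [e1, e2, eM, eM, if_pos hb1, if_pos hb2]
      exact_mod_cast congrArg (fun z : ℤ => (z : k)) hr
    · rintro b'' ⟨h1, h2⟩
      by_contra h
      have f1 := eM_facet k Q (left_ne_zero_of_mul h)
      have f2 := eM_facet k Q (right_ne_zero_of_mul h)
      have hr2 := hε.2 a b b'' c (fun h => h1 (Subtype.ext h.symm)) hb1 hb2 f1 f2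
      have hr3 := hε.2 a b' b'' c (fun h => h2 (Subtype.ext h.symm)) hb'1 hb'2 f1 f2
      have h0 : ε a b * ε b c = 0 := by omega
      rcases mul_eq_zero.1 h0 with h | h
      · rcases hε.1 _ _ hb1 with h' | h' <;> omega
      · rcases hε.1 _ _ hb2 with h' | h' <;> omega
  · apply Finset.sum_eq_zero
    intro b _
    by_contra h
    exact hex ⟨b, eM_facet k Q (left_ne_zero_of_mul h), eM_facet k Q (right_ne_zero_of_mul h)⟩

/-- Faces in `[A, F]` on which `l` is positive off `A`. -/
def dset (Φ : Finset (AddSubmonoid (L d))) (A F : AddSubmonoid (L d)) (l : L d →ₗ[ℤ] ℤ) :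
    Set {G // G ∈ Φ} :=
  {G | A ≤ (G : AddSubmonoid (L d)) ∧ (G : AddSubmonoid (L d)) ≤ F ∧
    ∀ g ∈ (G : AddSubmonoid (L d)), g ∉ A → 0 < l g}

lemma two_acyc (hΦ : ∀ G, G ∈ Φ ↔ IsFace Q G) (hε : IsIncidence Q ε)
    (A F : {G // G ∈ Φ}) (h : IsFacetOf Q (A : AddSubmonoid (L d)) F) :
    Acyc k (eM k Q Φ ε) {A, F} := by
  have hne : A ≠ F := by rintro rfl; have := h.2.2.2; omega
  have hd : ∀ a : {G // G ∈ Φ}, eM k Q Φ ε a a = 0 := by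
    intro a
    by_contra h
    have := (eM_facet k Q h).2.2.2
    omega
  have hFA : eM k Q Φ ε F A = 0 := by
    by_contra h'
    have h1 := (eM_facet k Q h').2.2.2
    have h2 := h.2.2.2
    omega
  have he := eM_ne k Q hε h
  intro x hx hdx
  have h1 := hdx A (by simp)
  rw [Fintype.sum_eq_add A F hne] at h1
  · rw [hd, zero_mul, zero_add] at h1
    have hxF := (mul_eq_zero.1 h1).resolve_left he
    refine ⟨fun b => if b = F then x A / eM k Q Φ ε A F else 0, ?_, ?_⟩
    · intro a ha
      by_contra h
      apply ha
      refine if_neg ?_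
      rintro rfl
      exact h (by simp)
    · intro a ha
      simp only [mul_ite, mul_zero, Finset.sum_ite_eq', Finset.mem_univ, if_true]
      rcases ha with rfl | ha
      · field_simp
      · have : a = F := ha
        subst this
        rw [hd, hxF, zero_mul]
  · rintro b ⟨hb1, hb2⟩
    have : x b = 0 := by
      by_contra h
      rcases hx b h with h | h
      · exact hb1 h
      · exact hb2 h
    rw [this, mul_zero]

lemma ratio_fun (l lam : L d →ₗ[ℤ] ℤ) (r : ℚ) : ∃ m : L d →ₗ[ℤ] ℤ,
    ∃ D : ℚ, 0 < D ∧ ∀ x, ((m x : ℤ) : ℚ) = D * ((l x : ℚ) - r * (lam x : ℚ)) := by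
  refine ⟨(r.den : ℤ) • l - r.num • lam, r.den, by exact_mod_cast r.den_pos, fun x => ?_⟩
  simp only [LinearMap.sub_apply, LinearMap.smul_apply, smul_eq_mul]
  push_cast
  have : (r.den : ℚ) * r = r.num := Rat.den_mul_eq_num r
  rw [mul_sub, ← mul_assoc, this]

lemma nonprop_acyc (hQ : Q.FG) (hΦ : ∀ G, G ∈ Φ ↔ IsFace Q G) (hε : IsIncidence Q ε)
    (n : ℕ)
    (IH : ∀ (A F : AddSubmonoid (L d)), IsFace Q A → IsFace Q F → A ≤ F →
      faceDim F ≤ faceDim A + n → ∀ l : L d →ₗ[ℤ] ℤ, (∀ a ∈ A, l a = 0) → (∃ f ∈ F, 0 < l f) →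
      Acyc k (eM k Q Φ ε) (dset Φ A F l))
    (A F : AddSubmonoid (L d)) (hA : IsFace Q A) (hF : IsFace Q F) (hAF : A ≤ F)
    (hd : faceDim F ≤ faceDim A + (n + 1)) (l lam : L d →ₗ[ℤ] ℤ) (hl : ∀ a ∈ A, l a = 0)
    (hpos : ∃ f ∈ F, 0 < l f)
    (hlam : ∀ x ∈ Q, 0 ≤ lam x) (hlam0 : ∀ x ∈ A, lam x = 0) (hlam1 : ∀ x ∈ Q, x ∉ A → 0 < lam x)
    (hnp : ∀ v ∈ F, 0 < lam v → ∃ x ∈ F, lam v * l x ≠ l v * lam x) :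
    Acyc k (eM k Q Φ ε) (dset Φ A F l) := by
  have hFQ := face_le Q hF
  have ratio : ∀ (l : L d →ₗ[ℤ] ℤ), (∀ a ∈ A, l a = 0) → ∀ G, IsFace Q G → ¬ G ≤ A →
      ∃ r : ℚ, (∃ v ∈ G, 0 < lam v ∧ (l v : ℚ) = r * lam v) ∧ ∀ x ∈ G, r * lam x ≤ l x := by
    intro l hl G hG hGA
    have hGQ := face_le Q hG
    obtain ⟨w, hwG, hwA⟩ := SetLike.not_le_iff_exists.1 hGA
    obtain ⟨v, hvG, hv, hmin⟩ := min_ratio Q hQ hG lam l (fun x hx => hlam x (hGQ hx))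
      (fun x hx h0 => by
        apply hl
        by_contra hxA
        have := hlam1 x (hGQ hx) hxA
        omega) ⟨w, hwG, (hlam1 w (hGQ hwG) hwA).ne'⟩
    have hv' : (0 : ℚ) < lam v := by exact_mod_cast hv
    refine ⟨(l v : ℚ) / lam v, ⟨v, hvG, hv, by field_simp⟩, fun x hx => ?_⟩
    rw [div_mul_eq_mul_div, div_le_iff₀ hv']
    have := hmin x hx
    have h2 : l v * lam x ≤ l x * lam v := by linarith
    exact_mod_cast h2
  obtain ⟨f0, hf0F, hf0⟩ := hpos
  have hFA : ¬ F ≤ A := fun h => by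
    have := hl f0 (h hf0F)
    omega
  -- maximal ratio
  obtain ⟨R', ⟨v0, hv0F, hv0, hv0e⟩, hR'⟩ := ratio (-l) (fun a ha => by simp [hl a ha]) F hF hFA
  obtain ⟨R, rfl⟩ : ∃ R, R' = -R := ⟨-R', by simp⟩
  have hv0e : (l v0 : ℚ) = R * lam v0 := by
    simp only [LinearMap.neg_apply, Int.cast_neg] at hv0e
    linarith
  have hR : ∀ x ∈ F, (l x : ℚ) ≤ R * lam x := by
    intro x hx
    have := hR' x hx
    simp only [LinearMap.neg_apply, Int.cast_neg] at this
    linarith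
  have hv0' : (0 : ℚ) < lam v0 := by exact_mod_cast hv0
  have hRpos : 0 < R := by
    have h1 := hR f0 hf0F
    have h2 : (0 : ℚ) < l f0 := by exact_mod_cast hf0
    have h3 : (0 : ℚ) ≤ lam f0 := by exact_mod_cast hlam f0 (hFQ hf0F)
    by_contra h
    have := mul_nonneg (not_lt.1 h |> neg_nonneg.2) h3
    linarith
  have hr : ∀ G : {G // G ∈ Φ}, ∃ r : ℚ,
      ((G : AddSubmonoid (L d)) ≤ A → r = R) ∧ (¬ (G : AddSubmonoid (L d)) ≤ A →
        ∃ v ∈ (G : AddSubmonoid (L d)), 0 < lam v ∧ (l v : ℚ) = r * lam v) ∧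
      ∀ x ∈ (G : AddSubmonoid (L d)), r * lam x ≤ l x := by
    intro G
    by_cases h : (G : AddSubmonoid (L d)) ≤ A
    · exact ⟨R, fun _ => rfl, fun h' => absurd h h', fun x hx => by
        simp [hl x (h hx), hlam0 x (h hx)]⟩
    · obtain ⟨r, h1, h2⟩ := ratio l hl G ((hΦ _).1 G.2) h
      exact ⟨r, fun h' => absurd h' h, fun _ => h1, h2⟩
  choose r rA rv rmin using hr
  have hS : ∀ a b c, a ∈ dset Φ A F l → c ∈ dset Φ A F l → a ≤ b → b ≤ c → b ∈ dset Φ A F l := by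
    rintro a b c ⟨ha1, ha2, ha3⟩ ⟨hc1, hc2, hc3⟩ hab hbc
    exact ⟨ha1.trans hab, le_trans hbc hc2, fun g hg hgA => hc3 g (hbc hg) hgA⟩
  have hrR : ∀ b ∈ dset Φ A F l, r b ≤ R := by
    intro b hb
    by_cases h : (b : AddSubmonoid (L d)) ≤ A
    · exact (rA b h).le
    · obtain ⟨v, hvb, hv, hve⟩ := rv b h
      have h1 := hR v (hb.2.1 hvb)
      rw [hve] at h1
      exact le_of_mul_le_mul_right h1 (by exact_mod_cast hv)
  have hmono : ∀ a b, a ∈ dset Φ A F l → b ∈ dset Φ A F l → a ≤ b → r b ≤ r a := by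
    intro a b ha hb hab
    by_cases h : (a : AddSubmonoid (L d)) ≤ A
    · rw [rA a h]; exact hrR b hb
    · obtain ⟨v, hva, hv, hve⟩ := rv a h
      have h1 := rmin b v (hab hva)
      rw [hve] at h1
      exact le_of_mul_le_mul_right h1 (by exact_mod_cast hv)
  have hee := eM_sq k Q hQ hΦ hε
  have hle : ∀ a b : {G // G ∈ Φ}, eM k Q Φ ε a b ≠ 0 → a ≤ b := fun a b h => eM_le k Q h
  refine Acyc.fibers hle hee (fun G => -(r G)) _ (dset Φ A F l) le_rfl hS
    (fun a b ha hb hab => neg_le_neg (hmono a b ha hb hab)) ?_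
  intro a ha
  simp only [neg_inj]
  by_cases hra : r a = R
  · -- the bottom fiber
    rw [hra]
    obtain ⟨m, D, hD, hm⟩ := ratio_fun l lam R
    have hm0 : ∀ x, m x = 0 ↔ (l x : ℚ) = R * lam x := by
      intro x
      rw [← Int.cast_eq_zero (α := ℚ), hm, mul_eq_zero, or_iff_right hD.ne', sub_eq_zero]
    obtain ⟨B, hB, hBm⟩ := face_of_face Q hQ hF (-m) (fun x hx => by
      have : (m x : ℚ) ≤ 0 := by
        rw [hm]
        exact mul_nonpos_of_nonneg_of_nonpos hD.le (sub_nonpos.2 (hR x hx))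
      have : m x ≤ 0 := by exact_mod_cast this
      simpa using this)
    simp only [LinearMap.neg_apply, neg_eq_zero, hm0] at hBm
    have hAB : A ≤ B := fun x hx => (hBm x).2 ⟨hAF hx, by simp [hl x hx, hlam0 x hx]⟩
    have hBF : B ≤ F := fun x hx => ((hBm x).1 hx).1
    have hv0B : v0 ∈ B := (hBm v0).2 ⟨hv0F, hv0e⟩
    have hBF' : B < F := by
      refine lt_of_le_of_ne hBF ?_
      rintro rfl
      obtain ⟨x, hx, hne⟩ := hnp v0 hv0F hv0
      apply hne
      have h1 := ((hBm x).1 hx).2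
      have : (lam v0 : ℚ) * l x = l v0 * lam x := by rw [h1, hv0e]; ring
      exact_mod_cast this
    have hdlt := face_dim_lt Q hB hF hBF'
    have := IH A B hA hB hAB (by omega) lam hlam0 ⟨v0, hv0B, hv0⟩
    convert this using 1
    ext b
    constructor
    · rintro ⟨hb, hrb⟩
      refine ⟨hb.1, fun x hx => ?_, fun g hg hgA => hlam1 g (hFQ (hb.2.1 hg)) hgA⟩
      have h1 := rmin b x hx
      rw [hrb] at h1
      exact (hBm x).2 ⟨hb.2.1 hx, le_antisymm (hR x (hb.2.1 hx)) h1⟩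
    · rintro ⟨hb1, hb2, hb3⟩
      refine ⟨⟨hb1, hb2.trans hBF, fun g hg hgA => ?_⟩, ?_⟩
      · have h1 := ((hBm g).1 (hb2 hg)).2
        have h2 : (0 : ℚ) < lam g := by exact_mod_cast hb3 g hg hgA
        have h3 : (0 : ℚ) < l g := by rw [h1]; exact mul_pos hRpos h2
        exact_mod_cast h3
      · by_cases h : (b : AddSubmonoid (L d)) ≤ A
        · exact rA b h
        · obtain ⟨v, hvb, hv, hve⟩ := rv b h
          have h1 := ((hBm v).1 (hb2 hvb)).2
          rw [hve] at h1
          exact mul_right_cancel₀ (by exact_mod_cast hv.ne') h1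
  · -- the other fibers
    have hraR : r a < R := lt_of_le_of_ne (hrR a ha) hra
    generalize hr0 : r a = r0 at *
    have hr0pos : 0 < r0 := by
      have haA : ¬ (a : AddSubmonoid (L d)) ≤ A := fun h => hra (hr0 ▸ rA a h)
      obtain ⟨v, hva, hv, hve⟩ := rv a haA
      rw [hr0] at hve
      have h1 := ha.2.2 v hva (fun h => by rw [hlam0 v h] at hv; omega)
      have h2 : (0 : ℚ) < l v := by exact_mod_cast h1
      rw [hve] at h2
      exact pos_of_mul_pos_left h2 (by exact_mod_cast hv.le)
    obtain ⟨m, D, hD, hm⟩ := ratio_fun l lam r0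
    have hm0 : ∀ x, m x = 0 ↔ (l x : ℚ) = r0 * lam x := by
      intro x
      rw [← Int.cast_eq_zero (α := ℚ), hm, mul_eq_zero, or_iff_right hD.ne', sub_eq_zero]
    have hmn : ∀ x, 0 ≤ m x ↔ r0 * lam x ≤ (l x : ℚ) := by
      intro x
      rw [← Int.cast_nonneg_iff (R := ℚ), hm, mul_nonneg_iff_of_pos_left hD, sub_nonneg]
    have hmp : ∀ x, 0 < m x ↔ r0 * lam x < (l x : ℚ) := by
      intro x
      rw [← Int.cast_pos (R := ℚ), hm, mul_pos_iff_of_pos_left hD, sub_pos]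
    let K : AddSubmonoid (L d) := (LinearMap.ker m).toAddSubmonoid
    have hK : ∀ x, x ∈ K ↔ m x = 0 := fun x => Iff.rfl
    refine Acyc.fibers hle hee (fun G => (G : AddSubmonoid (L d)) ⊓ K) _ _ le_rfl ?_
      (fun a b _ _ hab => inf_le_inf_right K hab) ?_
    · rintro a b c ⟨ha, hra⟩ ⟨hc, hrc⟩ hab hbc
      have hb := hS a b c ha hc hab hbc
      exact ⟨hb, le_antisymm (hra ▸ hmono a b ha hb hab) (hrc ▸ hmono b c hb hc hbc)⟩
    · rintro b0 ⟨hb0, hrb0⟩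
      obtain ⟨B, hB, hBm⟩ := face_of_face Q hQ ((hΦ _).1 b0.2) m (fun x hx => by
        rw [hmn, ← hrb0]
        exact rmin b0 x hx)
      have hBK : (b0 : AddSubmonoid (L d)) ⊓ K = B := by
        ext x
        rw [AddSubmonoid.mem_inf, hK, hBm]
      rw [hBK]
      have hb0A : ¬ (b0 : AddSubmonoid (L d)) ≤ A := fun h => by
        have := rA b0 h
        rw [hrb0] at this
        exact hraR.ne this
      obtain ⟨v, hvb, hv, hve⟩ := rv b0 hb0A
      rw [hrb0] at hve
      have hvB : v ∈ B := (hBm v).2 ⟨hvb, (hm0 v).2 hve⟩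
      have hAB : A ≤ B := fun x hx => (hBm x).2
        ⟨hb0.1 hx, (hm0 x).2 (by simp [hl x hx, hlam0 x hx])⟩
      have hBF : B ≤ F := fun x hx => hb0.2.1 ((hBm x).1 hx).1
      have hAB' : A < B := by
        refine lt_of_le_of_ne hAB ?_
        rintro rfl
        rw [hlam0 v hvB] at hv; omega
      have hdlt := face_dim_lt Q hA hB hAB'
      have := IH B F hB hF hBF (by omega) m (fun x hx => ((hBm x).1 hx).2) ⟨v0, hv0F, by
        rw [hmp, hv0e]
        exact mul_lt_mul_of_pos_right hraR hv0'⟩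
      convert this using 1
      ext b
      constructor
      · rintro ⟨⟨hb, hrb⟩, hbB⟩
        have hbB : (b : AddSubmonoid (L d)) ⊓ K = B := hbB
        refine ⟨hbB ▸ inf_le_left, hb.2.1, fun g hg hgB => ?_⟩
        have h1 : 0 ≤ m g := by
          rw [hmn, ← hrb]
          exact rmin b g hg
        refine lt_of_le_of_ne h1 fun h0 => hgB ?_
        rw [← hbB]
        exact ⟨hg, h0.symm⟩
      · rintro ⟨hb1, hb2, hb3⟩
        have hbm : ∀ x ∈ (b : AddSubmonoid (L d)), r0 * lam x ≤ (l x : ℚ) := by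
          intro x hx
          rw [← hmn]
          by_cases hxB : x ∈ B
          · exact ((hBm x).1 hxB).2.ge
          · exact (hb3 x hx hxB).le
        refine ⟨⟨⟨hAB.trans hb1, hb2, fun g hg hgA => ?_⟩, ?_⟩, ?_⟩
        · have h1 : (0 : ℚ) < lam g := by exact_mod_cast hlam1 g (hFQ (hb2 hg)) hgA
          have h2 := (mul_pos hr0pos h1).trans_le (hbm g hg)
          exact_mod_cast h2
        · have hbA : ¬ (b : AddSubmonoid (L d)) ≤ A := fun h => by
            have := hlam0 v (h (hb1 hvB))
            omega
          obtain ⟨w, hwb, hw, hwe⟩ := rv b hbA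
          apply le_antisymm
          · have h1 := rmin b v (hb1 hvB)
            rw [hve] at h1
            exact le_of_mul_le_mul_right h1 (by exact_mod_cast hv)
          · have h1 := hbm w hwb
            rw [hwe] at h1
            exact le_of_mul_le_mul_right h1 (by exact_mod_cast hw)
        · change (b : AddSubmonoid (L d)) ⊓ K = B
          apply le_antisymm
          · rintro x ⟨hxb, hxK⟩
            by_contra hxB
            have h1 := hb3 x hxb hxB
            have h2 := (hK x).1 hxK
            omega
          · exact fun x hx => ⟨hb1 hx, ((hBm x).1 hx).2⟩

theorem dset_acyc (hQ : Q.FG) (hΦ : ∀ G, G ∈ Φ ↔ IsFace Q G) (hε : IsIncidence Q ε)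
    (n : ℕ) : ∀ (A F : AddSubmonoid (L d)), IsFace Q A → IsFace Q F → A ≤ F →
      faceDim F ≤ faceDim A + n → ∀ l : L d →ₗ[ℤ] ℤ, (∀ a ∈ A, l a = 0) → (∃ f ∈ F, 0 < l f) →
      Acyc k (eM k Q Φ ε) (dset Φ A F l) := by
  induction n with
  | zero =>
    rintro A F hA hF hAF hd l hl ⟨f, hf, hlf⟩
    have := face_dim_lt Q hA hF (lt_of_le_of_ne hAF (by
      rintro rfl
      have := hl f hf
      omega))
    omega
  | succ n IH =>
    rintro A F hA hF hAF hd l hl ⟨f, hf, hlf⟩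
    obtain ⟨lam, hlam, hlam0, hlam1⟩ := face_fun Q hA
    have hFQ := face_le Q hF
    have hNP := fun l h1 h2 h3 => nonprop_acyc k Q hQ hΦ hε n IH A F hA hF hAF hd l lam h1 h2
      hlam hlam0 hlam1 h3
    by_cases hnp : ∀ v ∈ F, 0 < lam v → ∃ x ∈ F, lam v * l x ≠ l v * lam x
    · exact hNP l hl ⟨f, hf, hlf⟩ hnp
    push Not at hnp
    obtain ⟨v, hvF, hv, hprop⟩ := hnp
    have hlv : 0 < l v := by
      have h1 := hprop f hf
      have h2 := mul_pos hv hlf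
      rw [h1] at h2
      exact pos_of_mul_pos_left h2 (hlam f (hFQ hf))
    have hltAF : A < F := lt_of_le_of_ne hAF (by
      rintro rfl
      have := hl f hf
      omega)
    have hset : dset Φ A F l = {G : {G // G ∈ Φ} | A ≤ (G : AddSubmonoid (L d)) ∧ (G : AddSubmonoid (L d)) ≤ F} := by
      ext G
      constructor
      · rintro ⟨h1, h2, _⟩; exact ⟨h1, h2⟩
      · rintro ⟨h1, h2⟩
        refine ⟨h1, h2, fun g hg hgA => ?_⟩
        have h3 := hprop g (h2 hg)
        have h4 := mul_pos hlv (hlam1 g (hFQ (h2 hg)) hgA)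
        rw [← h3] at h4
        exact pos_of_mul_pos_right h4 hv.le
    rw [hset]
    by_cases hex : ∃ l' : L d →ₗ[ℤ] ℤ, (∀ a ∈ A, l' a = 0) ∧
        ∀ v ∈ F, 0 < lam v → ∃ x ∈ F, lam v * l' x ≠ l' v * lam x
    · obtain ⟨l', hl', hnp'⟩ := hex
      obtain ⟨w, hwF, hw, hmin⟩ := min_ratio Q hQ hF lam l' (fun x hx => hlam x (hFQ hx))
        (fun x hx h0 => by
          apply hl'
          by_contra hxA
          have := hlam1 x (hFQ hx) hxA
          omega) ⟨v, hvF, hv.ne'⟩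
      let m : L d →ₗ[ℤ] ℤ := lam w • l' + (1 - l' w) • lam
      have hm : ∀ x, m x = lam w * l' x + (1 - l' w) * lam x := fun x => rfl
      have hmpos : ∀ x ∈ F, lam x ≤ m x := by
        intro x hx
        have := hmin x hx
        rw [hm]
        linarith
      have := hNP m (fun a ha => by rw [hm, hl' a ha, hlam0 a ha]; ring)
        ⟨v, hvF, hv.trans_le (hmpos v hvF)⟩ (by
          intro u huF hu
          obtain ⟨x, hx, hne⟩ := hnp' u huF hu
          refine ⟨x, hx, fun h => hne ?_⟩
          rw [hm, hm] at h
          have h2 : lam w * (lam u * l' x) = lam w * (l' u * lam x) := by linarith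
          exact mul_left_cancel₀ hw.ne' h2)
      convert this using 1
      ext G
      constructor
      · rintro ⟨h1, h2⟩
        exact ⟨h1, h2, fun g hg hgA => (hlam1 g (hFQ (h2 hg)) hgA).trans_le (hmpos g (h2 hg))⟩
      · rintro ⟨h1, h2, _⟩; exact ⟨h1, h2⟩
    · push Not at hex
      have hd2 := faceDim_le (A := A) (F := F) lam v hv.ne' (by
        intro m hm x hx
        obtain ⟨v', hv'F, hv', hp⟩ := hex m hm
        have h1 := hp x hx
        have h2 := hp v hvF
        apply mul_left_cancel₀ hv'.ne'
        calc lam v' * (lam v * m x) = lam v * (lam v' * m x) := by ring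
          _ = (m v' * lam v) * lam x := by rw [h1]; ring
          _ = lam v' * (m v * lam x) := by rw [← h2]; ring)
      have hd1 := face_dim_lt Q hA hF hltAF
      have hfac : IsFacetOf Q A F := ⟨hA, hF, hAF, by omega⟩
      have := two_acyc k Q hΦ hε ⟨A, (hΦ A).2 hA⟩ ⟨F, (hΦ F).2 hF⟩ hfac
      convert this using 1
      ext G
      constructor
      · rintro ⟨h1, h2⟩
        by_cases hGA : A = G
        · left; exact Subtype.ext hGA.symm
        · right
          by_contra hGF
          have hGF' : (G : AddSubmonoid (L d)) ≠ F := fun h => hGF (Subtype.ext h)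
          have h3 := face_dim_lt Q hA ((hΦ _).1 G.2) (lt_of_le_of_ne h1 hGA)
          have h4 := face_dim_lt Q ((hΦ _).1 G.2) hF (lt_of_le_of_ne h2 hGF')
          omega
      · rintro (h | h)
        · rw [h]; exact ⟨le_rfl, hAF⟩
        · have : G = ⟨F, (hΦ F).2 hF⟩ := h
          rw [this]; exact ⟨hAF, le_rfl⟩

theorem interval_acyc (hQ : Q.FG) (hΦ : ∀ G, G ∈ Φ ↔ IsFace Q G) (hε : IsIncidence Q ε)
    (A F : AddSubmonoid (L d)) (hA : IsFace Q A) (hF : IsFace Q F) (hAF : A < F) :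
    Acyc k (eM k Q Φ ε)
      {G : {G // G ∈ Φ} | A ≤ (G : AddSubmonoid (L d)) ∧ (G : AddSubmonoid (L d)) ≤ F} := by
  obtain ⟨lam, hlam, hlam0, hlam1⟩ := face_fun Q hA
  obtain ⟨v, hvF, hvA⟩ := SetLike.exists_of_lt hAF
  have := dset_acyc k Q hQ hΦ hε (faceDim F) A F hA hF hAF.le (by omega) lam hlam0
    ⟨v, hvF, hlam1 v (face_le Q hF hvF) hvA⟩
  convert this using 1
  ext G
  constructor
  · rintro ⟨h1, h2⟩
    exact ⟨h1, h2, fun g hg hgA => hlam1 g (face_le Q hF (h2 hg)) hgA⟩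
  · rintro ⟨h1, h2, _⟩; exact ⟨h1, h2⟩

end Sweep

section Alg

lemma mem_facePrime {G : AddSubmonoid (L d)} (hG : IsFace Q G) (p : kQ k Q) :
    p ∈ facePrime k Q G ↔ ∀ q : Q, (q : L d) ∈ G → p.coeff q = 0 := by
  have h1 : facePrime k Q G =
      Ideal.span (AddMonoidAlgebra.of' k Q '' {q : Q | (q : L d) ∉ G}) := by
    unfold facePrime
    congr 1
    ext m
    constructor
    · rintro ⟨q, hq, rfl⟩; exact ⟨q, hq, rfl⟩
    · rintro ⟨q, hq, rfl⟩; exact ⟨q, hq, rfl⟩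
  rw [h1, AddMonoidAlgebra.mem_ideal_span_of'_image]
  constructor
  · intro h q hq
    by_contra h0
    obtain ⟨m', hm', d', hd'⟩ := h q (Finsupp.mem_support_iff.2 h0)
    apply hm'
    have : ((d' : L d) + (m' : L d)) ∈ G := by
      have e : (q : L d) = d' + m' := congrArg Subtype.val hd'
      rw [← e]; exact hq
    exact (face_split Q hG d'.2 m'.2 this).2
  · intro h m hm
    refine ⟨m, fun hmG => Finsupp.mem_support_iff.1 hm (h m hmG), 0, by simp⟩

lemma facePrime_prime {G : AddSubmonoid (L d)} (hG : IsFace Q G) :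
    (facePrime k Q G).IsPrime := by
  constructor
  · intro h
    have h1 : (1 : kQ k Q) ∈ facePrime k Q G := by rw [h]; trivial
    have h2 := (mem_facePrime k Q hG _).1 h1 0 G.zero_mem
    rw [AddMonoidAlgebra.one_def, AddMonoidAlgebra.coeff_single, Finsupp.single_eq_same] at h2
    exact one_ne_zero h2
  · intro p p' hpp
    let π : kQ k Q → kQ k Q := fun p =>
      AddMonoidAlgebra.ofCoeff (p.coeff.filter fun q : Q => (q : L d) ∈ G)
    have hπ : ∀ p, p - π p ∈ facePrime k Q G := by
      intro p
      rw [mem_facePrime k Q hG]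
      intro q hq
      have : (p - π p).coeff q = p.coeff q - (p.coeff.filter fun q : Q => (q : L d) ∈ G) q := rfl
      rw [this, Finsupp.filter_apply_pos (fun q : Q => (q : L d) ∈ G) _ hq, sub_self]
    have hπ' : ∀ p q, (π p).coeff q ≠ 0 → (q : L d) ∈ G := by
      intro p q h
      by_contra hq
      exact h (Finsupp.filter_apply_neg (fun q : Q => (q : L d) ∈ G) _ hq)
    have h1 : π p * π p' ∈ facePrime k Q G := by
      have : π p * π p' = p * p' - ((p - π p) * p' + π p * (p' - π p')) := by ring
      rw [this]
      exact Ideal.sub_mem _ hpp (Ideal.add_mem _ (Ideal.mul_mem_right _ _ (hπ p))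
        (Ideal.mul_mem_left _ _ (hπ p')))
    have h2 : π p * π p' = 0 := by
      rw [← AddMonoidAlgebra.coeff_eq_zero]
      ext q
      by_cases hq : (q : L d) ∈ G
      · exact (mem_facePrime k Q hG _).1 h1 q hq
      · rw [Finsupp.zero_apply]
        by_contra h0
        have := AddMonoidAlgebra.support_coeff_mul_subset _ _ (Finsupp.mem_support_iff.2 h0)
        obtain ⟨a, ha, b, hb, hab⟩ := Finset.mem_add.1 this
        apply hq
        rw [← hab]
        exact G.add_mem (hπ' p a (Finsupp.mem_support_iff.1 ha))
          (hπ' p' b (Finsupp.mem_support_iff.1 hb))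
    haveI hU0 : UniqueSums (Fin d → ℤ) := inferInstance
    haveI hU : UniqueSums Q := UniqueSums.of_injective_addHom
      (⟨fun q => (q : L d), fun _ _ => rfl⟩ : AddHom Q (Fin d → ℤ)) Subtype.val_injective hU0
    haveI hN : NoZeroDivisors (kQ k Q) :=
      inferInstanceAs (NoZeroDivisors (AddMonoidAlgebra k Q))
    rcases mul_eq_zero.1 h2 with h | h
    · left; have := hπ p; rwa [h, sub_zero] at this
    · right; have := hπ p'; rwa [h, sub_zero] at this

lemma facePrime_irred {G : AddSubmonoid (L d)} (hG : IsFace Q G) :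
    IsMonomialIdeal k Q (facePrime k Q G) ∧ IsIrreducibleIdeal k Q (facePrime k Q G) := by
  constructor
  · refine ⟨{q : Q | (q : L d) ∉ G}, ?_⟩
    unfold facePrime
    congr 1
    ext m
    constructor
    · rintro ⟨q, hq, rfl⟩; exact ⟨q, hq, rfl⟩
    · rintro ⟨q, hq, rfl⟩; exact ⟨q, hq, rfl⟩
  · intro W₁ W₂ h
    rcases (facePrime_prime k Q hG).inf_le.1 h.ge with h' | h'
    · left; exact le_antisymm (h.le.trans inf_le_left) h'
    · right; exact le_antisymm (h.le.trans inf_le_right) h'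

/-- coefficient of an element of `k[G]` -/
def cf (G : AddSubmonoid (L d)) (x : faceRing k Q G) (q : Q) : k :=
  if (q : L d) ∈ G then (Quotient.out x : kQ k Q).coeff q else 0

variable {k Q}

lemma cf_mk {G : AddSubmonoid (L d)} (hG : IsFace Q G) (p : kQ k Q) (q : Q) :
    cf k Q G (Ideal.Quotient.mk _ p) q = if (q : L d) ∈ G then p.coeff q else 0 := by
  unfold cf
  split_ifs with h
  · have h1 : Ideal.Quotient.mk (facePrime k Q G)
        (Quotient.out (Ideal.Quotient.mk (facePrime k Q G) p)) = Ideal.Quotient.mk _ p :=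
      Quotient.out_eq _
    rw [Ideal.Quotient.eq, mem_facePrime k Q hG] at h1
    exact sub_eq_zero.1 (h1 q h)
  · rfl

lemma cf_ext {G : AddSubmonoid (L d)} (hG : IsFace Q G) (x y : faceRing k Q G)
    (h : ∀ q, cf k Q G x q = cf k Q G y q) : x = y := by
  obtain ⟨p, rfl⟩ := Ideal.Quotient.mk_surjective x
  obtain ⟨p', rfl⟩ := Ideal.Quotient.mk_surjective y
  rw [Ideal.Quotient.eq, mem_facePrime k Q hG]
  intro q hq
  have := h q
  rw [cf_mk hG, cf_mk hG, if_pos hq, if_pos hq] at this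
  exact sub_eq_zero.2 this

lemma cf_add {G : AddSubmonoid (L d)} (hG : IsFace Q G) (x y : faceRing k Q G) (q : Q) :
    cf k Q G (x + y) q = cf k Q G x q + cf k Q G y q := by
  obtain ⟨p, rfl⟩ := Ideal.Quotient.mk_surjective x
  obtain ⟨p', rfl⟩ := Ideal.Quotient.mk_surjective y
  rw [← map_add, cf_mk hG, cf_mk hG, cf_mk hG]
  split_ifs
  · rfl
  · simp

lemma cf_zero {G : AddSubmonoid (L d)} (hG : IsFace Q G) (q : Q) :
    cf k Q G 0 q = 0 := by
  have := cf_mk hG (0 : kQ k Q) q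
  rw [map_zero] at this
  rw [this]; simp

lemma cf_zsmul {G : AddSubmonoid (L d)} (hG : IsFace Q G) (n : ℤ) (x : faceRing k Q G) (q : Q) :
    cf k Q G (n • x) q = (n : k) * cf k Q G x q := by
  let f : faceRing k Q G →+ k := AddMonoidHom.mk' (fun x => cf k Q G x q)
    (fun x y => cf_add hG x y q)
  have := map_zsmul f n x
  exact this.trans (zsmul_eq_mul _ _)

lemma cf_fin {G : AddSubmonoid (L d)} (x : faceRing k Q G) : {q | cf k Q G x q ≠ 0}.Finite := by
  apply ((Quotient.out x : kQ k Q).coeff.support.finite_toSet).subset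
  intro q hq
  refine Finsupp.mem_support_iff.2 fun h => hq ?_
  simp [cf, h]

lemma cf_mem {G : AddSubmonoid (L d)} {x : faceRing k Q G} {q : Q} (h : cf k Q G x q ≠ 0) :
    (q : L d) ∈ G := by
  by_contra h'
  exact h (if_neg h')

variable {Φ : Finset (AddSubmonoid (L d))} {F : AddSubmonoid (L d)}
variable {ε : AddSubmonoid (L d) → AddSubmonoid (L d) → ℤ}

/-- Presentation of a module by coefficient functions. -/
structure Rep (F : AddSubmonoid (L d)) (j : ℕ) {M : Type} [Zero M]
    (phi : M → Q → {G // G ∈ Φ} → k) : Prop where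
  inj : ∀ y y', phi y = phi y' → y = y'
  zero : phi 0 = 0
  supp : ∀ y q G, phi y q G ≠ 0 → ((G : AddSubmonoid (L d)) ≤ F ∧
    faceDim (G : AddSubmonoid (L d)) + j = faceDim F) ∧ (q : L d) ∈ (G : AddSubmonoid (L d))
  fin : ∀ y, {q | phi y q ≠ 0}.Finite
  surj : ∀ z : Q → {G // G ∈ Φ} → k, {q | z q ≠ 0}.Finite →
    (∀ q G, z q G ≠ 0 → ((G : AddSubmonoid (L d)) ≤ F ∧
      faceDim (G : AddSubmonoid (L d)) + j = faceDim F) ∧ (q : L d) ∈ (G : AddSubmonoid (L d))) →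
    ∃ y, phi y = z

theorem exact_of_rep (hQ : Q.FG) (hF : IsFace Q F) (hΦ : ∀ G, G ∈ Φ ↔ IsFace Q G)
    (hε : IsIncidence Q ε) {M₁ M₂ M₃ : Type} [Zero M₁] [Zero M₂] [Zero M₃] (j : ℕ)
    {p₁ : M₁ → Q → {G // G ∈ Φ} → k} {p₂ : M₂ → Q → {G // G ∈ Φ} → k}
    {p₃ : M₃ → Q → {G // G ∈ Φ} → k}
    (h₁ : Rep F j p₁) (h₂ : Rep F (j+1) p₂) (h₃ : Rep F (j+2) p₃)
    (d₁ : M₁ → M₂) (d₂ : M₂ → M₃)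
    (hd₁ : ∀ y q G, p₂ (d₁ y) q G = if (q : L d) ∈ (G : AddSubmonoid (L d)) then
      ∑ b, eM k Q Φ ε G b * p₁ y q b else 0)
    (hd₂ : ∀ y q G, p₃ (d₂ y) q G = if (q : L d) ∈ (G : AddSubmonoid (L d)) then
      ∑ b, eM k Q Φ ε G b * p₂ y q b else 0) :
    Function.Exact d₁ d₂ := by
  intro y
  constructor
  · intro hy
    have hz : ∀ q : Q, ∃ z : {G // G ∈ Φ} → k, (∀ G, z G ≠ 0 → ((G : AddSubmonoid (L d)) ≤ F ∧
        faceDim (G : AddSubmonoid (L d)) + j = faceDim F) ∧ (q : L d) ∈ (G : AddSubmonoid (L d))) ∧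
        (p₂ y q = 0 → z = 0) ∧ ∀ G, p₂ y q G = if (q : L d) ∈ (G : AddSubmonoid (L d)) then
          ∑ b, eM k Q Φ ε G b * z b else 0 := by
      intro q
      by_cases h0 : p₂ y q = 0
      · exact ⟨0, by simp, fun _ => rfl, fun G => by simp [h0]⟩
      obtain ⟨G₀, hG₀⟩ := Function.ne_iff.1 h0
      obtain ⟨⟨hG₀F, hG₀d⟩, hqG₀⟩ := h₂.supp y q G₀ hG₀
      obtain ⟨A, hA, hqA, hAmin⟩ := exists_min_face Q Φ hΦ q q.2
      have hAG₀ := hAmin G₀ ((hΦ _).1 G₀.2) hqG₀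
      have hAF : A < F := lt_of_le_of_lt hAG₀ (lt_of_le_of_ne hG₀F (fun h => by
        rw [h] at hG₀d; omega))
      have hmem : ∀ G : {G // G ∈ Φ}, (q : L d) ∈ (G : AddSubmonoid (L d)) ↔
          A ≤ (G : AddSubmonoid (L d)) := fun G =>
        ⟨fun h => hAmin G ((hΦ _).1 G.2) h, fun h => h hqA⟩
      obtain ⟨z, hz1, hz2⟩ := interval_acyc k Q hQ hΦ hε A F hA hF hAF (p₂ y q)
        (fun G hG => ⟨(hmem G).1 (h₂.supp y q G hG).2, (h₂.supp y q G hG).1.1⟩)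
        (fun G hG => by
          have := hd₂ y q G
          rw [hy, h₃.zero, if_pos ((hmem G).2 hG.1)] at this
          exact this.symm)
      refine ⟨fun G => if faceDim (G : AddSubmonoid (L d)) + j = faceDim F then z G else 0,
        ?_, fun h => absurd h h0, ?_⟩
      · intro G hG
        by_cases hdG : faceDim (G : AddSubmonoid (L d)) + j = faceDim F
        · simp only [hdG, if_true] at hG
          have := hz1 G hG
          exact ⟨⟨this.2, hdG⟩, (hmem G).2 this.1⟩
        · simp [hdG] at hG
      · intro G
        split_ifs with hqG
        · by_cases hdG : faceDim (G : AddSubmonoid (L d)) + (j + 1) = faceDim F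
          · by_cases hGF : (G : AddSubmonoid (L d)) ≤ F
            · rw [hz2 G ⟨(hmem G).1 hqG, hGF⟩]
              apply Finset.sum_congr rfl
              intro b _
              by_cases he : eM k Q Φ ε G b = 0
              · simp [he]
              · have := (eM_facet k Q he).2.2.2
                have hb : faceDim (b : AddSubmonoid (L d)) + j = faceDim F := by omega
                simp only [hb, if_true]
            · have e1 : p₂ y q G = 0 := by
                by_contra h
                exact hGF (h₂.supp y q G h).1.1
              rw [e1, eq_comm]
              apply Finset.sum_eq_zero
              intro b _
              by_contra h
              have hb := right_ne_zero_of_mul h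
              have hzb : z b ≠ 0 := fun h0 => hb (by simp [h0])
              exact hGF (le_trans (eM_le k Q (left_ne_zero_of_mul h)) (hz1 b hzb).2)
          · have e1 : p₂ y q G = 0 := by
              by_contra h
              exact hdG (h₂.supp y q G h).1.2
            rw [e1, eq_comm]
            apply Finset.sum_eq_zero
            intro b _
            by_contra h
            have hb := right_ne_zero_of_mul h
            have hdb : faceDim (b : AddSubmonoid (L d)) + j = faceDim F := by
              by_contra h'
              exact hb (by simp [h'])
            have := (eM_facet k Q (left_ne_zero_of_mul h)).2.2.2
            omega
        · by_contra h
          exact hqG (h₂.supp y q G h).2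
    choose z hz1 hz2 hz3 using hz
    obtain ⟨x, hx⟩ := h₁.surj z ((h₂.fin y).subset (fun q hq h => hq (hz2 q h))) hz1
    refine ⟨x, h₂.inj _ _ ?_⟩
    funext q G
    rw [hd₁, hz3, hx]
  · rintro ⟨x, rfl⟩
    apply h₃.inj
    rw [h₃.zero]
    funext q G
    rw [hd₂]
    split_ifs with hq
    · have : ∀ b, eM k Q Φ ε G b * p₂ (d₁ x) q b =
          ∑ c, (eM k Q Φ ε G b * eM k Q Φ ε b c) * p₁ x q c := by
        intro b
        by_cases he : eM k Q Φ ε G b = 0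
        · simp [he]
        · rw [hd₁, if_pos (eM_le k Q he hq), Finset.mul_sum]
          simp only [mul_assoc]
      rw [Finset.sum_congr rfl (fun b _ => this b), Finset.sum_comm]
      simp only [← Finset.sum_mul, eM_sq k Q hQ hΦ hε, zero_mul, Finset.sum_const_zero]
      rfl
    · rfl

/-- coefficient functions for the terms of the complex -/
def phiW (k : Type) [Field k] (Q : AddSubmonoid (L d)) (F : AddSubmonoid (L d))
    (Φ : Finset (AddSubmonoid (L d))) (j : ℕ) (y : WMod k Q F Φ j) (q : Q) (G : {G // G ∈ Φ}) : k :=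
  if h : (G : AddSubmonoid (L d)) ≤ F ∧ faceDim (G : AddSubmonoid (L d)) + j = faceDim F
  then cf k Q G (y ⟨G, h⟩) q else 0

/-- coefficient functions for the zeroth term -/
def phi0 (k : Type) [Field k] (Q : AddSubmonoid (L d)) (F : AddSubmonoid (L d))
    (Φ : Finset (AddSubmonoid (L d))) (y : faceRing k Q F) (q : Q) (G : {G // G ∈ Φ}) : k :=
  if (G : AddSubmonoid (L d)) = F then cf k Q F y q else 0

lemma rep_W (hΦ : ∀ G, G ∈ Φ ↔ IsFace Q G) (j : ℕ) : Rep F j (phiW k Q F Φ j) where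
  inj y y' h := by
    apply DFinsupp.ext
    rintro ⟨G, hG⟩
    apply cf_ext ((hΦ _).1 G.2)
    intro q
    have := congrFun (congrFun h q) G
    simp only [phiW, hG, dif_pos, and_self] at this
    exact this
  zero := by
    funext q G
    unfold phiW
    split_ifs with h
    · exact cf_zero ((hΦ _).1 G.2) q
    · rfl
  supp y q G h := by
    unfold phiW at h
    split_ifs at h with h'
    · exact ⟨h', cf_mem h⟩
    · exact absurd rfl h
  fin y := by
    have : {q | phiW k Q F Φ j y q ≠ 0} ⊆ ⋃ G, {q | phiW k Q F Φ j y q G ≠ 0} := by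
      intro q hq
      obtain ⟨G, hG⟩ := Function.ne_iff.1 hq
      exact Set.mem_iUnion.2 ⟨G, hG⟩
    refine (Set.finite_iUnion fun G => ?_).subset this
    unfold phiW
    split_ifs with h
    · exact cf_fin _
    · simp
  surj z hfin hz := by
    have hf : ∀ G, (Function.support fun q => z q G).Finite := fun G =>
      hfin.subset fun q hq h => hq (by simp [h])
    refine ⟨DFinsupp.equivFunOnFintype.symm fun G : WIdx F Φ j => Ideal.Quotient.mk _
      (AddMonoidAlgebra.ofCoeff (Finsupp.ofSupportFinite (fun q => z q G.1) (hf G.1))), ?_⟩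
    funext q G
    unfold phiW
    split_ifs with h
    · have := cf_mk (k := k) ((hΦ _).1 G.2) (AddMonoidAlgebra.ofCoeff
        (Finsupp.ofSupportFinite (fun q => z q G) (hf G))) q
      refine this.trans ?_
      split_ifs with hq
      · rfl
      · by_contra h'
        exact hq (hz q G (Ne.symm h')).2
    · by_contra h'
      exact h (hz q G (Ne.symm h')).1

lemma rep_0 (hF : IsFace Q F) (hΦ : ∀ G, G ∈ Φ ↔ IsFace Q G) : Rep F 0 (phi0 k Q F Φ) where
  inj y y' h := by
    apply cf_ext hF
    intro q
    have := congrFun (congrFun h q) ⟨F, (hΦ F).2 hF⟩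
    simpa [phi0] using this
  zero := by
    funext q G
    simp [phi0, cf_zero hF]
  supp y q G h := by
    unfold phi0 at h
    split_ifs at h with h'
    · refine ⟨⟨h'.le, by rw [h']; rfl⟩, ?_⟩
      rw [h']; exact cf_mem h
    · exact absurd rfl h
  fin y := by
    refine (cf_fin y).subset ?_
    intro q hq
    obtain ⟨G, hG⟩ := Function.ne_iff.1 hq
    unfold phi0 at hG
    split_ifs at hG
    · exact hG
    · exact absurd rfl hG
  surj z hfin hz := by
    have hf : (Function.support fun q => z q ⟨F, (hΦ F).2 hF⟩).Finite :=
      hfin.subset fun q hq h => hq (by simp [h])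
    refine ⟨Ideal.Quotient.mk _
      (AddMonoidAlgebra.ofCoeff (Finsupp.ofSupportFinite _ hf)), ?_⟩
    funext q G
    unfold phi0
    split_ifs with h
    · rw [cf_mk hF]
      obtain rfl : G = ⟨F, (hΦ F).2 hF⟩ := Subtype.ext h
      split_ifs with hq
      · rfl
      · by_contra h'
        exact hq (hz q _ (Ne.symm h')).2
    · by_contra h'
      have h2 := (hz q G (Ne.symm h')).1
      have := face_dim_lt Q ((hΦ _).1 G.2) hF (lt_of_le_of_ne h2.1 h)
      omega

lemma phiW_add (hΦ : ∀ G, G ∈ Φ ↔ IsFace Q G) (j : ℕ) (y y' : WMod k Q F Φ j) (q G) :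
    phiW k Q F Φ j (y + y') q G = phiW k Q F Φ j y q G + phiW k Q F Φ j y' q G := by
  unfold phiW
  split_ifs with h
  · rw [DirectSum.add_apply]; exact cf_add ((hΦ _).1 G.2) _ _ q
  · simp

/-- the component of the differential on `k[H]` -/
def compD (k : Type) [Field k] (Q : AddSubmonoid (L d)) (F : AddSubmonoid (L d))
    (Φ : Finset (AddSubmonoid (L d))) (ε : AddSubmonoid (L d) → AddSubmonoid (L d) → ℤ)
    (H : AddSubmonoid (L d)) (j : ℕ) : faceRing k Q H →ₗ[kQ k Q] WMod k Q F Φ j :=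
  ∑ G : WIdx F Φ j,
    if h : IsFacetOf Q (G : AddSubmonoid (L d)) H
    then (ε (G : AddSubmonoid (L d)) H) •
      ((DirectSum.lof (kQ k Q) _ _ G) ∘ₗ fMap k Q (facePrime_mono k Q h.2.2.1))
    else 0

lemma phi_compD (hΦ : ∀ G, G ∈ Φ ↔ IsFace Q G) (H : {G // G ∈ Φ}) (j : ℕ) (x : faceRing k Q H)
    (hHF : (H : AddSubmonoid (L d)) ≤ F)
    (hHd : faceDim (H : AddSubmonoid (L d)) + j = faceDim F + 1)
    (q : Q) (G : {G // G ∈ Φ}) :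
    phiW k Q F Φ j (compD k Q F Φ ε H j x) q G =
      if (q : L d) ∈ (G : AddSubmonoid (L d)) then eM k Q Φ ε G H * cf k Q H x q else 0 := by
  by_cases hidx : (G : AddSubmonoid (L d)) ≤ F ∧ faceDim (G : AddSubmonoid (L d)) + j = faceDim F
  · have hcomp : (compD k Q F Φ ε H j x) ⟨G, hidx⟩ =
        if h : IsFacetOf Q (G : AddSubmonoid (L d)) H
        then (ε (G : AddSubmonoid (L d)) H) • fMap k Q (facePrime_mono k Q h.2.2.1) x
        else 0 := by
      unfold compD
      rw [LinearMap.sum_apply, DirectSum.sum_apply]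
      rw [Finset.sum_eq_single (⟨G, hidx⟩ : WIdx F Φ j)]
      · split_ifs with h
        · rw [LinearMap.smul_apply, LinearMap.comp_apply, DirectSum.smul_apply,
            DirectSum.lof_apply]
        · rfl
      · intro b _ hb
        split_ifs with h
        · rw [LinearMap.smul_apply, LinearMap.comp_apply, DirectSum.smul_apply,
            DirectSum.lof_eq_of, DirectSum.of_eq_of_ne _ _ _ hb.symm, smul_zero]
        · rfl
      · intro h; exact absurd (Finset.mem_univ _) h
    unfold phiW
    rw [dif_pos hidx, hcomp]
    obtain ⟨p, rfl⟩ := Ideal.Quotient.mk_surjective x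
    by_cases hfac : IsFacetOf Q (G : AddSubmonoid (L d)) H
    · have e1 : fMap k Q (facePrime_mono k Q hfac.2.2.1) (Ideal.Quotient.mk _ p) =
        Ideal.Quotient.mk _ p := rfl
      rw [dif_pos hfac, cf_zsmul hfac.1, e1, cf_mk hfac.1, cf_mk hfac.2.1, eM, if_pos hfac]
      by_cases hq : (q : L d) ∈ (G : AddSubmonoid (L d))
      · rw [if_pos hq, if_pos hq, if_pos (hfac.2.2.1 hq)]
      · rw [if_neg hq, if_neg hq, mul_zero]
    · rw [dif_neg hfac, cf_zero ((hΦ _).1 G.2), eM, if_neg hfac]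
      simp
  · unfold phiW
    rw [dif_neg hidx]
    have : eM k Q Φ ε G H = 0 := by
      by_contra h
      have hfac := eM_facet k Q h
      have := hfac.2.2.2
      exact hidx ⟨hfac.2.2.1.trans hHF, by omega⟩
    simp [this]

lemma phi_wd0 (hF : IsFace Q F) (hΦ : ∀ G, G ∈ Φ ↔ IsFace Q G) (x : faceRing k Q F)
    (q : Q) (G : {G // G ∈ Φ}) :
    phiW k Q F Φ 1 (wd0 k Q F Φ ε x) q G =
      if (q : L d) ∈ (G : AddSubmonoid (L d)) then
        ∑ b, eM k Q Φ ε G b * phi0 k Q F Φ x q b else 0 := by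
  have := phi_compD (F := F) (ε := ε) hΦ ⟨F, (hΦ F).2 hF⟩ 1 x le_rfl rfl q G
  refine this.trans ?_
  split_ifs with hq
  · rw [Finset.sum_eq_single (⟨F, (hΦ F).2 hF⟩ : {G // G ∈ Φ})]
    · simp [phi0]
    · intro b _ hb
      have : (b : AddSubmonoid (L d)) ≠ F := fun h => hb (Subtype.ext h)
      simp [phi0, this]
    · intro h; exact absurd (Finset.mem_univ _) h
  · rfl

lemma phi_wd (hΦ : ∀ G, G ∈ Φ ↔ IsFace Q G) (i : ℕ) (x : WMod k Q F Φ (i+1))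
    (q : Q) (G : {G // G ∈ Φ}) :
    phiW k Q F Φ (i+2) (wd k Q F Φ ε i x) q G =
      if (q : L d) ∈ (G : AddSubmonoid (L d)) then
        ∑ b, eM k Q Φ ε G b * phiW k Q F Φ (i+1) x q b else 0 := by
  induction x using DirectSum.induction_on with
  | zero =>
    rw [map_zero, (rep_W hΦ _).zero, (rep_W hΦ _).zero]
    simp
  | add x y hx hy =>
    rw [map_add, phiW_add hΦ, hx, hy]
    simp only [phiW_add hΦ, mul_add, Finset.sum_add_distrib]
    split_ifs
    · rfl
    · simp
  | of H x =>
    have e1 : wd k Q F Φ ε i (DirectSum.of (fun G : WIdx F Φ (i+1) => faceRing k Q G) H x) =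
        compD k Q F Φ ε H (i+2) x := by
      unfold wd
      rw [← DirectSum.lof_eq_of (kQ k Q), DirectSum.toModule_lof]
      rfl
    rw [e1, phi_compD hΦ H.1 (i+2) x H.2.1 (by have := H.2.2; omega)]
    split_ifs with hq
    · rw [Finset.sum_eq_single H.1]
      · unfold phiW
        rw [dif_pos H.2, DirectSum.of_eq_same]
      · intro b _ hb
        unfold phiW
        split_ifs with h
        · rw [DirectSum.of_eq_of_ne _ _ _ (by rintro rfl; exact hb rfl),
            cf_zero ((hΦ _).1 b.2), mul_zero]
        · rw [mul_zero]
      · intro h; exact absurd (Finset.mem_univ _) h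
    · rfl

lemma ker_wd0 (hQ : Q.FG) (hF : IsFace Q F) (hΦ : ∀ G, G ∈ Φ ↔ IsFace Q G)
    (hε : IsIncidence Q ε) :
    LinearMap.ker (wd0 k Q F Φ ε) = canonicalModule k Q F := by
  apply le_antisymm
  · intro x hx
    rw [LinearMap.mem_ker] at hx
    have hzero : ∀ q : Q, (q : L d) ∈ F → (q : L d) ∉ relint Q F → cf k Q F x q = 0 := by
      intro q hqF hqr
      obtain ⟨A, hA, hqA, hAmin⟩ := exists_min_face Q Φ hΦ q q.2
      have hAF : A < F := by
        refine lt_of_le_of_ne (hAmin F hF hqF) ?_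
        rintro rfl
        exact hqr ⟨hqF, fun G hG hGA hne hqG => hne (le_antisymm hGA (hAmin G hG hqG))⟩
      obtain ⟨z, hz1, hz2⟩ := interval_acyc k Q hQ hΦ hε A F hA hF hAF (phi0 k Q F Φ x q)
        (fun G hG => ⟨hAmin G ((hΦ _).1 G.2) ((rep_0 hF hΦ).supp x q G hG).2,
          ((rep_0 hF hΦ).supp x q G hG).1.1⟩)
        (fun G hG => by
          have := phi_wd0 (ε := ε) hF hΦ x q G
          rw [hx, (rep_W hΦ _).zero, if_pos (hG.1 hqA)] at this
          exact this.symm)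
      have h1 := hz2 ⟨F, (hΦ F).2 hF⟩ ⟨hAF.le, le_rfl⟩
      have h2 : phi0 k Q F Φ x q ⟨F, (hΦ F).2 hF⟩ = cf k Q F x q := by simp [phi0]
      rw [← h2, h1]
      apply Finset.sum_eq_zero
      intro b _
      by_contra h
      have h3 := eM_facet k Q (left_ne_zero_of_mul h)
      have h4 := (hz1 b (right_ne_zero_of_mul h)).2
      have h5 : (b : AddSubmonoid (L d)) = F := le_antisymm h4 h3.2.2.1
      have h6 := h3.2.2.2
      rw [h5] at h6
      simp at h6
    obtain ⟨p, rfl⟩ := Ideal.Quotient.mk_surjective x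
    have hsum : p = ∑ q ∈ p.coeff.support, AddMonoidAlgebra.single q (p.coeff q) := by
      rw [← AddMonoidAlgebra.coeff_inj, AddMonoidAlgebra.coeff_sum]
      exact (Finsupp.sum_single p.coeff).symm
    have hmem : ∀ q : Q, Ideal.Quotient.mk (facePrime k Q F)
        (AddMonoidAlgebra.single q (p.coeff q)) ∈ canonicalModule k Q F := by
      intro q
      by_cases hq : (q : L d) ∈ relint Q F
      · have e1 : (AddMonoidAlgebra.single q (p.coeff q) : kQ k Q) =
            AddMonoidAlgebra.single 0 (p.coeff q) * mono k Q q := by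
          rw [mono, AddMonoidAlgebra.single_mul_single]; simp
        rw [e1, map_mul]
        exact Submodule.smul_mem (canonicalModule k Q F)
          (AddMonoidAlgebra.single 0 (p.coeff q)) (Submodule.subset_span ⟨q, hq, rfl⟩)
      · have : Ideal.Quotient.mk (facePrime k Q F)
            (AddMonoidAlgebra.single q (p.coeff q)) = 0 := by
          rw [Ideal.Quotient.eq_zero_iff_mem, mem_facePrime k Q hF]
          intro q' hq'
          rw [AddMonoidAlgebra.coeff_single]
          by_cases hqq : q = q'
          · subst hqq
            rw [Finsupp.single_eq_same]
            have := hzero q hq' hq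
            rwa [cf_mk hF, if_pos hq'] at this
          · simp [Finsupp.single_apply, hqq]
        rw [this]; exact Submodule.zero_mem _
    rw [hsum, map_sum]
    exact Submodule.sum_mem _ fun q _ => hmem q
  · unfold canonicalModule
    rw [Submodule.span_le]
    rintro _ ⟨q, hq, rfl⟩
    rw [SetLike.mem_coe, LinearMap.mem_ker]
    apply (rep_W hΦ 1).inj
    rw [(rep_W hΦ _).zero]
    funext q' G
    rw [phi_wd0 hF hΦ]
    split_ifs with hq'
    · apply Finset.sum_eq_zero
      intro b _
      by_contra h
      have hfac := eM_facet k Q (left_ne_zero_of_mul h)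
      have h2 := right_ne_zero_of_mul h
      unfold phi0 at h2
      split_ifs at h2 with hb
      · rw [cf_mk hF] at h2
        split_ifs at h2 with hq'F
        · rw [mono, AddMonoidAlgebra.coeff_single] at h2
          have hqq : q = q' := by
            by_contra hne
            exact h2 (by simp [Finsupp.single_apply, hne])
          subst hqq
          rw [hb] at hfac
          refine hq.2 G hfac.1 hfac.2.2.1 ?_ hq'
          intro h
          have := hfac.2.2.2
          rw [h] at this
          omega
        · exact h2 rfl
      · exact h2 rfl
    · rfl

end Alg

/-- **Statement 18.**  For a face `F` of `Q`, the complex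
`0 → k[F] → ⊕_{facets G ⊂ F} k[G] → ⋯ → ⊕_{rays v ⊆ F} k[v] → k → 0`
(with differentials given by the incidence function) is exact except at the leftmost
term, the kernel of the first map being the canonical module `ω_{k[F]}`; each of its
terms is a direct sum of quotients of `k[Q]` by irreducible monomial ideals, so it is
an irreducible resolution of `ω_{k[F]}`. -/
theorem face_ring_complex_resolves_canonical_module
    (hQ : IsNormalAffineSemigroup Q)
    (F : AddSubmonoid (L d)) (hF : IsFace Q F)
    (Φ : Finset (AddSubmonoid (L d))) (hΦ : ∀ G, G ∈ Φ ↔ IsFace Q G)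
    (ε : AddSubmonoid (L d) → AddSubmonoid (L d) → ℤ) (hε : IsIncidence Q ε) :
    LinearMap.ker (wd0 k Q F Φ ε) = canonicalModule k Q F ∧
    Function.Exact ⇑(wd0 k Q F Φ ε) ⇑(wd k Q F Φ ε 0) ∧
    (∀ i : ℕ, Function.Exact ⇑(wd k Q F Φ ε i) ⇑(wd k Q F Φ ε (i+1))) ∧
    (∀ G : AddSubmonoid (L d), IsFace Q G →
      IsMonomialIdeal k Q (facePrime k Q G) ∧
      IsIrreducibleIdeal k Q (facePrime k Q G)) := by
  refine ⟨ker_wd0 hQ.fg hF hΦ hε, ?_, fun i => ?_, fun G hG => facePrime_irred k Q hG⟩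
  · exact exact_of_rep hQ.fg hF hΦ hε 0 (rep_0 hF hΦ) (rep_W hΦ 1) (rep_W hΦ 2) _ _
      (phi_wd0 hF hΦ) (phi_wd hΦ 0)
  · exact exact_of_rep hQ.fg hF hΦ hε (i+1) (rep_W hΦ (i+1)) (rep_W hΦ (i+2)) (rep_W hΦ (i+3)) _ _
      (phi_wd hΦ i) (phi_wd hΦ (i+1))


end ZMS
end
end
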